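/- Let f ∈ ℤ[x] be a polynomial of even degree d ≥ 2 such that f(t) > 0 for all t ∈ ℝ and whose constant coefficient satisfies f(0) = 2^{2a}·(4k + 3) for some nonnegative integers a, k. Then there exist an odd natural number N and ℓ ∈ ℕ such that f(x) − (2^{−ℓ}·x^{d/2} + 2^a/N)² is a sum of four squares in ℚ[x]. -/

import Mathlib

open Polynomial

noncomputable section
open NumberField NumberField.mixedEmbedding NumberField.Units NumberField.Units.dirichletUnitTheorem Module


namespace FSq

/-- The tent function. -/
def tent (y : ℝ) : ℝ := max 0 (1 - |y|)

lemma tent_nonneg (y : ℝ) : 0 ≤ tent y := le_max_left _ _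

lemma tent_le_one (y : ℝ) : tent y ≤ 1 := by
  unfold tent
  exact max_le (by norm_num) (by linarith [abs_nonneg y])

lemma tent_lip (x y : ℝ) : |tent x - tent y| ≤ |x - y| := by
  unfold tent
  have h1 := abs_max_sub_max_le_abs (1 - |x|) (1 - |y|) 0
  rw [max_comm 0, max_comm 0]
  refine h1.trans ?_
  have : 1 - |x| - (1 - |y|) = -(|x| - |y|) := by ring
  rw [this, abs_neg]
  exact abs_abs_sub_abs_le x y

lemma tent_ne_zero {y : ℝ} (h : tent y ≠ 0) : |y| < 1 := by
  by_contra hc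
  apply h
  unfold tent
  exact max_eq_left (by linarith)

/-- the finite set of integers where `tent (y + k)` may be nonzero -/
def tentSupp (y : ℝ) : Finset ℤ := {-⌊y⌋, -⌊y⌋ - 1}

lemma tent_zero_of_notMem (y : ℝ) (k : ℤ) (hk : k ∉ tentSupp y) : tent (y + k) = 0 := by
  by_contra h
  have h2 := abs_lt.mp (tent_ne_zero h)
  apply hk
  have h3 := Int.floor_le y
  have h4 := Int.lt_floor_add_one y
  have h5 : (-2 : ℤ) < ⌊y⌋ + k := by
    have : (-2 : ℝ) < ((⌊y⌋ + k : ℤ) : ℝ) := by push_cast; linarith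
    exact_mod_cast this
  have h6 : ⌊y⌋ + k < 1 := by
    have : ((⌊y⌋ + k : ℤ) : ℝ) < 1 := by push_cast; linarith
    exact_mod_cast this
  simp only [tentSupp, Finset.mem_insert, Finset.mem_singleton]
  omega

lemma tent_sum (y : ℝ) : ∑ k ∈ tentSupp y, tent (y + k) = 1 := by
  have h3 := Int.floor_le y
  have h4 := Int.lt_floor_add_one y
  unfold tentSupp
  rw [Finset.sum_pair (by omega)]
  unfold tent
  push_cast
  rw [abs_of_nonneg (by linarith : 0 ≤ y + -(⌊y⌋ : ℝ)),
    abs_of_nonpos (by linarith : y + (-(⌊y⌋ : ℝ) - 1) ≤ 0), max_eq_right (by linarith),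
    max_eq_right (by linarith)]
  ring

lemma hasSum_tent_pi {ι : Type*} [Fintype ι] [DecidableEq ι] (y : ι → ℝ) :
    HasSum (fun k : ι → ℤ => ∏ i, tent (y i + k i)) 1 := by
  have h : HasSum (fun k : ι → ℤ => ∏ i, tent (y i + k i))
      (∑ k ∈ Fintype.piFinset (fun i => tentSupp (y i)), ∏ i, tent (y i + k i)) := by
    refine hasSum_sum_of_ne_finset_zero (fun k hk => ?_)
    rw [Fintype.mem_piFinset] at hk
    push Not at hk
    obtain ⟨i, hi⟩ := hk
    exact Finset.prod_eq_zero (Finset.mem_univ i) (tent_zero_of_notMem _ _ hi)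
  · rw [← Finset.prod_univ_sum (fun i => tentSupp (y i)) (fun i k => tent (y i + k))] at h
    simpa [tent_sum] using h

variable (K : Type*) [Field K] [NumberField K]

open scoped Classical in
/-- the real basis of the log space given by fundamental units -/
def ulB :
    Basis (Fin (rank K)) ℝ (logSpace K) := (basisUnitLattice K).ofZLatticeBasis ℝ _

variable {K}

/-- weight function -/
def wt (x : mixedSpace K) : ℝ := ∏ i, tent ((ulB K).repr (logMap x) i)

lemma wt_nonneg (x : mixedSpace K) : 0 ≤ wt x := Finset.prod_nonneg fun _ _ => tent_nonneg _

lemma wt_le_one (x : mixedSpace K) : wt x ≤ 1 :=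
  Finset.prod_le_one (fun _ _ => tent_nonneg _) fun _ _ => tent_le_one _

lemma ulB_repr_unit (ζ : torsion K) (e : Fin (rank K) → ℤ) (i : Fin (rank K)) :
    (ulB K).repr (logEmbedding K (Additive.ofMul (ζ.1 * ∏ i, (fundSystem K i) ^ (e i)))) i = e i := by
  have h1 : logEmbedding K (Additive.ofMul (ζ.1 * ∏ i, (fundSystem K i) ^ (e i)))
      = ∑ i, (e i : ℝ) • ulB K i := by
    rw [ofMul_mul, map_add, logEmbedding_eq_zero_iff.mpr ζ.2, zero_add, ofMul_prod, map_sum]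
    refine Finset.sum_congr rfl fun j _ => ?_
    rw [ofMul_zpow, map_zsmul, logEmbedding_fundSystem, ulB, Basis.ofZLatticeBasis_apply]
    rw [Int.cast_smul_eq_zsmul]
  rw [h1]
  simp [Finsupp.single_apply]

/-- units as torsion times powers of fundamental units -/
def unitEquiv : torsion K × (Fin (rank K) → ℤ) ≃ (𝓞 K)ˣ :=
  Equiv.ofBijective (fun p => p.1.1 * ∏ i, (fundSystem K i) ^ (p.2 i)) (by
    constructor
    · intro p q h
      obtain ⟨r, _, hr⟩ := exist_unique_eq_mul_prod K (p.1.1 * ∏ i, (fundSystem K i) ^ (p.2 i))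
      rw [hr p rfl, hr q h]
    · intro x
      obtain ⟨r, h, _⟩ := exist_unique_eq_mul_prod K x
      exact ⟨r, h.symm⟩)

lemma hasSum_finite_prod {α β : Type*} [Finite α] (g : β → ℝ) (hg : ∀ b, 0 ≤ g b) (h : HasSum g 1) :
    HasSum (fun p : α × β => g p.2) (Nat.card α : ℝ) := by
  have := Fintype.ofFinite α
  have h2 : HasSum (fun _ : α => (1:ℝ)) (Nat.card α : ℝ) := by
    have := hasSum_fintype (fun _ : α => (1:ℝ))
    simpa [Nat.card_eq_fintype_card] using this
  have := h2.mul h (h2.summable.mul_of_nonneg h.summable (fun _ => zero_le_one) hg)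
  simpa using this

lemma hasSum_wt {x : mixedSpace K} (hx : mixedEmbedding.norm x ≠ 0) :
    HasSum (fun u : (𝓞 K)ˣ => wt (u • x)) (torsionOrder K : ℝ) := by
  rw [← unitEquiv.hasSum_iff]
  have key : ∀ p : torsion K × (Fin (rank K) → ℤ),
      wt ((unitEquiv p) • x) = ∏ i, tent ((ulB K).repr (logMap x) i + p.2 i) := by
    rintro ⟨ζ, e⟩
    unfold wt
    refine Finset.prod_congr rfl fun i _ => ?_
    rw [logMap_unit_smul _ hx, map_add]
    rw [Finsupp.add_apply, add_comm]
    congr 2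
    exact ulB_repr_unit ζ e i
  have h0 := hasSum_tent_pi (fun i => (ulB K).repr (logMap x) i)
  have h1 := hasSum_finite_prod (α := torsion K) _
    (fun k => Finset.prod_nonneg fun _ _ => tent_nonneg _) h0
  simpa only [Function.comp_def, key, torsionOrder] using h1

end FSq

end

noncomputable section
open NumberField NumberField.mixedEmbedding NumberField.Units NumberField.Units.dirichletUnitTheorem Module
open NumberField.InfinitePlace


namespace FSq

lemma abs_prod_sub_prod_le {ι : Type*} (S : Finset ι) (f g : ι → ℝ)
    (hf : ∀ i, 0 ≤ f i ∧ f i ≤ 1) (hg : ∀ i, 0 ≤ g i ∧ g i ≤ 1) :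
    |∏ i ∈ S, f i - ∏ i ∈ S, g i| ≤ ∑ i ∈ S, |f i - g i| := by
  classical
  induction S using Finset.induction_on with
  | empty => simp
  | insert a S ha ih =>
    rw [Finset.prod_insert ha, Finset.prod_insert ha, Finset.sum_insert ha]
    have h1 : f a * ∏ i ∈ S, f i - g a * ∏ i ∈ S, g i
      = (f a - g a) * ∏ i ∈ S, f i + g a * (∏ i ∈ S, f i - ∏ i ∈ S, g i) := by ring
    rw [h1]
    have h2 : 0 ≤ ∏ i ∈ S, f i := Finset.prod_nonneg fun i _ => (hf i).1
    have h3 : ∏ i ∈ S, f i ≤ 1 := Finset.prod_le_one (fun i _ => (hf i).1) fun i _ => (hf i).2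
    refine (abs_add_le _ _).trans ?_
    rw [abs_mul, abs_mul, abs_of_nonneg h2, abs_of_nonneg (hg a).1]
    have h4 := mul_le_mul_of_nonneg_left h3 (abs_nonneg (f a - g a))
    have h5 := mul_le_mul_of_nonneg_right (hg a).2 (abs_nonneg (∏ i ∈ S, f i - ∏ i ∈ S, g i))
    linarith

lemma log_sub_log_le {a b : ℝ} (ha : 0 < a) (h : |b - a| ≤ a / 2) :
    |Real.log b - Real.log a| ≤ 2 * |b - a| / a := by
  have hb : a / 2 ≤ b := by have := (abs_le.mp h).1; linarith
  have hb0 : 0 < b := by linarith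
  have h1 : Real.log b - Real.log a ≤ (b - a) / a := by
    rw [← Real.log_div hb0.ne' ha.ne']
    refine (Real.log_le_sub_one_of_pos (by positivity)).trans (le_of_eq ?_)
    field_simp
  have h2 : Real.log a - Real.log b ≤ (a - b) / b := by
    rw [← Real.log_div ha.ne' hb0.ne']
    refine (Real.log_le_sub_one_of_pos (by positivity)).trans (le_of_eq ?_)
    field_simp
  have h3 : (a - b) / b ≤ 2 * |b - a| / a := by
    rw [div_le_div_iff₀ hb0 ha]
    have := neg_abs_le (b - a)
    nlinarith [abs_nonneg (b - a)]
  have h4 : (b - a) / a ≤ 2 * |b - a| / a := by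
    rw [div_le_div_iff_of_pos_right ha]
    have := le_abs_self (b - a)
    linarith [abs_nonneg (b - a)]
  rw [abs_le]
  constructor <;> linarith

lemma rpow_neg_sub_le_aux {a b s μ : ℝ} (hμ : 0 < μ) (ha : μ ≤ a) (hab : a ≤ b) (hs : 0 ≤ s) :
    |b ^ (-s) - a ^ (-s)| ≤ s * |Real.log b - Real.log a| * μ ^ (-s) := by
  have ha0 : 0 < a := by linarith
  have hb0 : 0 < b := by linarith
  have hl : Real.log a ≤ Real.log b := Real.log_le_log ha0 hab
  have h1 : a ^ (-s) ≤ μ ^ (-s) := Real.rpow_le_rpow_of_nonpos hμ ha (by linarith)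
  have h2 : b ^ (-s) ≤ a ^ (-s) := Real.rpow_le_rpow_of_nonpos ha0 hab (by linarith)
  rw [abs_sub_comm, abs_of_nonneg (by linarith), abs_of_nonneg (by linarith)]
  have h3 : b ^ (-s) = a ^ (-s) * Real.exp (-(s * (Real.log b - Real.log a))) := by
    rw [Real.rpow_def_of_pos ha0, Real.rpow_def_of_pos hb0, ← Real.exp_add]
    congr 1; ring
  have h4 := Real.add_one_le_exp (-(s * (Real.log b - Real.log a)))
  have h5 : 0 < a ^ (-s) := Real.rpow_pos_of_pos ha0 _
  have h6 : 0 ≤ s * (Real.log b - Real.log a) := mul_nonneg hs (by linarith)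
  rw [h3]
  nlinarith [mul_le_mul_of_nonneg_left h1 h6, mul_le_mul_of_nonneg_left h4 h5.le]

lemma rpow_neg_sub_le {a b s μ : ℝ} (hμ : 0 < μ) (ha : μ ≤ a) (hb : μ ≤ b) (hs : 0 ≤ s) :
    |b ^ (-s) - a ^ (-s)| ≤ s * |Real.log b - Real.log a| * μ ^ (-s) := by
  rcases le_total a b with h | h
  · exact rpow_neg_sub_le_aux hμ ha h hs
  · rw [abs_sub_comm, abs_sub_comm (Real.log b)]
    exact rpow_neg_sub_le_aux hμ hb h hs

open scoped Classical

variable {K : Type*} [Field K] [NumberField K]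

lemma normAtPlace_le_norm (w : InfinitePlace K) (x : mixedSpace K) : normAtPlace w x ≤ ‖x‖ := by
  rw [norm_eq_sup'_normAtPlace]
  exact Finset.le_sup' (fun w => normAtPlace w x) (Finset.mem_univ w)

lemma exists_normAtPlace_eq (x : mixedSpace K) : ∃ w : InfinitePlace K, ‖x‖ = normAtPlace w x := by
  rw [norm_eq_sup'_normAtPlace]
  obtain ⟨w, _, hw⟩ := Finset.exists_mem_eq_sup' (s := (Finset.univ : Finset (InfinitePlace K)))
    Finset.univ_nonempty (fun w => normAtPlace w x)
  exact ⟨w, hw⟩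

lemma log_norm_eq (x : mixedSpace K) (hx : mixedEmbedding.norm x ≠ 0) :
    Real.log (mixedEmbedding.norm x) = ∑ w, (mult w : ℝ) * Real.log (normAtPlace w x) := by
  rw [mixedEmbedding.norm_apply, Real.log_prod]
  · simp [Real.log_pow]
  · intro w _
    exact pow_ne_zero _ (mixedEmbedding.norm_ne_zero_iff.mp hx w)

variable (K) in
lemma support_bound : ∃ κ : ℝ, 0 < κ ∧ κ ≤ 1 ∧ ∀ x : mixedSpace K, mixedEmbedding.norm x ≠ 0 →
    wt x ≠ 0 → ∀ w, κ * ‖x‖ ≤ normAtPlace w x := by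
  set B : ℝ := ∑ i, ∑ w, |ulB K i w| with hB
  have hB0 : 0 ≤ B := Finset.sum_nonneg fun _ _ => Finset.sum_nonneg fun _ _ => abs_nonneg _
  set q : ℝ := (Fintype.card {w : InfinitePlace K // w ≠ w₀} : ℝ) with hq
  have hq0 : 0 ≤ q := Nat.cast_nonneg _
  set B' : ℝ := B + q * B with hB'
  have hB'0 : 0 ≤ B' := add_nonneg hB0 (mul_nonneg hq0 hB0)
  refine ⟨Real.exp (-(2 * B')), Real.exp_pos _, Real.exp_le_one_iff.mpr (by linarith), ?_⟩
  intro x hx hw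
  set n : ℝ := (finrank ℚ K : ℝ)
  have hn : n ≠ 0 := Nat.cast_ne_zero.mpr finrank_pos.ne'
  set d : InfinitePlace K → ℝ := fun w => Real.log (normAtPlace w x) -
      Real.log (mixedEmbedding.norm x) * n⁻¹ with hd
  have hsum : ∑ w, (mult w : ℝ) * d w = 0 := by
    simp only [hd, mul_sub]
    rw [Finset.sum_sub_distrib, ← log_norm_eq x hx, ← Finset.sum_mul, ← Nat.cast_sum, sum_mult_eq]
    field_simp
    simp [n]
  have h1 : ∀ w : {w : InfinitePlace K // w ≠ w₀}, |logMap x w| ≤ B := by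
    intro w
    have h2 : logMap x w = ∑ i, (ulB K).repr (logMap x) i * ulB K i w := by
      conv_lhs => rw [← (ulB K).sum_repr (logMap x)]
      simp [Finset.sum_apply]
    rw [h2]
    refine (Finset.abs_sum_le_sum_abs _ _).trans ?_
    refine Finset.sum_le_sum fun i _ => ?_
    rw [abs_mul]
    have h3 : tent ((ulB K).repr (logMap x) i) ≠ 0 :=
      (Finset.prod_ne_zero_iff.mp hw) i (Finset.mem_univ i)
    have h4 := tent_ne_zero h3
    have h5 : |ulB K i w| ≤ ∑ w, |ulB K i w| :=
      Finset.single_le_sum (f := fun w => |ulB K i w|) (fun _ _ => abs_nonneg _) (Finset.mem_univ w)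
    have h6 := mul_le_mul_of_nonneg_right h4.le (abs_nonneg (ulB K i w))
    linarith
  have h2 : ∀ w, |d w| ≤ B' := by
    have aux : ∀ w, |(mult w : ℝ) * d w| ≤ B' → |d w| ≤ B' := by
      intro w h
      rw [abs_mul, abs_of_nonneg (by positivity)] at h
      have := mul_le_mul_of_nonneg_right (one_le_mult (w := w)) (abs_nonneg (d w))
      linarith
    intro w
    apply aux
    by_cases hw0 : w = w₀
    · have h3 : (mult w : ℝ) * d w = - ∑ v : {w : InfinitePlace K // w ≠ w₀}, logMap x v := by
        rw [← Fintype.sum_subtype_add_sum_subtype (fun w => w ≠ w₀) (fun w => (mult w : ℝ) * d w)] at hsum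
        have h4 : ∑ v : {w : InfinitePlace K // ¬ (w ≠ w₀)}, (mult v.1 : ℝ) * d v = mult w * d w := by
          rw [Fintype.sum_eq_single ⟨w, by simpa using hw0⟩]
          rintro ⟨v, hv⟩ hne
          exact absurd (Subtype.ext ((not_not.mp hv).trans hw0.symm)) hne
        rw [h4] at hsum
        have h5 : ∑ v : {w : InfinitePlace K // w ≠ w₀}, logMap x v
          = ∑ v : {w : InfinitePlace K // w ≠ w₀}, (mult v.1 : ℝ) * d v :=
          Finset.sum_congr rfl fun v _ => logMap_apply x v
        rw [h5]; linarith
      rw [h3, abs_neg]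
      refine (Finset.abs_sum_le_sum_abs _ _).trans ?_
      refine (Finset.sum_le_sum fun v _ => h1 v).trans ?_
      simp only [Finset.sum_const, Finset.card_univ, nsmul_eq_mul]
      change q * B ≤ _
      linarith
    · have := h1 ⟨w, hw0⟩
      rw [logMap_apply] at this
      refine this.trans ?_
      have := mul_nonneg hq0 hB0
      linarith
  intro w
  obtain ⟨v, hv⟩ := exists_normAtPlace_eq x
  have hpos : ∀ w, 0 < normAtPlace w x := fun w =>
    lt_of_le_of_ne (normAtPlace_nonneg _ _) (mixedEmbedding.norm_ne_zero_iff.mp hx w).symm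
  rw [hv, ← Real.exp_log (hpos v), ← Real.exp_log (hpos w), ← Real.exp_add, Real.exp_le_exp]
  have h3 := (abs_le.mp (h2 v)).2
  have h4 := (abs_le.mp (h2 w)).1
  simp only [hd] at h3 h4
  linarith

/-- weighted norm power -/
def G (s : ℝ) (x : mixedSpace K) : ℝ := wt x * mixedEmbedding.norm x ^ (-s)

lemma G_nonneg (s : ℝ) (x : mixedSpace K) : 0 ≤ G s x :=
  mul_nonneg (wt_nonneg x) (Real.rpow_nonneg (mixedEmbedding.norm_nonneg x) _)

lemma G_ne_zero {s : ℝ} (hs : 1 ≤ s) {x : mixedSpace K} (h : G s x ≠ 0) :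
    mixedEmbedding.norm x ≠ 0 ∧ wt x ≠ 0 := by
  refine ⟨fun h0 => h ?_, left_ne_zero_of_mul h⟩
  rw [G, h0, Real.zero_rpow (by linarith), mul_zero]

lemma norm_ge_pow {x : mixedSpace K} {μ : ℝ} (hμ : 0 ≤ μ) (h : ∀ w, μ ≤ normAtPlace w x) :
    μ ^ finrank ℚ K ≤ mixedEmbedding.norm x := by
  rw [mixedEmbedding.norm_apply, ← sum_mult_eq, ← Finset.prod_pow_eq_pow_sum]
  exact Finset.prod_le_prod (fun _ _ => pow_nonneg hμ _) fun w _ => pow_le_pow_left₀ hμ (h w) _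

variable (K) in
lemma G_le : ∃ C : ℝ, 0 < C ∧ ∀ s : ℝ, 1 ≤ s → s ≤ 2 → ∀ x : mixedSpace K,
    G s x ≤ C * ‖x‖ ^ (-(finrank ℚ K * s)) := by
  obtain ⟨κ, hκ, hκ1, hs⟩ := support_bound K
  refine ⟨κ ^ (-(finrank ℚ K * 2 : ℝ)), Real.rpow_pos_of_pos hκ _, fun s h1 h2 x => ?_⟩
  by_cases h : G s x = 0
  · rw [h]; positivity
  obtain ⟨hx, hw⟩ := G_ne_zero h1 h
  have hx0 : 0 < ‖x‖ := by
    rw [norm_pos_iff]; rintro rfl; simp at hx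
  have h3 := norm_ge_pow (by positivity) (hs x hx hw)
  have h4 : G s x ≤ (κ * ‖x‖) ^ (-(finrank ℚ K * s)) := by
    calc G s x ≤ 1 * mixedEmbedding.norm x ^ (-s) :=
        mul_le_mul_of_nonneg_right (wt_le_one x) (Real.rpow_nonneg (mixedEmbedding.norm_nonneg x) _)
      _ ≤ ((κ * ‖x‖) ^ finrank ℚ K) ^ (-s) := by
        rw [one_mul]
        exact Real.rpow_le_rpow_of_nonpos (by positivity) h3 (by linarith)
      _ = (κ * ‖x‖) ^ (-(finrank ℚ K * s)) := by
        rw [← Real.rpow_natCast, ← Real.rpow_mul (by positivity)]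
        congr 1; ring
  refine h4.trans ?_
  rw [Real.mul_rpow hκ.le hx0.le]
  refine mul_le_mul_of_nonneg_right ?_ (by positivity)
  apply Real.rpow_le_rpow_of_exponent_ge hκ hκ1
  have : (0:ℝ) ≤ finrank ℚ K := Nat.cast_nonneg _
  nlinarith

variable (K) in
lemma repr_bound : ∃ P : ℝ, 0 < P ∧ ∀ (v : logSpace K) (δ : ℝ), (∀ w, |v w| ≤ δ) → 0 ≤ δ →
    ∀ i, |(ulB K).repr v i| ≤ P * δ := by
  refine ⟨1 + ∑ i, ∑ w, |(ulB K).repr (Pi.single w 1) i|, by positivity, ?_⟩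
  intro v δ hv hδ i
  have h1 : v = ∑ w, v w • (Pi.single w 1 : logSpace K) := by
    ext w; simp [Finset.sum_apply, Pi.single_apply]
  have h2 : (ulB K).repr v i = ∑ w, v w * (ulB K).repr (Pi.single w 1) i := by
    conv_lhs => rw [h1]
    simp [map_sum, Finsupp.finsetSum_apply]
  rw [h2]
  refine (Finset.abs_sum_le_sum_abs _ _).trans ?_
  have h3 : ∑ w, |v w * (ulB K).repr (Pi.single w 1) i| ≤ ∑ w, δ * |(ulB K).repr (Pi.single w 1) i| := by
    refine Finset.sum_le_sum fun w _ => ?_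
    rw [abs_mul]
    exact mul_le_mul_of_nonneg_right (hv w) (abs_nonneg _)
  rw [← Finset.mul_sum] at h3
  have h4 : ∑ w, |(ulB K).repr (Pi.single w 1) i| ≤ ∑ i, ∑ w, |(ulB K).repr (Pi.single w 1) i| :=
    Finset.single_le_sum (f := fun i => ∑ w, |(ulB K).repr (Pi.single w 1) i|)
      (fun _ _ => Finset.sum_nonneg fun _ _ => abs_nonneg _) (Finset.mem_univ i)
  nlinarith [mul_le_mul_of_nonneg_left h4 hδ]

end FSq

end

noncomputable section
open NumberField NumberField.mixedEmbedding NumberField.Units NumberField.Units.dirichletUnitTheorem Module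
open NumberField.InfinitePlace


namespace FSq

open scoped Classical

variable {K : Type*} [Field K] [NumberField K]

variable (K) in
lemma lip_aux : ∃ P : ℝ, 0 < P ∧ ∀ (δ : ℝ) (x y : mixedSpace K), 0 ≤ δ →
    mixedEmbedding.norm x ≠ 0 → mixedEmbedding.norm y ≠ 0 →
    (∀ w, |Real.log (normAtPlace w x) - Real.log (normAtPlace w y)| ≤ δ) →
    |wt x - wt y| ≤ P * δ ∧
    |Real.log (mixedEmbedding.norm x) - Real.log (mixedEmbedding.norm y)| ≤ finrank ℚ K * δ := by
  obtain ⟨P, hP, hrep⟩ := repr_bound K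
  refine ⟨1 + rank K * (P * 4), by positivity, ?_⟩
  intro δ x y hδ hx hy h
  have hn : (0:ℝ) < finrank ℚ K := Nat.cast_pos.mpr finrank_pos
  have h2 : |Real.log (mixedEmbedding.norm x) - Real.log (mixedEmbedding.norm y)|
      ≤ finrank ℚ K * δ := by
    rw [log_norm_eq x hx, log_norm_eq y hy, ← Finset.sum_sub_distrib]
    refine (Finset.abs_sum_le_sum_abs _ _).trans ?_
    rw [← sum_mult_eq, Nat.cast_sum, Finset.sum_mul]
    refine Finset.sum_le_sum fun w _ => ?_
    rw [← mul_sub, abs_mul, abs_of_nonneg (Nat.cast_nonneg _)]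
    exact mul_le_mul_of_nonneg_left (h w) (Nat.cast_nonneg _)
  refine ⟨?_, h2⟩
  have h3 : ∀ w, |(logMap x - logMap y) w| ≤ 4 * δ := by
    intro w
    rw [Pi.sub_apply, logMap_apply, logMap_apply, ← mul_sub, abs_mul,
      abs_of_nonneg (Nat.cast_nonneg _)]
    have h4 : (mult w.1 : ℝ) ≤ 2 := by
      unfold mult; split_ifs <;> norm_num
    have h5 : |Real.log (normAtPlace w.1 x) - Real.log (mixedEmbedding.norm x) * (finrank ℚ K : ℝ)⁻¹ -
        (Real.log (normAtPlace w.1 y) - Real.log (mixedEmbedding.norm y) * (finrank ℚ K : ℝ)⁻¹)| ≤ 2 * δ := by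
      have h6 : Real.log (normAtPlace w.1 x) - Real.log (mixedEmbedding.norm x) * (finrank ℚ K : ℝ)⁻¹ -
        (Real.log (normAtPlace w.1 y) - Real.log (mixedEmbedding.norm y) * (finrank ℚ K : ℝ)⁻¹)
        = (Real.log (normAtPlace w.1 x) - Real.log (normAtPlace w.1 y)) -
          (Real.log (mixedEmbedding.norm x) - Real.log (mixedEmbedding.norm y)) / finrank ℚ K := by
        field_simp; ring
      rw [h6]
      refine (abs_sub _ _).trans ?_
      rw [abs_div, abs_of_pos hn]
      have h7 : |Real.log (mixedEmbedding.norm x) - Real.log (mixedEmbedding.norm y)| / finrank ℚ K ≤ δ := by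
        rw [div_le_iff₀ hn]; linarith
      linarith [h w]
    calc _ ≤ 2 * (2 * δ) := mul_le_mul h4 h5 (abs_nonneg _) (by norm_num)
      _ = 4 * δ := by ring
  have h4 := hrep _ _ h3 (by positivity)
  unfold wt
  refine (abs_prod_sub_prod_le _ _ _ (fun i => ⟨tent_nonneg _, tent_le_one _⟩)
    (fun i => ⟨tent_nonneg _, tent_le_one _⟩)).trans ?_
  have h5 : ∀ i ∈ (Finset.univ : Finset (Fin (rank K))), |tent ((ulB K).repr (logMap x) i) - tent ((ulB K).repr (logMap y) i)| ≤ P * (4 * δ) := by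
    intro i _
    refine (tent_lip _ _).trans ?_
    have := h4 i
    rwa [map_sub, Finsupp.sub_apply] at this
  refine (Finset.sum_le_sum h5).trans ?_
  simp only [Finset.sum_const, Finset.card_univ, Fintype.card_fin, nsmul_eq_mul]
  linarith

variable (K) in
lemma lip_A (D : ℝ) (hD : 0 < D) : ∃ C R : ℝ, 0 < C ∧ 0 < R ∧ ∀ s : ℝ, 1 ≤ s → s ≤ 2 →
    ∀ y c : mixedSpace K, ‖c‖ ≤ D → R ≤ ‖y‖ → G s y ≠ 0 →
      |G s (y + c) - G s y| ≤ C / ‖y‖ ^ (finrank ℚ K + 1) := by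
  obtain ⟨κ, hκ, hκ1, hsupp⟩ := support_bound K
  obtain ⟨P, hP, hlip⟩ := lip_aux K
  set n := finrank ℚ K with hn
  refine ⟨(P + 2 * n) * (2 * D / κ) * (κ / 2) ^ (-(n:ℤ)) , 2 / κ + 2 * D / κ, by positivity, by positivity, ?_⟩
  intro s hs1 hs2 y c hc hy hG
  obtain ⟨hy0, hwy⟩ := G_ne_zero hs1 hG
  have hY : 0 < ‖y‖ := lt_of_lt_of_le (by positivity) hy
  have hk := hsupp y hy0 hwy
  have hpos : ∀ w, 0 < normAtPlace w y := fun w => lt_of_lt_of_le (by positivity) (hk w)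
  have hky : 2 + 2 * D ≤ κ * ‖y‖ := by
    calc 2 + 2 * D = κ * (2 / κ + 2 * D / κ) := by field_simp
      _ ≤ _ := mul_le_mul_of_nonneg_left hy hκ.le
  have hdiff : ∀ w, |normAtPlace w (y + c) - normAtPlace w y| ≤ D := by
    intro w
    have h1 := normAtPlace_add_le w y c
    have h2 := normAtPlace_add_le w (y + c) (-c)
    rw [normAtPlace_neg, add_neg_cancel_right] at h2
    have h3 := normAtPlace_le_norm w c
    rw [abs_le]; constructor <;> linarith
  have hlog : ∀ w, |Real.log (normAtPlace w (y + c)) - Real.log (normAtPlace w y)| ≤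
      2 * D / (κ * ‖y‖) := by
    intro w
    refine (log_sub_log_le (hpos w) ?_).trans ?_
    · linarith [hdiff w, hk w]
    · exact div_le_div₀ (by positivity) (by linarith [hdiff w]) (by positivity) (hk w)
  have hlow : ∀ w, κ * ‖y‖ / 2 ≤ normAtPlace w (y + c) := by
    intro w
    have := (abs_le.mp (hdiff w)).1
    linarith [hk w]
  set μ := κ * ‖y‖ / 2 with hμ
  have hμ1 : 1 ≤ μ := by rw [hμ]; linarith
  have hN1 := norm_ge_pow (by linarith) hlow
  have hN2 := norm_ge_pow (x := y) (μ := μ) (by linarith) (fun w => le_trans (by rw [hμ]; linarith) (hk w))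
  rw [← hn] at hN1 hN2
  have hμn : 0 < μ ^ n := by positivity
  have hyc0 : mixedEmbedding.norm (y + c) ≠ 0 := (lt_of_lt_of_le hμn hN1).ne'
  set δ := 2 * D / (κ * ‖y‖) with hδ
  have hδ0 : 0 ≤ δ := by positivity
  obtain ⟨hA, hB⟩ := hlip δ (y + c) y hδ0 hyc0 hy0 hlog
  have hr := rpow_neg_sub_le hμn hN2 hN1 (by linarith : 0 ≤ s)
  have hμs : (μ ^ n) ^ (-s) ≤ (μ ^ n)⁻¹ := by
    rw [← Real.rpow_neg_one]
    exact Real.rpow_le_rpow_of_exponent_le (one_le_pow₀ hμ1) (by linarith)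
  have hNs : mixedEmbedding.norm y ^ (-s) ≤ (μ ^ n)⁻¹ :=
    (Real.rpow_le_rpow_of_nonpos hμn hN2 (by linarith)).trans hμs
  have hsplit : G s (y + c) - G s y = wt (y + c) * (mixedEmbedding.norm (y + c) ^ (-s) -
      mixedEmbedding.norm y ^ (-s)) + (wt (y + c) - wt y) * mixedEmbedding.norm y ^ (-s) := by
    unfold G; ring
  have hfin : |G s (y + c) - G s y| ≤ (P + 2 * n) * δ * (μ ^ n)⁻¹ := by
    rw [hsplit]
    refine (abs_add_le _ _).trans ?_
    rw [abs_mul, abs_mul, abs_of_nonneg (wt_nonneg _),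
      abs_of_nonneg (Real.rpow_nonneg (mixedEmbedding.norm_nonneg y) _)]
    have e1 : wt (y + c) * |mixedEmbedding.norm (y + c) ^ (-s) - mixedEmbedding.norm y ^ (-s)|
        ≤ 2 * (n * δ) * (μ ^ n)⁻¹ := by
      calc _ ≤ 1 * |mixedEmbedding.norm (y + c) ^ (-s) - mixedEmbedding.norm y ^ (-s)| :=
            mul_le_mul_of_nonneg_right (wt_le_one _) (abs_nonneg _)
        _ ≤ s * |Real.log (mixedEmbedding.norm (y + c)) - Real.log (mixedEmbedding.norm y)| * (μ ^ n) ^ (-s) := by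
            rw [one_mul]; exact hr
        _ ≤ 2 * (n * δ) * (μ ^ n)⁻¹ := by
            refine mul_le_mul ?_ hμs (by positivity) (by positivity)
            exact mul_le_mul hs2 hB (abs_nonneg _) (by norm_num)
    have e2 : |wt (y + c) - wt y| * mixedEmbedding.norm y ^ (-s) ≤ P * δ * (μ ^ n)⁻¹ :=
      mul_le_mul hA hNs (Real.rpow_nonneg (mixedEmbedding.norm_nonneg y) _) (by positivity)
    linarith
  refine hfin.trans (le_of_eq ?_)
  rw [hδ, hμ, zpow_neg, zpow_natCast, pow_succ]
  have : (κ * ‖y‖ / 2) ^ n = (κ / 2) ^ n * ‖y‖ ^ n := by rw [← mul_pow]; congr 1; ring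
  rw [this]
  field_simp

variable (K) in
lemma lip_B (D : ℝ) (hD : 0 < D) : ∃ C R : ℝ, 0 < C ∧ 0 < R ∧ ∀ s : ℝ, 1 ≤ s → s ≤ 2 →
    ∀ y c : mixedSpace K, ‖c‖ ≤ D → R ≤ ‖y‖ →
      |G s (y + c) - G s y| ≤ C / ‖y‖ ^ (finrank ℚ K + 1) := by
  obtain ⟨C, R, hC, hR, h⟩ := lip_A K D hD
  refine ⟨C * 2 ^ (finrank ℚ K + 1), 2 * R + 2 * D, by positivity, by positivity, ?_⟩
  intro s hs1 hs2 y c hc hy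
  have hY : 0 < ‖y‖ := lt_of_lt_of_le (by positivity) hy
  have hle : C / ‖y‖ ^ (finrank ℚ K + 1) ≤ C * 2 ^ (finrank ℚ K + 1) / ‖y‖ ^ (finrank ℚ K + 1) := by
    refine div_le_div_of_nonneg_right ?_ (by positivity)
    have : (1:ℝ) ≤ 2 ^ (finrank ℚ K + 1) := one_le_pow₀ (by norm_num)
    nlinarith
  by_cases h1 : G s y = 0
  · by_cases h2 : G s (y + c) = 0
    · rw [h1, h2, sub_zero, abs_zero]; positivity
    · have h3 : ‖y‖ / 2 ≤ ‖y + c‖ := by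
        have := norm_sub_le (y + c) c
        rw [add_sub_cancel_right] at this
        linarith
      have h4 := h s hs1 hs2 (y + c) (-c) (by rwa [norm_neg]) (by linarith) h2
      rw [add_neg_cancel_right, abs_sub_comm] at h4
      refine h4.trans ?_
      calc C / ‖y + c‖ ^ (finrank ℚ K + 1) ≤ C / (‖y‖ / 2) ^ (finrank ℚ K + 1) := by
            refine div_le_div_of_nonneg_left hC.le (by positivity) ?_
            exact pow_le_pow_left₀ (by positivity) h3 _
        _ = _ := by rw [div_pow]; field_simp
  · exact (h s hs1 hs2 y c hc (by linarith) h1).trans hle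

end FSq

end

noncomputable section
open NumberField NumberField.mixedEmbedding NumberField.Units NumberField.Units.dirichletUnitTheorem Module
open NumberField.InfinitePlace


namespace FSq

open scoped Classical nonZeroDivisors

variable {K : Type*} [Field K] [NumberField K]

/-- embedding of integers -/
def emb (a : 𝓞 K) : mixedSpace K := mixedEmbedding K (a : K)

lemma emb_add (a b : 𝓞 K) : emb (a + b) = emb a + emb b := by simp [emb]

lemma emb_inj : Function.Injective (emb : 𝓞 K → mixedSpace K) := by
  intro a b h
  exact RingOfIntegers.ext (mixedEmbedding_injective K h)

lemma emb_norm (a : 𝓞 K) : mixedEmbedding.norm (emb a) = (Ideal.absNorm (Ideal.span {a}) : ℝ) := by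
  rw [emb, norm_eq_norm, Ideal.absNorm_span_singleton, ← Algebra.coe_norm_int]
  simp [Nat.cast_natAbs]

lemma summable_lattice_aux {E : Type*} [NormedAddCommGroup E] [NormedSpace ℝ E]
    [FiniteDimensional ℝ E] (L : Submodule ℤ E) [DiscreteTopology L] [IsZLattice ℝ L]
    {A : Type*} (f : A → E) (hf : Function.Injective f) (hL : ∀ a, f a ∈ L) (r : ℝ)
    (hr : (finrank ℝ E : ℝ) < r) : Summable fun a => ‖f a‖ ^ (-r) := by
  have h := ZLattice.summable_norm_rpow L (-r) (by rw [ZLattice.rank ℝ]; linarith)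
  exact h.comp_injective (i := fun a => (⟨f a, hL a⟩ : L))
    (fun a b hab => hf (congrArg Subtype.val hab))

variable (K) in
lemma summable_emb (r : ℝ) (hr : (finrank ℚ K : ℝ) < r) :
    Summable fun a : 𝓞 K => ‖emb a‖ ^ (-r) :=
  summable_lattice_aux (mixedEmbedding.integerLattice K) emb emb_inj (fun a => ⟨a, rfl⟩) r
    (by rw [mixedEmbedding.finrank]; exact hr)

lemma G_emb_le_one {s : ℝ} (hs : 1 ≤ s) (a : 𝓞 K) : G s (emb a) ≤ 1 := by
  by_cases h : G s (emb a) = 0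
  · rw [h]; norm_num
  have h1 := (G_ne_zero hs h).1
  unfold G
  refine mul_le_one₀ (wt_le_one _) (Real.rpow_nonneg (mixedEmbedding.norm_nonneg _) _) ?_
  rw [emb_norm] at h1 ⊢
  have : (1:ℝ) ≤ Ideal.absNorm (Ideal.span {a}) := by
    exact_mod_cast Nat.one_le_iff_ne_zero.mpr (by exact_mod_cast h1)
  exact Real.rpow_le_one_of_one_le_of_nonpos this (by linarith)

lemma summable_G {s : ℝ} (hs : 1 < s) (hs2 : s ≤ 2) : Summable fun a : 𝓞 K => G s (emb a) := by
  obtain ⟨C, hC, h⟩ := G_le K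
  have hn : (0:ℝ) < finrank ℚ K := Nat.cast_pos.mpr finrank_pos
  refine Summable.of_nonneg_of_le (fun _ => G_nonneg _ _) (fun a => h s hs.le hs2 (emb a)) ?_
  exact (summable_emb K _ (by nlinarith)).mul_left C

lemma diff_bound (c : 𝓞 K) : ∃ F : 𝓞 K → ℝ, Summable F ∧ (∀ a, 0 ≤ F a) ∧
    ∀ s : ℝ, 1 ≤ s → s ≤ 2 → ∀ b : 𝓞 K, |G s (emb (b + c)) - G s (emb b)| ≤ F b := by
  obtain ⟨C, R, hC, hR, h⟩ := lip_B K (‖emb c‖ + 1) (by positivity)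
  set n := finrank ℚ K with hn
  refine ⟨fun b => (C + R ^ (n + 1)) * ‖emb b‖ ^ (-((n:ℝ) + 1)) + if b = 0 then 1 else 0, ?_, ?_, ?_⟩
  · refine Summable.add ((summable_emb K _ (by rw [← hn]; linarith)).mul_left _) ?_
    exact summable_of_ne_finset_zero (s := {0}) (by intro b hb; simp at hb; simp [hb])
  · intro a; dsimp only; split_ifs <;> positivity
  · intro s hs1 hs2 b
    have hone : |G s (emb (b + c)) - G s (emb b)| ≤ 1 := by
      rw [abs_le]
      constructor <;> linarith [G_nonneg s (emb b), G_nonneg s (emb (b + c)), G_emb_le_one hs1 b, G_emb_le_one hs1 (b + c)]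
    by_cases hb : b = 0
    · simp only [hb, if_true] at hone ⊢
      refine hone.trans ?_
      have : 0 ≤ (C + R ^ (n + 1)) * ‖emb (0 : 𝓞 K)‖ ^ (-((n:ℝ) + 1)) := by positivity
      linarith
    · simp only [hb, if_false, add_zero]
      have hpos : 0 < ‖emb b‖ := by
        rw [norm_pos_iff]
        intro h0
        apply hb
        apply emb_inj
        rw [h0]; simp [emb]
      have hpow : ‖emb b‖ ^ (-((n:ℝ) + 1)) = (‖emb b‖ ^ (n + 1))⁻¹ := by
        rw [Real.rpow_neg hpos.le]; congr 1
        rw [← Real.rpow_natCast]; push_cast; rfl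
      rw [hpow, ← div_eq_mul_inv]
      by_cases hbR : R ≤ ‖emb b‖
      · rw [emb_add]
        refine (h s hs1 hs2 _ _ (by linarith) hbR).trans ?_
        refine div_le_div_of_nonneg_right ?_ (by positivity)
        have : 0 < R ^ (n + 1) := by positivity
        linarith
      · refine hone.trans ?_
        rw [le_div_iff₀ (by positivity), one_mul]
        have : ‖emb b‖ ^ (n + 1) ≤ R ^ (n + 1) := pow_le_pow_left₀ hpos.le (by linarith) _
        linarith

/-- lattice sum -/
def SO (K : Type*) [Field K] [NumberField K] (s : ℝ) : ℝ := ∑' a : 𝓞 K, G s (emb a)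

/-- lattice sum over an ideal -/
def SJ (J : Ideal (𝓞 K)) (s : ℝ) : ℝ := ∑' a : J, G s (emb (a : 𝓞 K))

lemma lattice_compare (J : Ideal (𝓞 K)) (hJ : J ≠ ⊥) : ∃ C : ℝ, ∀ s : ℝ, 1 < s → s ≤ 2 →
    |SO K s - Ideal.absNorm J * SJ J s| ≤ C := by
  have : Finite (𝓞 K ⧸ J) := Ideal.finiteQuotientOfFreeOfNeBot J hJ
  have := Fintype.ofFinite (𝓞 K ⧸ J)
  choose F hF1 hF2 hF3 using fun q : 𝓞 K ⧸ J => diff_bound (Quotient.out q : 𝓞 K)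
  refine ⟨∑ q, ∑' b : J, F q b, fun s hs hs2 => ?_⟩
  let e : (𝓞 K ⧸ J) × J ≃ 𝓞 K := Equiv.ofBijective (fun p => (p.2 : 𝓞 K) + Quotient.out p.1) (by
    have key : ∀ (q : 𝓞 K ⧸ J) (b : J), Ideal.Quotient.mk J ((b : 𝓞 K) + Quotient.out q) = q := by
      intro q b
      rw [map_add, Ideal.Quotient.eq_zero_iff_mem.mpr b.2, zero_add]
      exact Quotient.out_eq q
    constructor
    · rintro ⟨q, b⟩ ⟨q', b'⟩ h
      simp only at h
      have h1 : q = q' := by rw [← key q b, ← key q' b', h]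
      subst h1
      exact Prod.ext rfl (Subtype.ext (add_right_cancel h))
    · intro a
      have : a - Quotient.out (Ideal.Quotient.mk J a) ∈ J := by
        rw [← Ideal.Quotient.eq_zero_iff_mem, map_sub, sub_eq_zero]
        exact (Quotient.out_eq (Ideal.Quotient.mk J a)).symm
      exact ⟨(Ideal.Quotient.mk J a, ⟨_, this⟩), by simp⟩)
  have hsG := summable_G (K := K) hs hs2
  have h1 : SO K s = ∑ q : 𝓞 K ⧸ J, ∑' b : J, G s (emb ((b : 𝓞 K) + Quotient.out q)) := by
    unfold SO
    rw [← e.tsum_eq, Summable.tsum_prod (f := fun p => G s (emb (e p))) (hsG.comp_injective e.injective), tsum_fintype]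
    rfl
  have h2 : (Ideal.absNorm J : ℝ) * SJ J s = ∑ q : 𝓞 K ⧸ J, SJ J s := by
    rw [Finset.sum_const, Finset.card_univ, nsmul_eq_mul, Ideal.absNorm_apply,
      Submodule.cardQuot_apply, Nat.card_eq_fintype_card]
  rw [h1, h2, ← Finset.sum_sub_distrib]
  refine (Finset.abs_sum_le_sum_abs _ _).trans (Finset.sum_le_sum fun q _ => ?_)
  unfold SJ
  have hinj : Function.Injective (fun b : J => (b : 𝓞 K)) := Subtype.val_injective
  have s1 : Summable fun b : J => G s (emb ((b : 𝓞 K) + Quotient.out q)) :=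
    hsG.comp_injective (i := fun b : J => (b : 𝓞 K) + Quotient.out q)
      (fun b b' h => Subtype.ext (add_right_cancel h))
  have s2 : Summable fun b : J => G s (emb (b : 𝓞 K)) := hsG.comp_injective hinj
  have s3 : Summable fun b : J => F q b := (hF1 q).comp_injective hinj
  rw [← s1.tsum_sub s2]
  have h3 : ∀ b : J, ‖G s (emb ((b : 𝓞 K) + Quotient.out q)) - G s (emb (b : 𝓞 K))‖ ≤ F q b :=
    fun b => hF3 q s hs.le hs2 b
  exact tsum_of_norm_bounded s3.hasSum h3

end FSq

end

noncomputable section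
open NumberField NumberField.mixedEmbedding NumberField.Units NumberField.Units.dirichletUnitTheorem Module
open NumberField.InfinitePlace


namespace FSq

open scoped Classical nonZeroDivisors

variable {K : Type*} [Field K] [NumberField K]

lemma mul_isPrincipal {I J : (Ideal (𝓞 K))⁰} {c : ClassGroup (𝓞 K)} (hJ : ClassGroup.mk0 J = c⁻¹)
    (hI : ClassGroup.mk0 I = c) : ∃ a : 𝓞 K, a ≠ 0 ∧ (I : Ideal (𝓞 K)) * J = Ideal.span {a} := by
  have h : ClassGroup.mk0 (I * J) = 1 := by rw [map_mul, hI, hJ, mul_inv_cancel]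
  rw [ClassGroup.mk0_eq_one_iff] at h
  obtain ⟨a, ha⟩ := h.principal
  refine ⟨a, ?_, ?_⟩
  · rintro rfl
    have := nonZeroDivisors.coe_ne_zero (I * J)
    apply this
    rw [ha]; simp
  · rw [← Ideal.submodule_span_eq, ← ha]; rfl

lemma class_bij (J : (Ideal (𝓞 K))⁰) (c : ClassGroup (𝓞 K)) (hJ : ClassGroup.mk0 J = c⁻¹) :
    ∃ (e : {I : (Ideal (𝓞 K))⁰ // ClassGroup.mk0 I = c} × (𝓞 K)ˣ ≃ {a : (J : Ideal (𝓞 K)) // a ≠ 0})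
      (g : {I : (Ideal (𝓞 K))⁰ // ClassGroup.mk0 I = c} → 𝓞 K),
      (∀ I, (I.1 : Ideal (𝓞 K)) * J = Ideal.span {g I}) ∧ (∀ I, g I ≠ 0) ∧
      ∀ p, ((e p).1 : 𝓞 K) = p.2 * g p.1 := by
  choose g hg0 hg using fun I : {I : (Ideal (𝓞 K))⁰ // ClassGroup.mk0 I = c} => mul_isPrincipal hJ I.2
  have hmem : ∀ I, g I ∈ (J : Ideal (𝓞 K)) := by
    intro I
    have : g I ∈ Ideal.span {g I} := Ideal.mem_span_singleton_self _
    rw [← hg I] at this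
    have hle : (I.1 : Ideal (𝓞 K)) * (J : Ideal (𝓞 K)) ≤ (J : Ideal (𝓞 K)) := Ideal.mul_le_right
    exact hle this
  let f : {I : (Ideal (𝓞 K))⁰ // ClassGroup.mk0 I = c} × (𝓞 K)ˣ → {a : (J : Ideal (𝓞 K)) // a ≠ 0} :=
    fun p => ⟨⟨p.2 * g p.1, Ideal.mul_mem_left _ _ (hmem _)⟩, by
      intro h
      have h2 := congrArg Subtype.val h
      simp at h2
      exact hg0 _ h2⟩
  have hf : Function.Bijective f := by
    constructor
    · rintro ⟨I, u⟩ ⟨I', u'⟩ h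
      have h1 : (u : 𝓞 K) * g I = u' * g I' := congrArg (fun x => (x.1 : 𝓞 K)) h
      have h2 : Ideal.span {g I} = Ideal.span {g I'} := by
        rw [Ideal.span_singleton_eq_span_singleton]
        exact ⟨u * u'⁻¹, by
          rw [Units.val_mul]
          calc g I * (u * (u'⁻¹ : (𝓞 K)ˣ)) = (u * g I) * (u'⁻¹ : (𝓞 K)ˣ) := by ring
            _ = _ := by rw [h1]; rw [mul_right_comm, Units.mul_inv, one_mul]⟩
      rw [← hg I, ← hg I'] at h2
      have h3 : I = I' := by
        apply Subtype.ext
        apply Subtype.ext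
        exact mul_right_cancel₀ (nonZeroDivisors.coe_ne_zero J) h2
      subst h3
      have h4 := mul_right_cancel₀ (hg0 I) h1
      exact Prod.ext rfl (Units.ext h4)
    · rintro ⟨⟨a, ha⟩, ha0⟩
      have ha0' : a ≠ 0 := fun h => ha0 (by ext1; exact h)
      have h1 : (J : Ideal (𝓞 K)) ∣ Ideal.span {a} := by
        rw [Ideal.dvd_span_singleton]; exact ha
      obtain ⟨I, hI⟩ := h1
      have hI0 : I ≠ 0 := by
        rintro rfl
        rw [mul_zero] at hI
        simp at hI
        exact ha0' hI
      have hc : ClassGroup.mk0 ⟨I, mem_nonZeroDivisors_of_ne_zero hI0⟩ = c := by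
        have h2 : ClassGroup.mk0 (J * ⟨I, mem_nonZeroDivisors_of_ne_zero hI0⟩) = 1 := by
          rw [ClassGroup.mk0_eq_one_iff]
          refine ⟨⟨a, ?_⟩⟩
          rw [Ideal.submodule_span_eq, hI]; rfl
        rw [map_mul, hJ, inv_mul_eq_one] at h2
        exact h2.symm
      set I' : {I : (Ideal (𝓞 K))⁰ // ClassGroup.mk0 I = c} := ⟨_, hc⟩ with hI'
      have h3 : Ideal.span {g I'} = Ideal.span {a} := by
        rw [← hg I', hI, mul_comm]
      rw [Ideal.span_singleton_eq_span_singleton] at h3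
      obtain ⟨u, hu⟩ := h3
      refine ⟨(I', u), ?_⟩
      ext1; ext1
      change (u : 𝓞 K) * g I' = a
      rw [mul_comm, hu]
  exact ⟨Equiv.ofBijective f hf, g, hg, hg0, fun p => rfl⟩

lemma G_unit (s : ℝ) (u : (𝓞 K)ˣ) (a : 𝓞 K) :
    G s (emb ((u : 𝓞 K) * a)) = wt (u • emb a) * mixedEmbedding.norm (emb a) ^ (-s) := by
  have h : emb ((u : 𝓞 K) * a) = u • emb a := by
    rw [unitSMul_smul, emb, emb]; simp
  rw [h, G, norm_unit_smul]

lemma hasSum_class (J : (Ideal (𝓞 K))⁰) (c : ClassGroup (𝓞 K)) (hJ : ClassGroup.mk0 J = c⁻¹)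
    {s : ℝ} (hs : 1 < s) (hs2 : s ≤ 2) :
    HasSum (fun I : {I : (Ideal (𝓞 K))⁰ // ClassGroup.mk0 I = c} =>
      (torsionOrder K : ℝ) * ((Ideal.absNorm (I.1 : Ideal (𝓞 K)) : ℝ) *
        Ideal.absNorm (J : Ideal (𝓞 K))) ^ (-s)) (SJ (J : Ideal (𝓞 K)) s) := by
  obtain ⟨e, g, hg, hg0, he⟩ := class_bij J c hJ
  have hsum : Summable fun a : (J : Ideal (𝓞 K)) => G s (emb (a : 𝓞 K)) :=
    (summable_G hs hs2).comp_injective Subtype.val_injective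
  have h1 : HasSum (fun a : {a : (J : Ideal (𝓞 K)) // a ≠ 0} => G s (emb (a.1 : 𝓞 K))) (SJ (J : Ideal (𝓞 K)) s) := by
    have := hsum.hasSum
    rw [← hasSum_subtype_iff_of_support_subset (s := {a | a ≠ 0})] at this
    · exact this
    · intro a ha
      simp only [Function.mem_support] at ha
      rintro rfl
      apply (G_ne_zero hs.le ha).1
      simp [emb]
  rw [← e.hasSum_iff] at h1
  have h2 : ∀ I : {I : (Ideal (𝓞 K))⁰ // ClassGroup.mk0 I = c},
      HasSum (fun u : (𝓞 K)ˣ => ((fun a : {a : (J : Ideal (𝓞 K)) // a ≠ 0} => G s (emb (a.1 : 𝓞 K))) ∘ e) (I, u))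
      ((torsionOrder K : ℝ) * ((Ideal.absNorm (I.1 : Ideal (𝓞 K)) : ℝ) *
        Ideal.absNorm (J : Ideal (𝓞 K))) ^ (-s)) := by
    intro I
    have hn : mixedEmbedding.norm (emb (g I)) = (Ideal.absNorm (I.1 : Ideal (𝓞 K)) : ℝ) *
        Ideal.absNorm (J : Ideal (𝓞 K)) := by
      rw [emb_norm, ← hg I, map_mul]; push_cast; rfl
    have hn0 : mixedEmbedding.norm (emb (g I)) ≠ 0 := by
      rw [emb_norm]
      simpa using hg0 I
    have h3 := (hasSum_wt hn0).mul_right (mixedEmbedding.norm (emb (g I)) ^ (-s))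
    rw [hn] at h3
    refine h3.congr_fun ?_
    intro u
    simp only [Function.comp, he, G_unit, hn]
  exact h1.prod_fiberwise h2

/-- partial zeta function of an ideal class -/
def Zc (c : ClassGroup (𝓞 K)) (s : ℝ) : ℝ :=
  ∑' I : {I : (Ideal (𝓞 K))⁰ // ClassGroup.mk0 I = c}, (Ideal.absNorm (I.1 : Ideal (𝓞 K)) : ℝ) ^ (-s)

lemma absNorm_pos (I : (Ideal (𝓞 K))⁰) : 0 < (Ideal.absNorm (I : Ideal (𝓞 K)) : ℝ) := by
  have : Ideal.absNorm (I : Ideal (𝓞 K)) ≠ 0 := by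
    rw [Ne, Ideal.absNorm_eq_zero_iff]
    exact nonZeroDivisors.coe_ne_zero I
  positivity

lemma summable_Zc (c : ClassGroup (𝓞 K)) {s : ℝ} (hs : 1 < s) (hs2 : s ≤ 2) :
    Summable fun I : {I : (Ideal (𝓞 K))⁰ // ClassGroup.mk0 I = c} =>
      (Ideal.absNorm (I.1 : Ideal (𝓞 K)) : ℝ) ^ (-s) := by
  obtain ⟨J, hJ⟩ := ClassGroup.mk0_surjective c⁻¹
  have h := (hasSum_class J c hJ hs hs2).summable
  have hw : (torsionOrder K : ℝ) ≠ 0 := by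
    simp [torsionOrder_ne_zero]
  have hJ0 := Real.rpow_pos_of_pos (absNorm_pos J) (-s)
  have h2 := h.mul_left ((torsionOrder K : ℝ)⁻¹ * ((Ideal.absNorm (J : Ideal (𝓞 K)) : ℝ) ^ (-s))⁻¹)
  refine h2.congr fun I => ?_
  rw [Real.mul_rpow (absNorm_pos _).le (absNorm_pos _).le]
  field_simp

lemma SJ_eq (J : (Ideal (𝓞 K))⁰) (c : ClassGroup (𝓞 K)) (hJ : ClassGroup.mk0 J = c⁻¹)
    {s : ℝ} (hs : 1 < s) (hs2 : s ≤ 2) : SJ (J : Ideal (𝓞 K)) s =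
      torsionOrder K * (Ideal.absNorm (J : Ideal (𝓞 K)) : ℝ) ^ (-s) * Zc c s := by
  rw [← (hasSum_class J c hJ hs hs2).tsum_eq, Zc, ← tsum_mul_left]
  refine tsum_congr fun I => ?_
  rw [Real.mul_rpow (absNorm_pos _).le (absNorm_pos _).le]
  ring

lemma Zc_nonneg (c : ClassGroup (𝓞 K)) (s : ℝ) : 0 ≤ Zc c s :=
  tsum_nonneg fun _ => Real.rpow_nonneg (absNorm_pos _).le _

lemma class_compare (c : ClassGroup (𝓞 K)) : ∃ (C q : ℝ), 0 < q ∧ ∀ s : ℝ, 1 < s → s ≤ 2 →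
    |SO K s / torsionOrder K - q ^ (1 - s) * Zc c s| ≤ C := by
  obtain ⟨J, hJ⟩ := ClassGroup.mk0_surjective c⁻¹
  obtain ⟨C, hC⟩ := lattice_compare (J : Ideal (𝓞 K)) (nonZeroDivisors.coe_ne_zero J)
  have hw : (0:ℝ) < torsionOrder K := by
    exact_mod_cast Nat.pos_of_ne_zero (torsionOrder_ne_zero K)
  refine ⟨C / torsionOrder K, Ideal.absNorm (J : Ideal (𝓞 K)), absNorm_pos J, fun s hs hs2 => ?_⟩
  have h := hC s hs hs2
  rw [SJ_eq J c hJ hs hs2] at h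
  have h2 : SO K s / torsionOrder K - (Ideal.absNorm (J : Ideal (𝓞 K)) : ℝ) ^ (1 - s) * Zc c s
    = (SO K s - Ideal.absNorm (J : Ideal (𝓞 K)) * (torsionOrder K * (Ideal.absNorm (J : Ideal (𝓞 K)) : ℝ) ^ (-s) * Zc c s)) / torsionOrder K := by
    rw [sub_eq_add_neg 1 s, Real.rpow_add (absNorm_pos J), Real.rpow_one]
    field_simp
  rw [h2, abs_div, abs_of_pos hw]
  exact div_le_div_of_nonneg_right h hw.le

lemma summable_ideals {s : ℝ} (hs : 1 < s) (hs2 : s ≤ 2) :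
    Summable fun I : (Ideal (𝓞 K))⁰ => (Ideal.absNorm (I : Ideal (𝓞 K)) : ℝ) ^ (-s) := by
  rw [← (Equiv.sigmaFiberEquiv (fun I : (Ideal (𝓞 K))⁰ => ClassGroup.mk0 I)).summable_iff]
  rw [summable_sigma_of_nonneg]
  · exact ⟨fun c => summable_Zc c hs hs2, Summable.of_finite⟩
  · intro _; exact Real.rpow_nonneg (absNorm_pos _).le _

lemma tsum_ideals_class {s : ℝ} (hs : 1 < s) (hs2 : s ≤ 2) (χ : ClassGroup (𝓞 K) → ℝ)
    (hχ : ∀ c, |χ c| ≤ 1) :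
    ∑' I : (Ideal (𝓞 K))⁰, χ (ClassGroup.mk0 I) * (Ideal.absNorm (I : Ideal (𝓞 K)) : ℝ) ^ (-s)
     = ∑ c, χ c * Zc c s := by
  have hsum : Summable fun I : (Ideal (𝓞 K))⁰ =>
      χ (ClassGroup.mk0 I) * (Ideal.absNorm (I : Ideal (𝓞 K)) : ℝ) ^ (-s) := by
    refine Summable.of_norm_bounded (summable_ideals hs hs2) fun I => ?_
    have h0 := Real.rpow_nonneg (absNorm_pos I).le (-s)
    rw [norm_mul, Real.norm_eq_abs, Real.norm_eq_abs, abs_of_nonneg h0]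
    have := mul_le_mul_of_nonneg_right (hχ (ClassGroup.mk0 I)) h0
    linarith
  set e := Equiv.sigmaFiberEquiv (fun I : (Ideal (𝓞 K))⁰ => ClassGroup.mk0 I)
  rw [← e.tsum_eq, Summable.tsum_sigma (f := fun x => χ (ClassGroup.mk0 (e x)) * (Ideal.absNorm ((e x : (Ideal (𝓞 K))⁰) : Ideal (𝓞 K)) : ℝ) ^ (-s)) (hsum.comp_injective e.injective), tsum_fintype]
  refine Finset.sum_congr rfl fun c _ => ?_
  rw [Zc, ← tsum_mul_left]
  refine tsum_congr fun I => ?_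
  have : ClassGroup.mk0 (e ⟨c, I⟩) = c := I.2
  rw [this]; rfl

end FSq

end

noncomputable section
open NumberField NumberField.Units Module Filter Topology


namespace FSq

open scoped Classical nonZeroDivisors

variable {K : Type*} [Field K] [NumberField K]

/-- real zeta function -/
def zR (K : Type*) [Field K] [NumberField K] (s : ℝ) : ℝ :=
  ∑' I : (Ideal (𝓞 K))⁰, (Ideal.absNorm (I : Ideal (𝓞 K)) : ℝ) ^ (-s)

lemma zR_eq {s : ℝ} (hs : 1 < s) (hs2 : s ≤ 2) : ((zR K s : ℝ) : ℂ) = dedekindZeta K s := by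
  have h := (summable_ideals (K := K) hs hs2).hasSum
  set e := Equiv.sigmaFiberEquiv (fun I : (Ideal (𝓞 K))⁰ => Ideal.absNorm (I : Ideal (𝓞 K)))
  rw [← e.hasSum_iff] at h
  have hcard : ∀ n : ℕ, n ≠ 0 → ∃ f : {I : (Ideal (𝓞 K))⁰ // Ideal.absNorm (I : Ideal (𝓞 K)) = n} ≃ {I : Ideal (𝓞 K) // Ideal.absNorm I = n}, True := by
    intro n hn
    refine ⟨⟨fun I => ⟨I.1, I.2⟩, fun I => ⟨⟨I.1, mem_nonZeroDivisors_of_ne_zero ?_⟩, I.2⟩, fun _ => rfl, fun _ => rfl⟩, trivial⟩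
    intro h0
    have := I.2
    rw [h0] at this
    simp at this
    exact hn this.symm
  have hfin : ∀ n : ℕ, n ≠ 0 → Finite {I : (Ideal (𝓞 K))⁰ // Ideal.absNorm (I : Ideal (𝓞 K)) = n} := by
    intro n hn
    obtain ⟨f, -⟩ := hcard n hn
    have : Finite {I : Ideal (𝓞 K) // Ideal.absNorm I = n} := Ideal.finite_setOfPred_absNorm_eq n
    exact Finite.of_equiv _ f.symm
  have h0 : IsEmpty {I : (Ideal (𝓞 K))⁰ // Ideal.absNorm (I : Ideal (𝓞 K)) = 0} := by
    constructor
    rintro ⟨I, hI⟩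
    have := absNorm_pos I
    rw [hI] at this
    simp at this
  have h2 : ∀ n : ℕ, HasSum (fun I : {I : (Ideal (𝓞 K))⁰ // Ideal.absNorm (I : Ideal (𝓞 K)) = n} =>
      ((fun I : (Ideal (𝓞 K))⁰ => (Ideal.absNorm (I : Ideal (𝓞 K)) : ℝ) ^ (-s)) ∘ e) ⟨n, I⟩)
      ((Nat.card {I : (Ideal (𝓞 K))⁰ // Ideal.absNorm (I : Ideal (𝓞 K)) = n} : ℝ) * (n : ℝ) ^ (-s)) := by
    intro n
    by_cases hn : n = 0
    · subst hn
      rw [Nat.card_of_isEmpty, Nat.cast_zero, zero_mul]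
      exact hasSum_empty
    · have := hfin n hn
      have := Fintype.ofFinite {I : (Ideal (𝓞 K))⁰ // Ideal.absNorm (I : Ideal (𝓞 K)) = n}
      convert hasSum_fintype _
      rw [Finset.sum_congr rfl (g := fun _ => (n : ℝ) ^ (-s))]
      · rw [Finset.sum_const, Finset.card_univ, nsmul_eq_mul, Nat.card_eq_fintype_card]
      · intro I _
        simp only [Function.comp]
        have : Ideal.absNorm ((e ⟨n, I⟩ : (Ideal (𝓞 K))⁰) : Ideal (𝓞 K)) = n := I.2
        rw [this]
  have h3 := h.sigma h2
  have h4 := (Complex.hasSum_ofReal).mpr h3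
  rw [dedekindZeta, LSeries, zR, ← h4.tsum_eq]
  refine tsum_congr fun n => ?_
  by_cases hn : n = 0
  · subst hn
    simp
  · rw [LSeries.term_of_ne_zero hn]
    obtain ⟨f, -⟩ := hcard n hn
    rw [Nat.card_congr f]
    push_cast
    rw [Complex.ofReal_cpow (Nat.cast_nonneg _), div_eq_mul_inv, ← Complex.cpow_neg]
    push_cast
    rfl

variable (K) in
lemma zR_tendsto : Tendsto (fun s : ℝ => (s - 1) * zR K s) (𝓝[>] 1) (𝓝 (dedekindZeta_residue K)) := by
  have h := tendsto_sub_one_mul_dedekindZeta_nhdsGT K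
  have h1 : Tendsto (fun s : ℝ => (((s - 1) * zR K s : ℝ) : ℂ)) (𝓝[>] 1) (𝓝 ((dedekindZeta_residue K : ℝ) : ℂ)) := by
    refine h.congr' ?_
    have : Set.Ioc (1:ℝ) 2 ∈ 𝓝[>] (1:ℝ) := Ioc_mem_nhdsGT (by norm_num)
    filter_upwards [this] with s hs
    rw [← zR_eq hs.1 hs.2]; push_cast; rfl
  have h2 := (Complex.continuous_re.tendsto _).comp h1
  simpa [Function.comp_def, -Complex.ofReal_mul] using h2

variable (K) in
lemma zR_bounds : ∃ c C : ℝ, 0 < c ∧ 0 < C ∧ ∀ᶠ s in 𝓝[>] (1:ℝ), c ≤ (s - 1) * zR K s ∧ (s - 1) * zR K s ≤ C := by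
  have h := zR_tendsto K
  have hp := dedekindZeta_residue_pos K
  refine ⟨dedekindZeta_residue K / 2, dedekindZeta_residue K + 1, by positivity, by positivity, ?_⟩
  filter_upwards [h.eventually (lt_mem_nhds (by linarith : dedekindZeta_residue K / 2 < dedekindZeta_residue K)),
    h.eventually (gt_mem_nhds (by linarith : dedekindZeta_residue K < dedekindZeta_residue K + 1))] with s h1 h2
  exact ⟨h1.le, h2.le⟩

lemma Zc_le_zR (c : ClassGroup (𝓞 K)) {s : ℝ} (hs : 1 < s) (hs2 : s ≤ 2) : Zc c s ≤ zR K s := by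
  unfold Zc zR
  exact Summable.tsum_subtype_le (fun I : (Ideal (𝓞 K))⁰ => (Ideal.absNorm (I : Ideal (𝓞 K)) : ℝ) ^ (-s))
    {I | ClassGroup.mk0 I = c} (fun _ => Real.rpow_nonneg (absNorm_pos _).le _) (summable_ideals hs hs2)

lemma class_compare2 (c : ClassGroup (𝓞 K)) : ∃ C : ℝ, ∀ᶠ s in 𝓝[>] (1:ℝ),
    |SO K s / torsionOrder K - Zc c s| ≤ C := by
  obtain ⟨C, q, hq, h⟩ := class_compare c
  obtain ⟨_, C2, _, hC2, h2⟩ := zR_bounds K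
  have hI : Set.Ioc (1:ℝ) 2 ∈ 𝓝[>] (1:ℝ) := Ioc_mem_nhdsGT (by norm_num)
  refine ⟨C + (|Real.log q| * (1 + q⁻¹)) * C2, ?_⟩
  filter_upwards [h2, hI] with s ⟨_, hs2⟩ ⟨hs, hs'⟩
  have e1 := h s hs hs'
  have e2 : |q ^ (1 - s) - 1| ≤ (s - 1) * (|Real.log q| * (1 + q⁻¹)) := by
    rw [Real.rpow_def_of_pos hq]
    set L := Real.log q with hL
    have hqi : q⁻¹ = Real.exp (-L) := by rw [Real.exp_neg, hL, Real.exp_log hq]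
    rw [hqi]
    rcases le_total 0 L with h0 | h0
    · have : Real.exp (L * (1 - s)) ≤ 1 := Real.exp_le_one_iff.mpr (by nlinarith)
      rw [abs_of_nonpos (by linarith), abs_of_nonneg h0]
      have := Real.add_one_le_exp (L * (1 - s))
      have := Real.exp_pos (-L)
      nlinarith [mul_nonneg (mul_nonneg (by linarith : 0 ≤ s - 1) h0) this.le]
    · have : 1 ≤ Real.exp (L * (1 - s)) := Real.one_le_exp (by nlinarith)
      rw [abs_of_nonneg (by linarith), abs_of_nonpos h0]
      have h5 := Real.add_one_le_exp (-(L * (1 - s)))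
      have h6 : Real.exp (-(L * (1 - s))) * Real.exp (L * (1 - s)) = 1 := by
        rw [← Real.exp_add]; simp
      have h7 : Real.exp (L * (1 - s)) ≤ Real.exp (-L) := Real.exp_le_exp.mpr (by nlinarith)
      have h8 : 0 ≤ L * (1 - s) := by nlinarith
      have h9 := mul_le_mul_of_nonneg_left h7 h8
      have h10 := mul_le_mul_of_nonneg_right h5 (Real.exp_pos (L * (1 - s))).le
      nlinarith
  have e3 : Zc c s ≤ zR K s := Zc_le_zR c hs hs'
  have e4 := Zc_nonneg c s
  have e5 : SO K s / torsionOrder K - Zc c s = (SO K s / torsionOrder K - q ^ (1 - s) * Zc c s)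
      + (q ^ (1 - s) - 1) * Zc c s := by ring
  rw [e5]
  refine (abs_add_le _ _).trans (add_le_add e1 ?_)
  rw [abs_mul, abs_of_nonneg e4]
  have h0 : 0 ≤ |Real.log q| * (1 + q⁻¹) := by positivity
  calc |q ^ (1 - s) - 1| * Zc c s ≤ ((s - 1) * (|Real.log q| * (1 + q⁻¹))) * zR K s :=
        mul_le_mul e2 e3 e4 (by nlinarith)
    _ = (|Real.log q| * (1 + q⁻¹)) * ((s - 1) * zR K s) := by ring
    _ ≤ _ := mul_le_mul_of_nonneg_left hs2 h0

/-- L-function of a class group character -/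
def LR (χ : ClassGroup (𝓞 K) → ℝ) (s : ℝ) : ℝ :=
  ∑' I : (Ideal (𝓞 K))⁰, χ (ClassGroup.mk0 I) * (Ideal.absNorm (I : Ideal (𝓞 K)) : ℝ) ^ (-s)

lemma LR_bounded (χ : ClassGroup (𝓞 K) → ℝ) (hχ : ∀ c, |χ c| ≤ 1) (h0 : ∑ c, χ c = 0) :
    ∃ C : ℝ, ∀ᶠ s in 𝓝[>] (1:ℝ), |LR χ s| ≤ C := by
  choose C hC using fun c : ClassGroup (𝓞 K) => class_compare2 c
  have hI : Set.Ioc (1:ℝ) 2 ∈ 𝓝[>] (1:ℝ) := Ioc_mem_nhdsGT (by norm_num)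
  refine ⟨∑ c, C c, ?_⟩
  filter_upwards [Filter.eventually_all.mpr hC, hI] with s h ⟨hs, hs2⟩
  have e : LR χ s = - ∑ c, χ c * (SO K s / torsionOrder K - Zc c s) := by
    rw [LR, tsum_ideals_class hs hs2 χ hχ]
    simp only [mul_sub, Finset.sum_sub_distrib, ← Finset.sum_mul, h0]
    ring
  rw [e, abs_neg]
  refine (Finset.abs_sum_le_sum_abs _ _).trans (Finset.sum_le_sum fun c _ => ?_)
  rw [abs_mul]
  have := mul_le_mul_of_nonneg_right (hχ c) (abs_nonneg (SO K s / torsionOrder K - Zc c s))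
  linarith [h c]

end FSq

end

noncomputable section
open Filter Topology


namespace FSq

open scoped Classical

section abstractEuler

variable {M ι : Type*} [CommMonoid M]

/-- indicator of elements with prime factors in a set -/
def smoothInd (π : ι → M) (S : Finset ι) (f : M → ℝ) (a : M) : ℝ :=
  if ∀ i, π i ∣ a → i ∈ S then f a else 0

lemma smoothInd_summable (π : ι → M) (S : Finset ι) (f : M → ℝ) (hf : Summable fun a => |f a|) :
    Summable (smoothInd π S f) := by
  refine Summable.of_norm_bounded hf fun a => ?_
  unfold smoothInd
  split_ifs <;> simp

lemma euler_step (π : ι → M) (h1 : ∀ i a b, π i * a = π i * b → a = b)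
    (h2 : ∀ i j, π i ∣ π j → i = j) (h3 : ∀ i a b, π i ∣ a * b → π i ∣ a ∨ π i ∣ b)
    (f : M →* ℝ) (hf : Summable fun a => |f a|) (S : Finset ι) (p : ι) (hp : p ∉ S) :
    (∑' a, smoothInd π (insert p S) f a) * (1 - f (π p)) = ∑' a, smoothInd π S f a := by
  set g := smoothInd π (insert p S) f with hg
  have hgs : Summable g := smoothInd_summable π _ f hf
  have hinj : Function.Injective (fun a => π p * a) := fun a b h => h1 p a b h
  have e1 : ∑' a, g (π p * a) = f (π p) * ∑' a, g a := by
    rw [← tsum_mul_left]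
    refine tsum_congr fun a => ?_
    have : (∀ i, π i ∣ π p * a → i ∈ insert p S) ↔ (∀ i, π i ∣ a → i ∈ insert p S) := by
      constructor
      · intro h i hi
        exact h i (hi.mul_left _)
      · intro h i hi
        rcases h3 i _ _ hi with h4 | h4
        · rw [h2 i p h4]; exact Finset.mem_insert_self _ _
        · exact h i h4
    simp only [hg, smoothInd, this]
    split_ifs <;> simp
  have e2 : ∑' a, g (π p * a) = ∑' a, if π p ∣ a then g a else 0 := by
    have : Function.support (fun a => if π p ∣ a then g a else 0) ⊆ Set.range (fun a => π p * a) := by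
      intro a ha
      simp only [Function.mem_support, ne_eq, ite_eq_right_iff, Classical.not_imp] at ha
      obtain ⟨b, hb⟩ := ha.1
      exact ⟨b, hb.symm⟩
    rw [← hinj.tsum_eq this]
    refine tsum_congr fun a => ?_
    rw [if_pos (Dvd.intro _ rfl)]
  have e3 : ∀ a, smoothInd π S f a = g a - if π p ∣ a then g a else 0 := by
    intro a
    by_cases hd : π p ∣ a
    · rw [if_pos hd, sub_self, smoothInd, if_neg]
      intro h; exact hp (h p hd)
    · rw [if_neg hd, sub_zero, hg, smoothInd, smoothInd]
      congr 1
      simp only [Finset.mem_insert, eq_iff_iff]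
      constructor
      · intro h i hi; right; exact h i hi
      · intro h i hi
        rcases h i hi with rfl | h4
        · exact absurd hi hd
        · exact h4
  have hs2 : Summable fun a => if π p ∣ a then g a else 0 := by
    refine Summable.of_norm_bounded hgs.abs fun a => ?_
    split_ifs <;> simp
  rw [tsum_congr e3, hgs.tsum_sub hs2, ← e2, e1]
  ring

lemma euler_finite (π : ι → M) (h1 : ∀ i a b, π i * a = π i * b → a = b)
    (h2 : ∀ i j, π i ∣ π j → i = j) (h3 : ∀ i a b, π i ∣ a * b → π i ∣ a ∨ π i ∣ b)
    (h4 : ∀ a, (∀ i, ¬ π i ∣ a) → a = 1) (h4' : ∀ i, ¬ π i ∣ 1)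
    (f : M →* ℝ) (hf : Summable fun a => |f a|) (hne : ∀ i, f (π i) ≠ 1) (S : Finset ι) :
    ∑' a, smoothInd π S f a = ∏ i ∈ S, (1 - f (π i))⁻¹ := by
  induction S using Finset.induction_on with
  | empty =>
    rw [Finset.prod_empty, tsum_eq_single 1]
    · rw [smoothInd, if_pos, map_one]
      intro i hi; exact absurd hi (h4' i)
    · intro a ha
      rw [smoothInd, if_neg]
      intro h
      exact ha (h4 a fun i hi => by simpa using h i hi)
  | insert p S hp ih =>
    rw [Finset.prod_insert hp, ← ih, ← euler_step π h1 h2 h3 f hf S p hp]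
    have : 1 - f (π p) ≠ 0 := sub_ne_zero.mpr (hne p).symm
    field_simp

lemma euler_tendsto (π : ι → M) (h1 : ∀ i a b, π i * a = π i * b → a = b)
    (h2 : ∀ i j, π i ∣ π j → i = j) (h3 : ∀ i a b, π i ∣ a * b → π i ∣ a ∨ π i ∣ b)
    (h4 : ∀ a, (∀ i, ¬ π i ∣ a) → a = 1) (h4' : ∀ i, ¬ π i ∣ 1)
    (h5 : ∀ a, {i | π i ∣ a}.Finite)
    (f : M →* ℝ) (hf : Summable fun a => |f a|) (hne : ∀ i, f (π i) ≠ 1) :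
    Tendsto (fun S : Finset ι => ∏ i ∈ S, (1 - f (π i))⁻¹) atTop (𝓝 (∑' a, f a)) := by
  simp_rw [← euler_finite π h1 h2 h3 h4 h4' f hf hne]
  refine tendsto_tsum_of_dominated_convergence (bound := fun a => |f a|) hf ?_ ?_
  · intro a
    refine tendsto_const_nhds.congr' ?_
    filter_upwards [eventually_ge_atTop (h5 a).toFinset] with S hS
    rw [smoothInd, if_pos]
    intro i hi
    exact hS (by simpa using hi)
  · refine Eventually.of_forall fun S a => ?_
    unfold smoothInd
    split_ifs <;> simp

end abstractEuler

open NumberField IsDedekindDomain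
open scoped nonZeroDivisors

variable {K : Type*} [Field K] [NumberField K]

/-- prime as element of the monoid of nonzero ideals -/
def pI (v : HeightOneSpectrum (𝓞 K)) : (Ideal (𝓞 K))⁰ :=
  ⟨v.asIdeal, mem_nonZeroDivisors_of_ne_zero v.ne_bot⟩

lemma dvd_coe {I J : (Ideal (𝓞 K))⁰} : I ∣ J ↔ (I : Ideal (𝓞 K)) ∣ J := by
  constructor
  · rintro ⟨c, rfl⟩
    exact ⟨c, rfl⟩
  · rintro ⟨c, hc⟩
    refine ⟨⟨c, mem_nonZeroDivisors_of_ne_zero ?_⟩, Subtype.ext hc⟩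
    rintro rfl
    rw [mul_zero] at hc
    exact nonZeroDivisors.coe_ne_zero J hc

lemma euler_ideals (f : (Ideal (𝓞 K))⁰ →* ℝ) (hf : Summable fun a => |f a|)
    (hne : ∀ v, f (pI v) ≠ 1) :
    Tendsto (fun S : Finset (HeightOneSpectrum (𝓞 K)) => ∏ v ∈ S, (1 - f (pI v))⁻¹) atTop
      (𝓝 (∑' I, f I)) := by
  refine euler_tendsto pI ?_ ?_ ?_ ?_ ?_ ?_ f hf hne
  · intro i a b h
    apply Subtype.ext
    exact mul_left_cancel₀ i.ne_bot (congrArg Subtype.val h)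
  · intro i j h
    rw [dvd_coe] at h
    apply HeightOneSpectrum.ext
    exact ((j.isMaximal.eq_of_le i.isPrime.ne_top (Ideal.le_of_dvd h))).symm
  · intro i a b h
    rw [dvd_coe] at h ⊢
    rw [dvd_coe]
    exact i.prime.dvd_or_dvd h
  · intro a h
    by_contra hne
    have : (a : Ideal (𝓞 K)) ≠ ⊤ := fun h => hne (Subtype.ext (h.trans Ideal.one_eq_top.symm))
    obtain ⟨m, hm, hle⟩ := Ideal.exists_le_maximal _ this
    have hm0 : m ≠ ⊥ := by
      rintro rfl
      exact nonZeroDivisors.coe_ne_zero a (le_bot_iff.mp hle)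
    exact h ⟨m, hm.isPrime, hm0⟩ (dvd_coe.mpr (Ideal.dvd_iff_le.mpr hle))
  · intro i h
    rw [dvd_coe] at h
    exact i.prime.not_isUnit (isUnit_of_dvd_one h)
  · intro a
    have := Ideal.finite_factors (nonZeroDivisors.coe_ne_zero a)
    refine this.subset ?_
    intro i hi
    have hi' : pI i ∣ a := hi
    rw [dvd_coe] at hi'
    exact hi'

end FSq

end

noncomputable section
open NumberField IsDedekindDomain Filter Topology


namespace FSq

open scoped Classical nonZeroDivisors

variable {K : Type*} [Field K] [NumberField K]

/-- norm of a prime, as a real number -/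
def nv (v : HeightOneSpectrum (𝓞 K)) : ℝ := Ideal.absNorm v.asIdeal

lemma nv_ge (v : HeightOneSpectrum (𝓞 K)) : 2 ≤ nv v := by
  have h0 : Ideal.absNorm v.asIdeal ≠ 0 := by
    rw [Ne, Ideal.absNorm_eq_zero_iff]; exact v.ne_bot
  have h1 : Ideal.absNorm v.asIdeal ≠ 1 := by
    rw [Ne, Ideal.absNorm_eq_one_iff]; exact v.isPrime.ne_top
  unfold nv
  exact_mod_cast (by omega : 2 ≤ Ideal.absNorm v.asIdeal)

lemma nv_rpow_lt {s : ℝ} (hs : 0 < s) (v : HeightOneSpectrum (𝓞 K)) :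
    0 < nv v ^ (-s) ∧ nv v ^ (-s) < 1 := by
  have := nv_ge v
  exact ⟨Real.rpow_pos_of_pos (by linarith) _, Real.rpow_lt_one_of_one_lt_of_neg (by linarith) (by linarith)⟩

/-- the multiplicative function attached to a character -/
def fχ (χ : ClassGroup (𝓞 K) →* ℝ) (s : ℝ) : (Ideal (𝓞 K))⁰ →* ℝ where
  toFun I := χ (ClassGroup.mk0 I) * (Ideal.absNorm (I : Ideal (𝓞 K)) : ℝ) ^ (-s)
  map_one' := by simp
  map_mul' I J := by
    simp only [map_mul, Submonoid.coe_mul, Nat.cast_mul]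
    rw [Real.mul_rpow (Nat.cast_nonneg _) (Nat.cast_nonneg _)]
    ring

lemma fχ_pI (χ : ClassGroup (𝓞 K) →* ℝ) (s : ℝ) (v : HeightOneSpectrum (𝓞 K)) :
    fχ χ s (pI v) = χ (ClassGroup.mk0 (pI v)) * nv v ^ (-s) := rfl

lemma fχ_tendsto (χ : ClassGroup (𝓞 K) →* ℝ) (hχ : ∀ c, χ c = 1 ∨ χ c = -1) {s : ℝ} (hs : 1 < s)
    (hs2 : s ≤ 2) : Tendsto (fun S : Finset (HeightOneSpectrum (𝓞 K)) =>
      ∏ v ∈ S, (1 - χ (ClassGroup.mk0 (pI v)) * nv v ^ (-s))⁻¹) atTop (𝓝 (LR χ s)) := by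
  refine euler_ideals (fχ χ s) ?_ ?_
  · refine (summable_ideals (K := K) hs hs2).congr fun I => ?_
    change _ = |χ (ClassGroup.mk0 I) * (Ideal.absNorm (I : Ideal (𝓞 K)) : ℝ) ^ (-s)|
    rw [abs_mul, abs_of_nonneg (Real.rpow_nonneg (absNorm_pos I).le _)]
    rcases hχ (ClassGroup.mk0 I) with h | h <;> simp [h]
  · intro v
    rw [fχ_pI]
    have := nv_rpow_lt (by linarith : 0 < s) v
    rcases hχ (ClassGroup.mk0 (pI v)) with h | h <;> rw [h] <;> intro h2 <;> linarith

lemma zR_tendsto_prod {s : ℝ} (hs : 1 < s)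
    (hs2 : s ≤ 2) : Tendsto (fun S : Finset (HeightOneSpectrum (𝓞 K)) =>
      ∏ v ∈ S, (1 - nv v ^ (-s))⁻¹) atTop (𝓝 (zR K s)) := by
  have h := fχ_tendsto (K := K) 1 (fun _ => Or.inl rfl) hs hs2
  have : LR (1 : ClassGroup (𝓞 K) →* ℝ) s = zR K s := by simp [LR, zR]
  rw [this] at h
  simpa using h

lemma prod_le_of_tendsto {ι : Type*} (g : ι → ℝ) (hg : ∀ i, 1 ≤ g i) {a : ℝ}
    (h : Tendsto (fun S : Finset ι => ∏ i ∈ S, g i) atTop (𝓝 a)) (S : Finset ι) :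
    ∏ i ∈ S, g i ≤ a := by
  refine ge_of_tendsto h ?_
  filter_upwards [eventually_ge_atTop S] with T hT
  exact Finset.prod_le_prod_of_subset_of_one_le hT (fun i _ => by linarith [hg i]) (fun i _ _ => hg i)

lemma fac_ge_one {q a b : ℝ} (h0 : 0 < q) (h1 : q < 1) (ha : a = 1 ∨ a = -1) (hb : b = 1 ∨ b = -1) :
    1 ≤ (1 - q)⁻¹ * (1 - a * q)⁻¹ * (1 - b * q)⁻¹ * (1 - (a * b) * q)⁻¹ := by
  have e1 : 0 < 1 - q := by linarith
  have e2 : 0 < 1 + q := by linarith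
  have e3 : 1 ≤ (1 - q)⁻¹ := (one_le_inv₀ e1).mpr (by linarith)
  have e4 : 1 ≤ (1 - q)⁻¹ * (1 + q)⁻¹ := by
    rw [← mul_inv]
    refine (one_le_inv₀ (by positivity)).mpr (by nlinarith)
  rcases ha with rfl | rfl <;> rcases hb with rfl | rfl <;> norm_num
  · calc (1:ℝ) ≤ (1 - q)⁻¹ ^ 4 := one_le_pow₀ e3
      _ = _ := by ring
  all_goals
    calc (1:ℝ) ≤ ((1 - q)⁻¹ * (1 + q)⁻¹) ^ 2 := one_le_pow₀ e4
      _ = _ := by ring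

theorem index_main {L : Type*} [Field L] [NumberField L]
    (P : HeightOneSpectrum (𝓞 L) → HeightOneSpectrum (𝓞 K))
    (χ₁ χ₂ : ClassGroup (𝓞 K) →* ℝ) (hχ₁ : ∀ c, χ₁ c = 1 ∨ χ₁ c = -1) (hχ₂ : ∀ c, χ₂ c = 1 ∨ χ₂ c = -1)
    (hfib : ∀ v, (∀ T : Finset (HeightOneSpectrum (𝓞 L)), (∀ w ∈ T, P w = v) →
      (T.card ≤ 2 ∧ (∀ w ∈ T, nv w = nv v) ∧ χ₁ (ClassGroup.mk0 (pI v)) = 1 ∧ χ₂ (ClassGroup.mk0 (pI v)) = 1) ∨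
      (T.card ≤ 1 ∧ ∀ w ∈ T, nv w = nv v ^ 2)))
    {s : ℝ} (hs : 1 < s) (hs2 : s ≤ 2) :
    (zR L s) ^ 2 ≤ (zR K 2) ^ 2 * (zR K s * LR χ₁ s * LR χ₂ s * LR (χ₁ * χ₂ : ClassGroup (𝓞 K) →* ℝ) s) := by
  set q : HeightOneSpectrum (𝓞 K) → ℝ := fun v => nv v ^ (-s) with hq
  have hq1 : ∀ v, 0 < q v ∧ q v < 1 := fun v => nv_rpow_lt (by linarith) v
  set fac : HeightOneSpectrum (𝓞 K) → ℝ := fun v => (1 - q v)⁻¹ * (1 - χ₁ (ClassGroup.mk0 (pI v)) * q v)⁻¹ *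
    (1 - χ₂ (ClassGroup.mk0 (pI v)) * q v)⁻¹ * (1 - (χ₁ (ClassGroup.mk0 (pI v)) * χ₂ (ClassGroup.mk0 (pI v))) * q v)⁻¹ with hfac
  have hχ12 : ∀ c, (χ₁ * χ₂ : ClassGroup (𝓞 K) →* ℝ) c = 1 ∨ (χ₁ * χ₂ : ClassGroup (𝓞 K) →* ℝ) c = -1 := by
    intro c
    rw [MonoidHom.mul_apply]
    rcases hχ₁ c with h | h <;> rcases hχ₂ c with h' | h' <;> simp [h, h']
  have hfac1 : ∀ v, 1 ≤ fac v := fun v => fac_ge_one (hq1 v).1 (hq1 v).2 (hχ₁ _) (hχ₂ _)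
  have ht : Tendsto (fun S : Finset (HeightOneSpectrum (𝓞 K)) => ∏ v ∈ S, fac v) atTop
      (𝓝 (zR K s * LR χ₁ s * LR χ₂ s * LR (χ₁ * χ₂ : ClassGroup (𝓞 K) →* ℝ) s)) := by
    have := (((zR_tendsto_prod (K := K) hs hs2).mul (fχ_tendsto χ₁ hχ₁ hs hs2)).mul (fχ_tendsto χ₂ hχ₂ hs hs2)).mul
      (fχ_tendsto (χ₁ * χ₂) hχ12 hs hs2)
    refine this.congr fun S => ?_
    rw [← Finset.prod_mul_distrib, ← Finset.prod_mul_distrib, ← Finset.prod_mul_distrib]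
    rfl
  have hz2 := zR_tendsto_prod (K := K) (s := 2) (by norm_num) le_rfl
  have hr : ∀ v : HeightOneSpectrum (𝓞 K), 0 < nv v ^ (-2 : ℝ) ∧ nv v ^ (-2 : ℝ) < 1 :=
    fun v => nv_rpow_lt (by norm_num) v
  have hr1 : ∀ v : HeightOneSpectrum (𝓞 K), 1 ≤ (1 - nv v ^ (-2 : ℝ))⁻¹ := fun v =>
    (one_le_inv₀ (by linarith [hr v])).mpr (by linarith [hr v])
  have hqq : ∀ v, (1 - q v ^ 2)⁻¹ ≤ (1 - nv v ^ (-2 : ℝ))⁻¹ := by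
    intro v
    refine inv_anti₀ (by linarith [hr v]) ?_
    have : q v ^ 2 ≤ nv v ^ (-2 : ℝ) := by
      rw [hq]
      simp only
      rw [← Real.rpow_natCast, ← Real.rpow_mul (by linarith [nv_ge v])]
      apply Real.rpow_le_rpow_of_exponent_le (by linarith [nv_ge v])
      push_cast; linarith
    linarith
  have hq21 : ∀ v, 1 ≤ (1 - q v ^ 2)⁻¹ := by
    intro v
    have := hq1 v
    exact (one_le_inv₀ (by nlinarith)).mpr (by nlinarith)
  have hg1 : ∀ w : HeightOneSpectrum (𝓞 L), 1 ≤ (1 - nv w ^ (-s))⁻¹ := fun w => by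
    have := nv_rpow_lt (by linarith : 0 < s) w
    exact (one_le_inv₀ (by linarith)).mpr (by linarith)
  -- local bound
  have hloc : ∀ (v : HeightOneSpectrum (𝓞 K)) (T : Finset (HeightOneSpectrum (𝓞 L))), (∀ w ∈ T, P w = v) →
      (∏ w ∈ T, (1 - nv w ^ (-s))⁻¹) ^ 2 ≤ ((1 - nv v ^ (-2 : ℝ))⁻¹) ^ 2 * fac v := by
    intro v T hT
    have h0 : 0 < 1 - q v := by linarith [hq1 v]
    rcases hfib v T hT with ⟨hc, hn, hx1, hx2⟩ | ⟨hc, hn⟩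
    · rw [Finset.prod_congr rfl (g := fun _ => (1 - q v)⁻¹) (fun w hw => by rw [hn w hw]), Finset.prod_const]
      have e3 : 1 ≤ (1 - q v)⁻¹ := (one_le_inv₀ h0).mpr (by linarith [hq1 v])
      have e4 : fac v = ((1 - q v)⁻¹ ^ 2) ^ 2 := by
        simp only [hfac, hx1, hx2]; ring
      have e5 : (1 - q v)⁻¹ ^ T.card ≤ (1 - q v)⁻¹ ^ 2 := pow_le_pow_right₀ e3 hc
      have e6 : ((1 - q v)⁻¹ ^ T.card) ^ 2 ≤ fac v := by
        rw [e4]; exact pow_le_pow_left₀ (by positivity) e5 2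
      have e7 : 1 ≤ ((1 - nv v ^ (-2 : ℝ))⁻¹) ^ 2 := one_le_pow₀ (hr1 v)
      nlinarith [hfac1 v]
    · have e1 : ∀ w ∈ T, (1 - nv w ^ (-s))⁻¹ = (1 - q v ^ 2)⁻¹ := by
        intro w hw
        rw [hn w hw, hq]
        simp only
        rw [← Real.rpow_natCast, ← Real.rpow_natCast, ← Real.rpow_mul (by linarith [nv_ge v]), ← Real.rpow_mul (by linarith [nv_ge v]), mul_comm]
      rw [Finset.prod_congr rfl e1, Finset.prod_const]
      have e5 : (1 - q v ^ 2)⁻¹ ^ T.card ≤ (1 - q v ^ 2)⁻¹ ^ 1 := pow_le_pow_right₀ (hq21 v) hc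
      rw [pow_one] at e5
      have e6 : ((1 - q v ^ 2)⁻¹ ^ T.card) ^ 2 ≤ ((1 - nv v ^ (-2 : ℝ))⁻¹) ^ 2 :=
        pow_le_pow_left₀ (pow_nonneg (by linarith [hq21 v]) _) (e5.trans (hqq v)) 2
      have e7 : 1 ≤ ((1 - nv v ^ (-2 : ℝ))⁻¹) ^ 2 := one_le_pow₀ (hr1 v)
      nlinarith [hfac1 v]
  have hT : ∀ T : Finset (HeightOneSpectrum (𝓞 L)), (∏ w ∈ T, (1 - nv w ^ (-s))⁻¹) ^ 2 ≤
      (zR K 2) ^ 2 * (zR K s * LR χ₁ s * LR χ₂ s * LR (χ₁ * χ₂ : ClassGroup (𝓞 K) →* ℝ) s) := by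
    intro T
    rw [← Finset.prod_fiberwise_of_maps_to (t := T.image P) (g := P) (fun w hw => Finset.mem_image_of_mem P hw),
      ← Finset.prod_pow]
    calc _ ≤ ∏ v ∈ T.image P, (((1 - nv v ^ (-2 : ℝ))⁻¹) ^ 2 * fac v) :=
          Finset.prod_le_prod (fun v _ => by positivity) (fun v _ => hloc v _ (fun w hw => (Finset.mem_filter.mp hw).2))
      _ = (∏ v ∈ T.image P, (1 - nv v ^ (-2 : ℝ))⁻¹) ^ 2 * ∏ v ∈ T.image P, fac v := by
          rw [Finset.prod_mul_distrib, Finset.prod_pow]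
      _ ≤ _ := by
          have p0 : 0 ≤ ∏ v ∈ T.image P, (1 - nv v ^ (-2 : ℝ))⁻¹ := Finset.prod_nonneg fun v _ => by linarith [hr1 v]
          refine mul_le_mul (pow_le_pow_left₀ p0 ?_ 2) ?_ (Finset.prod_nonneg fun v _ => by linarith [hfac1 v]) (by positivity)
          · exact prod_le_of_tendsto _ hr1 hz2 _
          · exact prod_le_of_tendsto _ hfac1 ht _
  exact le_of_tendsto ((zR_tendsto_prod (K := L) hs hs2).pow 2) (Eventually.of_forall hT)

lemma sum_char_eq_zero (χ : ClassGroup (𝓞 K) →* ℝ) (hχ : χ ≠ 1) : ∑ c, χ c = 0 := by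
  have : ∃ a, χ a ≠ 1 := by
    by_contra h
    push Not at h
    exact hχ (MonoidHom.ext h)
  obtain ⟨a, ha⟩ := this
  have h1 : ∑ c, χ (a * c) = ∑ c, χ c := Fintype.sum_equiv (Equiv.mulLeft a) _ _ (fun _ => rfl)
  simp only [map_mul, ← Finset.mul_sum] at h1
  have h2 : (χ a - 1) * ∑ c, χ c = 0 := by rw [sub_mul, h1]; ring
  rcases mul_eq_zero.mp h2 with h | h
  · exact absurd (by linarith) ha
  · exact h

theorem index_contra {L : Type*} [Field L] [NumberField L]
    (P : HeightOneSpectrum (𝓞 L) → HeightOneSpectrum (𝓞 K))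
    (χ₁ χ₂ : ClassGroup (𝓞 K) →* ℝ) (hχ₁ : ∀ c, χ₁ c = 1 ∨ χ₁ c = -1) (hχ₂ : ∀ c, χ₂ c = 1 ∨ χ₂ c = -1)
    (hfib : ∀ v, (∀ T : Finset (HeightOneSpectrum (𝓞 L)), (∀ w ∈ T, P w = v) →
      (T.card ≤ 2 ∧ (∀ w ∈ T, nv w = nv v) ∧ χ₁ (ClassGroup.mk0 (pI v)) = 1 ∧ χ₂ (ClassGroup.mk0 (pI v)) = 1) ∨
      (T.card ≤ 1 ∧ ∀ w ∈ T, nv w = nv v ^ 2)))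
    (h1 : χ₁ ≠ 1) (h2 : χ₂ ≠ 1) (h12 : χ₁ * χ₂ ≠ 1) : False := by
  have hab : ∀ (χ : ClassGroup (𝓞 K) →* ℝ), (∀ c, χ c = 1 ∨ χ c = -1) → ∀ c, |χ c| ≤ 1 := by
    intro χ h c
    rcases h c with h | h <;> simp [h]
  have hχ12 : ∀ c, (χ₁ * χ₂ : ClassGroup (𝓞 K) →* ℝ) c = 1 ∨ (χ₁ * χ₂ : ClassGroup (𝓞 K) →* ℝ) c = -1 := by
    intro c
    rw [MonoidHom.mul_apply]
    rcases hχ₁ c with h | h <;> rcases hχ₂ c with h' | h' <;> simp [h, h']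
  obtain ⟨B1, hB1⟩ := LR_bounded χ₁ (hab _ hχ₁) (sum_char_eq_zero _ h1)
  obtain ⟨B2, hB2⟩ := LR_bounded χ₂ (hab _ hχ₂) (sum_char_eq_zero _ h2)
  obtain ⟨B3, hB3⟩ := LR_bounded (χ₁ * χ₂ : ClassGroup (𝓞 K) →* ℝ) (hab _ hχ12) (sum_char_eq_zero _ h12)
  obtain ⟨_, C, _, hC, hzK⟩ := zR_bounds K
  obtain ⟨c, _, hc, _, hzL⟩ := zR_bounds L
  have hI : Set.Ioc (1:ℝ) 2 ∈ 𝓝[>] (1:ℝ) := Ioc_mem_nhdsGT (by norm_num)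
  set D := (zR K 2) ^ 2 * (C * B1 * B2 * B3) with hD
  have key : ∀ᶠ s in 𝓝[>] (1:ℝ), c ^ 2 ≤ D * (s - 1) := by
    filter_upwards [hB1, hB2, hB3, hzK, hzL, hI] with s b1 b2 b3 ⟨_, z1⟩ ⟨z2, _⟩ ⟨hs, hs2⟩
    have hm := index_main P χ₁ χ₂ hχ₁ hχ₂ hfib hs hs2
    have hz0 : 0 ≤ zR K s := tsum_nonneg fun _ => Real.rpow_nonneg (absNorm_pos _).le _
    have ht : 0 < s - 1 := by linarith
    have e1 : zR K s * LR χ₁ s * LR χ₂ s * LR (χ₁ * χ₂ : ClassGroup (𝓞 K) →* ℝ) s ≤ zR K s * (B1 * B2 * B3) := by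
      have a1 : |LR χ₁ s * LR χ₂ s * LR (χ₁ * χ₂ : ClassGroup (𝓞 K) →* ℝ) s| ≤ B1 * B2 * B3 := by
        rw [abs_mul, abs_mul]
        have n1 := (abs_nonneg _).trans b1
        have n2 := (abs_nonneg _).trans b2
        exact mul_le_mul (mul_le_mul b1 b2 (abs_nonneg _) n1) b3 (abs_nonneg _) (mul_nonneg n1 n2)
      have a2 := (le_abs_self _).trans a1
      calc _ = zR K s * (LR χ₁ s * LR χ₂ s * LR (χ₁ * χ₂ : ClassGroup (𝓞 K) →* ℝ) s) := by ring
        _ ≤ _ := mul_le_mul_of_nonneg_left a2 hz0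
    have n1 := (abs_nonneg _).trans b1
    have n2 := (abs_nonneg _).trans b2
    have n3 := (abs_nonneg _).trans b3
    calc c ^ 2 ≤ ((s - 1) * zR L s) ^ 2 := pow_le_pow_left₀ hc.le z2 2
      _ = (s - 1) ^ 2 * (zR L s) ^ 2 := by ring
      _ ≤ (s - 1) ^ 2 * ((zR K 2) ^ 2 * (zR K s * (B1 * B2 * B3))) := by
          refine mul_le_mul_of_nonneg_left (hm.trans ?_) (by positivity)
          exact mul_le_mul_of_nonneg_left e1 (by positivity)
      _ = ((zR K 2) ^ 2 * (B1 * B2 * B3)) * (s - 1) * ((s - 1) * zR K s) := by ring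
      _ ≤ ((zR K 2) ^ 2 * (B1 * B2 * B3)) * (s - 1) * C := by
          refine mul_le_mul_of_nonneg_left z1 (by positivity)
      _ = D * (s - 1) := by rw [hD]; ring
  have ht : Tendsto (fun s : ℝ => D * (s - 1)) (𝓝[>] 1) (𝓝 0) := by
    have : Tendsto (fun s : ℝ => D * (s - 1)) (𝓝 1) (𝓝 (D * (1 - 1))) :=
      Continuous.tendsto (by fun_prop) 1
    rw [sub_self, mul_zero] at this
    exact this.mono_left nhdsWithin_le_nhds
  have := ge_of_tendsto ht key
  nlinarith [sq_pos_of_pos hc]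

end FSq

end

noncomputable section
namespace FSq

lemma relIndex_map_of_ker_le {G G' : Type*} [CommGroup G] [CommGroup G'] (φ : G →* G')
    {X Y : Subgroup G} (hk : φ.ker ≤ X) :
    (X.map φ).relIndex (Y.map φ) = X.relIndex Y := by
  have := Subgroup.relIndex_comap (H := X.map φ) φ Y
  rw [← this, Subgroup.comap_map_eq, sup_eq_left.mpr hk]

section
variable {A D : Type*} [CommGroup A] [CommGroup D]

/-- norm -/
def nh (s : A →* A) : A →* A := MonoidHom.id A * s
/-- quotient map -/
def mh (s : A →* A) : A →* A := MonoidHom.id A / s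

@[simp] lemma nh_apply (s : A →* A) (x : A) : nh s x = x * s x := rfl
@[simp] lemma mh_apply (s : A →* A) (x : A) : mh s x = x / s x := rfl

/-- squares of a subgroup -/
def sqs (B : Subgroup A) : Subgroup A := B.map (powMonoidHom 2)

theorem herbrand (s : A →* A) (t : D →* D) (δ : A →* D)
    (hs : ∀ a, s (s a) = a) (ht : ∀ d, t (t d) = d) (hδ : ∀ a, δ (s a) = t (δ a))
    (h90A : ∀ a, a * s a = 1 → ∃ c, a = c / s c)
    (h90D : ∀ d, d * t d = 1 → ∃ c, d = c / t c)
    (r : ℕ)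
    (hE0 : (sqs (δ.ker ⊓ (mh s).ker)).relIndex (δ.ker ⊓ (mh s).ker) ≠ 0)
    (hE : (sqs (δ.ker ⊓ (mh s).ker)).relIndex (δ.ker ⊓ (mh s).ker) ≤ 2 ^ r)
    (hB : 2 ^ (r+1) ≤ (sqs (δ.ker ⊓ (nh s).ker)).relIndex (δ.ker ⊓ (nh s).ker))
    (hfinL : δ.range.index ≠ 0)
    (hfinK : ((mh s).ker.map δ).relIndex (mh t).ker ≠ 0)
    (hidx : ((nh t).range ⊔ (mh s).ker.map δ).relIndex (mh t).ker ≤ 2) :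
    ∀ e, δ e = 1 → s e = e → ∃ x, e = x * s x := by
  set EL := δ.ker with hEL
  set F := (mh s).ker with hF
  set E := EL ⊓ F with hEd
  set B := EL ⊓ (nh s).ker with hBd
  set P := δ.range with hP
  set Q := F.map δ with hQ
  set I := (mh t).ker with hI
  have memEL : ∀ {a}, a ∈ EL ↔ δ a = 1 := fun {a} => MonoidHom.mem_ker
  have memF : ∀ {a}, a ∈ F ↔ a = s a := fun {a} => by
    rw [hF, MonoidHom.mem_ker, mh_apply, div_eq_one]
  have memI : ∀ {a}, a ∈ I ↔ a = t a := fun {a} => by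
    rw [hI, MonoidHom.mem_ker, mh_apply, div_eq_one]
  have memB : ∀ {a}, a ∈ B ↔ δ a = 1 ∧ a * s a = 1 := fun {a} => by
    rw [hBd, Subgroup.mem_inf, memEL, MonoidHom.mem_ker, nh_apply]
  have memE : ∀ {a}, a ∈ E ↔ δ a = 1 ∧ a = s a := fun {a} => by
    rw [hEd, Subgroup.mem_inf, memEL, memF]
  have memQ : ∀ {d}, d ∈ Q ↔ ∃ a, a = s a ∧ δ a = d := fun {d} => by
    simp [hQ, Subgroup.mem_map, memF]
  have memP : ∀ {d}, d ∈ P ↔ ∃ a, δ a = d := fun {d} => by simp [hP]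
  have mhδ : ∀ a, mh t (δ a) = δ (mh s a) := fun a => by simp [hδ]
  have nhδ : ∀ a, nh t (δ a) = δ (nh s a) := fun a => by simp [hδ]
  have mnA : ∀ a, nh s (mh s a) = 1 := fun a => by simp [hs]
  have mnD : ∀ a, nh t (mh t a) = 1 := fun a => by simp [ht]
  have nmA : ∀ a, mh s (nh s a) = 1 := fun a => by simp [hs, mul_comm]
  have nmD : ∀ a, mh t (nh t a) = 1 := fun a => by simp [ht, mul_comm]
  have hQI : Q ≤ I := by
    intro d hd
    obtain ⟨a, ha, rfl⟩ := memQ.1 hd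
    rw [memI, ← hδ, ← ha]
  have hQP : Q ≤ P := by
    intro d hd
    obtain ⟨a, ha, rfl⟩ := memQ.1 hd
    exact memP.2 ⟨a, rfl⟩
  -- step 1
  have step1 : Q.relIndex (I ⊓ P) = (EL.map (mh s)).relIndex B := by
    set Y : Subgroup A := EL.comap (mh s) with hY
    have e1 : Y.map δ = I ⊓ P := by
      ext d
      simp only [Subgroup.mem_map, Subgroup.mem_inf, hY, Subgroup.mem_comap, memEL]
      constructor
      · rintro ⟨a, ha, rfl⟩
        refine ⟨?_, memP.2 ⟨a, rfl⟩⟩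
        rw [hI, MonoidHom.mem_ker, mhδ, ha]
      · rintro ⟨h1, h2⟩
        obtain ⟨a, rfl⟩ := memP.1 h2
        rw [hI, MonoidHom.mem_ker, mhδ] at h1
        exact ⟨a, h1, rfl⟩
    have e2 : (F ⊔ EL).map δ = Q := by
      rw [Subgroup.map_sup, hEL, (Subgroup.map_eq_bot_iff δ.ker).2 le_rfl, sup_bot_eq]
    have e3 : Y.map (mh s) = B := by
      ext b
      simp only [Subgroup.mem_map, hY, Subgroup.mem_comap]
      constructor
      · rintro ⟨a, ha, rfl⟩
        exact memB.2 ⟨memEL.1 ha, mnA a⟩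
      · intro hb
        obtain ⟨h1, h2⟩ := memB.1 hb
        obtain ⟨c, hc⟩ := h90A b h2
        refine ⟨c, ?_, hc.symm⟩
        rw [mh_apply, ← hc]; exact memEL.2 h1
    have e4 : (F ⊔ EL).map (mh s) = EL.map (mh s) := by
      rw [Subgroup.map_sup, hF, (Subgroup.map_eq_bot_iff (mh s).ker).2 le_rfl, bot_sup_eq]
    rw [← e1, ← e2, relIndex_map_of_ker_le δ le_sup_right,
      ← relIndex_map_of_ker_le (mh s) (le_sup_left : F ≤ F ⊔ EL), e3, e4]
  set κ := Q.relIndex (I ⊓ P) with hκ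
  -- step 2
  have hnEL : EL.map (nh s) ≤ E := by
    rintro _ ⟨a, ha, rfl⟩
    rw [memE, ← nhδ, memEL.1 ha, map_one]
    refine ⟨rfl, ?_⟩
    simp [hs, mul_comm]
  have hmEL : EL.map (mh s) ≤ B := by
    rintro _ ⟨a, ha, rfl⟩
    rw [memB, ← mhδ, memEL.1 ha, map_one]
    exact ⟨rfl, mnA a⟩
  have sqE : E.map (nh s) = sqs E := by
    ext x
    simp only [sqs, Subgroup.mem_map]
    constructor <;> rintro ⟨a, ha, rfl⟩ <;> refine ⟨a, ha, ?_⟩ <;>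
      simp [← (memE.1 ha).2, sq]
  have sqB : B.map (mh s) = sqs B := by
    ext x
    simp only [sqs, Subgroup.mem_map]
    have : ∀ a ∈ B, a / s a = a ^ 2 := by
      intro a ha
      have := (memB.1 ha).2
      rw [div_eq_mul_inv, sq, inv_eq_of_mul_eq_one_left this]
    constructor <;> rintro ⟨a, ha, rfl⟩ <;> refine ⟨a, ha, ?_⟩ <;>
      simp [this a ha]
  have hEEL : E ≤ EL := inf_le_left
  have hBEL : B ≤ EL := inf_le_left
  have s2 : (sqs E).relIndex (EL.map (nh s)) = (sqs B).relIndex (EL.map (mh s)) := by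
    have hk1 : (E ⊔ B).map (nh s) = sqs E := by
      rw [Subgroup.map_sup, sqE, (Subgroup.map_eq_bot_iff B).2 inf_le_right, sup_bot_eq]
    have hk2 : (E ⊔ B).map (mh s) = sqs B := by
      rw [Subgroup.map_sup, sqB, (Subgroup.map_eq_bot_iff E).2 inf_le_right, bot_sup_eq]
    have key : ∀ (φ : A →* A) , EL ⊓ φ.ker ≤ E ⊔ B →
        ((E ⊔ B).map φ).relIndex (EL.map φ) = (E ⊔ B).relIndex EL := by
      intro φ hφ
      have h := relIndex_map_of_ker_le φ (X := (E ⊔ B) ⊔ φ.ker) (Y := EL) le_sup_right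
      rw [Subgroup.map_sup, (Subgroup.map_eq_bot_iff φ.ker).2 le_rfl, sup_bot_eq] at h
      rw [h, ← Subgroup.inf_relIndex_right, ← Subgroup.inf_relIndex_right (E ⊔ B)]
      congr 1
      apply le_antisymm
      · rintro x ⟨hx, hx'⟩
        refine ⟨?_, hx'⟩
        obtain ⟨y, hy, z, hz, rfl⟩ := Subgroup.mem_sup.1 hx
        have hyE : y ∈ EL := (sup_le hEEL hBEL) hy
        have hzE : z ∈ EL := by
          have := EL.mul_mem (EL.inv_mem hyE) hx'
          simpa using this
        exact (E ⊔ B).mul_mem hy (hφ ⟨hzE, hz⟩)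
      · exact inf_le_inf_right _ le_sup_left
    rw [← hk1, ← hk2, key (nh s) le_sup_right, key (mh s) le_sup_left]
  have sqEle : sqs E ≤ EL.map (nh s) := by
    rw [← sqE]; exact Subgroup.map_mono hEEL
  have sqBle : sqs B ≤ EL.map (mh s) := by
    rw [← sqB]; exact Subgroup.map_mono hBEL
  have m1 := Subgroup.relIndex_mul_relIndex _ _ _ sqEle hnEL
  have m2 := Subgroup.relIndex_mul_relIndex _ _ _ sqBle hmEL
  rw [← step1] at m2
  -- step 3
  set Z : Subgroup D := P.comap (mh t) with hZ
  have hPZ : P ≤ Z := by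
    intro d hd
    obtain ⟨a, rfl⟩ := memP.1 hd
    rw [hZ, Subgroup.mem_comap, mhδ]
    exact memP.2 ⟨_, rfl⟩
  set W : Subgroup D := (mh t).range ⊔ P with hW
  have z1 := Subgroup.relIndex_mul_index hPZ
  have z2 := Subgroup.relIndex_mul_index (le_sup_right : P ≤ W)
  have z3 : Z.index = P.relIndex W := by
    rw [hZ, hW, Subgroup.relIndex_sup_right, Subgroup.index_comap]
  have z4 : P.relIndex Z = W.index := by
    have hne : Z.index ≠ 0 := by
      intro h; rw [h, mul_zero] at z1; exact hfinL z1.symm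
    rw [z3] at z1 hne
    have := z1.trans z2.symm
    rw [mul_comm] at this
    exact Nat.eq_of_mul_eq_mul_left (Nat.pos_of_ne_zero hne) this
  have z5 : Q.relIndex ((nh t).range ⊔ Q) ≤ W.index := by
    rw [Subgroup.relIndex_sup_right, ← Subgroup.index_comap]
    apply Nat.le_of_dvd
    · apply Nat.pos_of_ne_zero
      intro h; rw [h, mul_zero] at z2; exact hfinL z2.symm
    apply Subgroup.index_dvd_of_le
    rw [hW]
    apply sup_le
    · rintro _ ⟨d, rfl⟩
      rw [Subgroup.mem_comap, mnD]; exact one_mem _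
    · intro d hd
      obtain ⟨a, rfl⟩ := memP.1 hd
      rw [Subgroup.mem_comap, nhδ, memQ]
      exact ⟨_, by simp [hs, mul_comm], rfl⟩
  have hnI : (nh t).range ⊔ Q ≤ I := by
    apply sup_le _ hQI
    rintro _ ⟨d, rfl⟩
    rw [hI, MonoidHom.mem_ker, nmD]
  have z6 := Subgroup.relIndex_mul_relIndex _ _ _ (le_sup_right : Q ≤ (nh t).range ⊔ Q) hnI
  -- step 4
  have hIPZ : I ⊔ P ≤ Z := by
    apply sup_le _ hPZ
    intro d hd
    rw [hZ, Subgroup.mem_comap, MonoidHom.mem_ker.1 hd]; exact one_mem _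
  have y1 := Subgroup.relIndex_mul_relIndex _ _ _ (le_sup_right : P ≤ I ⊔ P) hIPZ
  rw [Subgroup.relIndex_sup_right, ← Subgroup.inf_relIndex_left] at y1
  have y2 := Subgroup.relIndex_mul_relIndex _ _ _ (le_inf hQI hQP) (inf_le_left : I ⊓ P ≤ I)
  rw [← hκ] at y2
  -- step 5
  set NA := (nh s).range with hNA
  have step5 : (I ⊔ P).relIndex Z = (EL.map (nh s)).relIndex (E ⊓ NA) := by
    have w1 := relIndex_map_of_ker_le (mh t) (X := I ⊔ P) (Y := Z) le_sup_left
    have w2 : (I ⊔ P).map (mh t) = P.map (mh t) := by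
      rw [Subgroup.map_sup, hI, (Subgroup.map_eq_bot_iff (mh t).ker).2 le_rfl, bot_sup_eq]
    set Y : Subgroup A := EL.comap (nh s) with hY
    have w3 : Y.map δ = Z.map (mh t) := by
      ext d
      constructor
      · rintro ⟨a, ha, rfl⟩
        have ha' : nh t (δ a) = 1 := by rw [nhδ]; exact ha
        obtain ⟨c, hc⟩ := h90D _ ha'
        refine ⟨c, ?_, hc.symm⟩
        show mh t c ∈ P
        rw [mh_apply, ← hc]; exact memP.2 ⟨a, rfl⟩
      · rintro ⟨c, hc, rfl⟩
        obtain ⟨a, ha⟩ := memP.1 (show mh t c ∈ P from hc)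
        refine ⟨a, ?_, ha⟩
        show δ (nh s a) = 1
        rw [← nhδ, ha, mnD]
    have w4 : ((mh s).range ⊔ EL).map δ = P.map (mh t) := by
      rw [Subgroup.map_sup, hEL, (Subgroup.map_eq_bot_iff δ.ker).2 le_rfl, sup_bot_eq]
      ext d
      constructor
      · rintro ⟨_, ⟨a, rfl⟩, rfl⟩
        exact ⟨δ a, ⟨a, rfl⟩, mhδ a⟩
      · rintro ⟨_, ⟨a, rfl⟩, rfl⟩
        exact ⟨_, ⟨a, rfl⟩, (mhδ a).symm⟩
    have w5 : Y.map (nh s) = E ⊓ NA := by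
      ext x
      constructor
      · rintro ⟨a, ha, rfl⟩
        exact ⟨memE.2 ⟨ha, by simp [hs, mul_comm]⟩, ⟨a, rfl⟩⟩
      · rintro ⟨h, ⟨a, rfl⟩⟩
        exact ⟨a, (memE.1 h).1, rfl⟩
    have w6 : ((mh s).range ⊔ EL).map (nh s) = EL.map (nh s) := by
      rw [Subgroup.map_sup]
      have : (mh s).range.map (nh s) = ⊥ := by
        rw [Subgroup.map_eq_bot_iff]
        rintro _ ⟨a, rfl⟩
        exact mnA a
      rw [this, bot_sup_eq]
    have hkn : (nh s).ker ≤ (mh s).range ⊔ EL := by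
      intro a ha
      obtain ⟨c, hc⟩ := h90A a ha
      exact Subgroup.mem_sup_left ⟨c, hc.symm⟩
    rw [← w1, w2, ← w3, ← w4, relIndex_map_of_ker_le δ le_sup_right, ← w5, ← w6,
      relIndex_map_of_ker_le (nh s) hkn]
  have u1 : EL.map (nh s) ≤ E ⊓ NA := le_inf hnEL (by rintro _ ⟨a, _, rfl⟩; exact ⟨a, rfl⟩)
  have u2 := Subgroup.relIndex_mul_relIndex _ _ _ u1 (inf_le_left : E ⊓ NA ≤ E)
  rw [← step5] at u2
  rw [← y2] at hfinK
  rw [← y2] at z6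
  rw [z4] at y1
  have hfin : (E ⊓ NA).relIndex E = 1 := by
    generalize (E ⊓ NA).relIndex E = e1 at *
    generalize (I ⊔ P).relIndex Z = e2 at *
    generalize (EL.map (nh s)).relIndex E = e3 at *
    generalize (sqs E).relIndex E = e4 at *
    generalize (sqs B).relIndex B = e5 at *
    generalize (sqs E).relIndex (EL.map (nh s)) = e6 at *
    rw [← s2] at m2
    generalize (I ⊓ P).relIndex I = e7 at *
    generalize Q.relIndex ((nh t).range ⊔ Q) = e8 at *
    generalize ((nh t).range ⊔ Q).relIndex I = e9 at *
    generalize W.index = e10 at *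
    have hk0 : κ ≠ 0 := left_ne_zero_of_mul hfinK
    have h70 : e7 ≠ 0 := right_ne_zero_of_mul hfinK
    have h60 : e6 ≠ 0 := by rintro rfl; simp at m1; exact hE0 m1.symm
    have h30 : e3 ≠ 0 := by rintro rfl; simp at m1; exact hE0 m1.symm
    have h20 : e2 ≠ 0 := by rintro rfl; simp at u2; exact h30 u2.symm
    have h10 : e1 ≠ 0 := by rintro rfl; simp at u2; exact h30 u2.symm
    -- e6*e3 = e4 ≤ 2^r, e6*κ = e5 ≥ 2^(r+1)
    have a1 : 2 * e3 ≤ κ := by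
      have : e6 * (2 * e3) ≤ e6 * κ := by
        calc e6 * (2 * e3) = 2 * e4 := by rw [← m1]; ring
          _ ≤ 2 * 2 ^ r := by omega
          _ = 2 ^ (r+1) := by ring
          _ ≤ e5 := hB
          _ = e6 * κ := m2.symm
      exact Nat.le_of_mul_le_mul_left this (Nat.pos_of_ne_zero h60)
    have a2 : κ ≤ 2 * e2 := by
      have : e7 * κ ≤ e7 * (2 * e2) := by
        calc e7 * κ = e8 * e9 := by rw [z6]; ring
          _ ≤ e10 * 2 := Nat.mul_le_mul z5 hidx
          _ = e7 * (2 * e2) := by rw [← y1]; ring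
      exact Nat.le_of_mul_le_mul_left this (Nat.pos_of_ne_zero h70)
    have a3 : e2 * e1 ≤ e2 * 1 := by omega
    have := Nat.le_of_mul_le_mul_left a3 (Nat.pos_of_ne_zero h20)
    omega
  rw [Subgroup.relIndex_eq_one] at hfin
  intro e he hse
  obtain ⟨-, x, hx⟩ := hfin (memE.2 ⟨he, hse.symm⟩)
  exact ⟨x, hx.symm⟩
end
end FSq

end

noncomputable section
namespace FSq

/-- index of doubles -/
lemma index_two_free (n : ℕ) : (zsmulAddGroupHom (α := Fin n →₀ ℤ) 2).range.index = 2 ^ n := by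
  let φ : (Fin n →₀ ℤ) →+ (Fin n → ZMod 2) :=
    { toFun := fun x i => (x i : ZMod 2)
      map_zero' := by ext; simp
      map_add' := by intros; ext; simp }
  have h1 : φ.ker = (zsmulAddGroupHom (α := Fin n →₀ ℤ) 2).range := by
    ext x
    rw [AddMonoidHom.mem_ker, AddMonoidHom.mem_range]
    constructor
    · intro h
      have h' : ∀ i, (2:ℤ) ∣ x i := fun i => (ZMod.intCast_zmod_eq_zero_iff_dvd _ 2).1 (congrFun h i)
      choose y hy using h'
      refine ⟨Finsupp.equivFunOnFinite.symm y, ?_⟩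
      ext i
      simp [hy]
    · rintro ⟨y, rfl⟩
      ext i
      simp [φ]
      left; rfl
  have h2 : Function.Surjective φ := by
    intro y
    refine ⟨Finsupp.equivFunOnFinite.symm (fun i => (y i).val), ?_⟩
    ext i
    simp [φ]
  rw [← h1, AddSubgroup.index_ker, AddMonoidHom.range_eq_top.2 h2]
  simp

lemma index_two_finite (T : Type*) [AddCommGroup T] [Finite T] :
    (zsmulAddGroupHom (α := T) 2).range.index = Nat.card (zsmulAddGroupHom (α := T) 2).ker := by
  have h1 := AddSubgroup.index_mul_card (zsmulAddGroupHom (α := T) 2).range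
  have h2 := AddSubgroup.index_mul_card (zsmulAddGroupHom (α := T) 2).ker
  rw [AddSubgroup.index_ker] at h2
  have : 0 < Nat.card (zsmulAddGroupHom (α := T) 2).range := Nat.card_pos
  rw [mul_comm] at h2
  exact Nat.eq_of_mul_eq_mul_right this (h1.trans h2.symm)

lemma index_two_equiv {G H : Type*} [AddCommGroup G] [AddCommGroup H] (g : G ≃+ H) :
    (zsmulAddGroupHom (α := G) 2).range.index = (zsmulAddGroupHom (α := H) 2).range.index := by
  have : (zsmulAddGroupHom (α := G) 2).range.map (g : G →+ H) =
      (zsmulAddGroupHom (α := H) 2).range := by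
    ext x
    constructor
    · rintro ⟨_, ⟨y, rfl⟩, rfl⟩
      exact ⟨g y, by simp⟩
    · rintro ⟨y, rfl⟩
      exact ⟨_, ⟨g.symm y, rfl⟩, by simp⟩
  rw [← this, AddSubgroup.index_map_equiv]

lemma card_two_equiv {G H : Type*} [AddCommGroup G] [AddCommGroup H] (g : G ≃+ H) :
    Nat.card (zsmulAddGroupHom (α := G) 2).ker = Nat.card (zsmulAddGroupHom (α := H) 2).ker := by
  refine Nat.card_congr (g.toEquiv.subtypeEquiv ?_)
  intro a
  rw [AddMonoidHom.mem_ker, AddMonoidHom.mem_ker]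
  simp only [zsmulAddGroupHom_apply]
  constructor
  · intro h
    show (2:ℤ) • g a = 0
    rw [← map_zsmul, h, map_zero]
  · intro h
    have h : (2:ℤ) • g a = 0 := h
    rw [← map_zsmul] at h
    exact g.injective (h.trans (map_zero g).symm)

lemma index_two_fg (G : Type*) [AddCommGroup G] [Module.Finite ℤ G] :
    (zsmulAddGroupHom (α := G) 2).range.index =
      2 ^ (Module.finrank ℤ G) * Nat.card (zsmulAddGroupHom (α := G) 2).ker := by
  haveI : AddGroup.FG G := Module.Finite.iff_addGroup_fg.1 inferInstance
  obtain ⟨n, ι, _, p, hp, e, ⟨g⟩⟩ := AddCommGroup.equiv_free_prod_directSum_zmod G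
  classical
  haveI : ∀ i, NeZero (p i ^ e i) := fun i => ⟨pow_ne_zero _ (hp i).ne_zero⟩
  haveI : Finite (DirectSum ι fun i => ZMod (p i ^ e i)) := by
    exact Finite.of_equiv _ DFinsupp.equivFunOnFintype.symm
  set T := (DirectSum ι fun i => ZMod (p i ^ e i)) with hT
  rw [index_two_equiv g, card_two_equiv g]
  have hr : Module.finrank ℤ G = n := by
    rw [g.toIntLinearEquiv.finrank_eq]
    have h := Submodule.finrank_quotient_add_finrank
      (LinearMap.ker (LinearMap.fst ℤ (Fin n →₀ ℤ) T))
    rw [(LinearMap.quotKerEquivOfSurjective _ LinearMap.fst_surjective).finrank_eq] at h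
    have h0 : Module.finrank ℤ (LinearMap.ker (LinearMap.fst ℤ (Fin n →₀ ℤ) T)) = 0 := by
      haveI : Finite (LinearMap.ker (LinearMap.fst ℤ (Fin n →₀ ℤ) T)) := by
        refine Finite.of_injective (fun x => x.1.2) ?_
        rintro ⟨⟨a, b⟩, hx⟩ ⟨⟨c, d⟩, hy⟩ h
        simp at hx hy h
        subst hx hy h
        rfl
      refine (Module.finrank_eq_zero_iff (R := ℤ) (M := LinearMap.ker (LinearMap.fst ℤ (Fin n →₀ ℤ) T))).2 ?_
      intro x
      refine ⟨Nat.card (LinearMap.ker (LinearMap.fst ℤ (Fin n →₀ ℤ) T)), ?_, ?_⟩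
      · exact_mod_cast Nat.card_pos.ne'
      · rw [Nat.cast_smul_eq_nsmul ℤ]; exact card_nsmul_eq_zero' (x := x)
    rw [h0] at h
    simp at h
    exact h.symm
  rw [hr]
  have h1 : (zsmulAddGroupHom (α := (Fin n →₀ ℤ) × T) 2).range =
      (zsmulAddGroupHom (α := (Fin n →₀ ℤ)) 2).range.prod (zsmulAddGroupHom (α := T) 2).range := by
    ext ⟨x, y⟩
    rw [AddSubgroup.mem_prod]
    constructor
    · rintro ⟨⟨a, b⟩, h⟩
      simp only [zsmulAddGroupHom_apply, Prod.smul_mk, Prod.mk.injEq] at h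
      exact ⟨⟨a, h.1⟩, ⟨b, h.2⟩⟩
    · rintro ⟨⟨a, ha⟩, ⟨b, hb⟩⟩
      exact ⟨(a, b), Prod.ext ha hb⟩
  have h2 : Nat.card (zsmulAddGroupHom (α := (Fin n →₀ ℤ) × T) 2).ker =
      Nat.card (zsmulAddGroupHom (α := T) 2).ker := by
    refine Nat.card_congr ⟨fun x => ⟨x.1.2, ?_⟩, fun y => ⟨(0, y.1), ?_⟩, ?_, ?_⟩
    · have := x.2
      rw [AddMonoidHom.mem_ker] at this ⊢
      exact congrArg Prod.snd this
    · have := y.2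
      rw [AddMonoidHom.mem_ker] at this ⊢
      exact Prod.ext (by simp) this
    · rintro ⟨⟨a, b⟩, hx⟩
      rw [AddMonoidHom.mem_ker] at hx
      have : (2:ℤ) • a = 0 := congrArg Prod.fst hx
      have : a = 0 := by simpa using this
      subst this; rfl
    · intro y; rfl
  rw [h1, AddSubgroup.index_prod, index_two_free, index_two_finite, h2]
end FSq

end

noncomputable section
namespace FSq

variable {A : Type*} [CommGroup A]

lemma sqs_relIndex (B : Subgroup A) [Module.Finite ℤ (Additive B)] :
    (sqs B).relIndex B = 2 ^ (Module.finrank ℤ (Additive B)) * Nat.card {x : B // x ^ 2 = 1} := by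
  have h := index_two_fg (Additive B)
  have h1 : Nat.card (zsmulAddGroupHom (α := Additive B) 2).ker = Nat.card {x : B // x ^ 2 = 1} := by
    refine Nat.card_congr (Additive.toMul.subtypeEquiv ?_)
    intro a
    rw [AddMonoidHom.mem_ker]
    simp only [zsmulAddGroupHom_apply]
    constructor
    · intro h
      have := congrArg Additive.toMul h
      rw [toMul_zsmul] at this
      exact_mod_cast this
    · intro h
      apply Additive.toMul.injective
      rw [toMul_zsmul]
      exact_mod_cast h
  rw [h1] at h
  rw [← h]
  have h2 : ((sqs B).subgroupOf B) = AddSubgroup.toSubgroup' (zsmulAddGroupHom (α := Additive B) 2).range := by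
    ext x
    rw [Subgroup.mem_subgroupOf]
    simp only [sqs, Subgroup.mem_map]
    constructor
    · rintro ⟨y, hy, h⟩
      refine ⟨Additive.ofMul ⟨y, hy⟩, ?_⟩
      apply Additive.toMul.injective
      apply Subtype.ext
      have h' : y ^ 2 = (x : A) := by simpa using h
      refine Eq.trans ?_ h'
      simp
    · rintro ⟨y, h⟩
      refine ⟨(Additive.toMul y).1, (Additive.toMul y).2, ?_⟩
      have := congrArg (fun z => ((Additive.toMul z : B) : A)) h
      refine Eq.trans ?_ this
      simp
  rw [Subgroup.relIndex, h2]
  rfl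

lemma rank_B (s : A →* A) (hs : ∀ a, s (s a) = a) (EL : Subgroup A)
    (hEL : ∀ a ∈ EL, s a ∈ EL) [Module.Finite ℤ (Additive EL)] :
    Module.Finite ℤ (Additive (EL ⊓ (mh s).ker : Subgroup A)) ∧
    Module.Finite ℤ (Additive (EL ⊓ (nh s).ker : Subgroup A)) ∧
    Module.finrank ℤ (Additive EL) ≤ Module.finrank ℤ (Additive (EL ⊓ (mh s).ker : Subgroup A)) +
      Module.finrank ℤ (Additive (EL ⊓ (nh s).ker : Subgroup A)) := by
  let inc : ∀ (X : Subgroup A) (_ : X ≤ EL), Additive X →ₗ[ℤ] Additive EL := fun X hX =>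
    (MonoidHom.toAdditive (Subgroup.inclusion hX)).toIntLinearMap
  have hinc : ∀ X hX, Function.Injective (inc X hX) := fun X hX =>
    Subgroup.inclusion_injective hX
  have f1 : Module.Finite ℤ (Additive (EL ⊓ (mh s).ker : Subgroup A)) :=
    Module.Finite.of_injective _ (hinc _ inf_le_left)
  have f2 : Module.Finite ℤ (Additive (EL ⊓ (nh s).ker : Subgroup A)) :=
    Module.Finite.of_injective _ (hinc _ inf_le_left)
  refine ⟨f1, f2, ?_⟩
  let n0 : EL →* (EL ⊓ (mh s).ker : Subgroup A) :=
    ((nh s).comp EL.subtype).codRestrict _ (by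
      intro a
      refine ⟨EL.mul_mem a.2 (hEL _ a.2), ?_⟩
      show mh s (nh s a) = 1
      simp [hs, mul_comm])
  let n1 : Additive EL →ₗ[ℤ] Additive (EL ⊓ (mh s).ker : Subgroup A) :=
    (MonoidHom.toAdditive n0).toIntLinearMap
  have h1 := Submodule.finrank_quotient_add_finrank (LinearMap.ker n1)
  rw [n1.quotKerEquivRange.finrank_eq] at h1
  have h2 := Submodule.finrank_le (LinearMap.range n1)
  have h3 : LinearMap.ker n1 = LinearMap.range (inc (EL ⊓ (nh s).ker) inf_le_left) := by
    ext x
    rw [LinearMap.mem_ker, LinearMap.mem_range]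
    constructor
    · intro hx
      have hx' : nh s (Additive.toMul x : EL) = 1 :=
        congrArg (fun z => ((Additive.toMul z : (EL ⊓ (mh s).ker : Subgroup A)) : A)) hx
      exact ⟨Additive.ofMul ⟨(Additive.toMul x : EL), (Additive.toMul x).2, hx'⟩, rfl⟩
    · rintro ⟨y, rfl⟩
      apply Additive.toMul.injective
      apply Subtype.ext
      exact (Additive.toMul y).2.2
  rw [h3, LinearMap.finrank_range_of_inj (hinc _ _)] at h1
  omega
end FSq

end

noncomputable section
namespace FSq
open NumberField FractionalIdeal IsDedekindDomain
open scoped nonZeroDivisors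

variable (K L : Type*) [Field K] [NumberField K] [Field L] [NumberField L] [Algebra K L]

/-- quadratic extension by a square root of `-1`, unramified at 2. -/
structure QD where
  σ : L ≃ₐ[K] L
  ι : L
  hι : ι ^ 2 = -1
  hσι : σ ι = -ι
  hrep : ∀ x : L, ∃ p q : K, x = algebraMap K L p + algebraMap K L q * ι
  b : 𝓞 K
  c : 𝓞 K
  hb : b ^ 2 + 1 = 4 * c

variable {K L}
namespace QD
variable (Q : QD K L)

lemma σσ (x : L) : Q.σ (Q.σ x) = x := by
  obtain ⟨p, q, rfl⟩ := Q.hrep x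
  simp [Q.hσι]

lemma ι_ne : Q.ι ≠ 0 := by
  intro h; have := Q.hι; rw [h] at this; norm_num at this

lemma fixed {x : L} (hx : Q.σ x = x) : ∃ p : K, x = algebraMap K L p := by
  obtain ⟨p, q, rfl⟩ := Q.hrep x
  refine ⟨p, ?_⟩
  simp only [map_add, AlgEquiv.commutes, map_mul, Q.hσι] at hx
  have : algebraMap K L q * Q.ι = 0 := by linear_combination (-1/2) * hx
  rw [this, add_zero]

/-- sigma on integers -/
def σO : 𝓞 L ≃+* 𝓞 L := RingOfIntegers.mapRingEquiv (Q.σ : L ≃+* L)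

@[simp] lemma σO_coe (x : 𝓞 L) : ((Q.σO x : 𝓞 L) : L) = Q.σ x := rfl

lemma σOσO (x : 𝓞 L) : Q.σO (Q.σO x) = x := by
  apply RingOfIntegers.ext; simp [Q.σσ]

lemma algMap_coe (x : 𝓞 K) : ((algebraMap (𝓞 K) (𝓞 L) x : 𝓞 L) : L) = algebraMap K L x := rfl

@[simp] lemma σO_alg (x : 𝓞 K) : Q.σO (algebraMap (𝓞 K) (𝓞 L) x) = algebraMap (𝓞 K) (𝓞 L) x := by
  apply RingOfIntegers.ext
  rw [σO_coe, algMap_coe, AlgEquiv.commutes]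

/-- i as integer -/
def ιO : 𝓞 L := ⟨Q.ι, by
  refine ⟨Polynomial.X ^ 2 + 1, ?_, ?_⟩
  · monicity!
  · simp [Q.hι]⟩

/-- omega -/
def ω : 𝓞 L := ⟨(algebraMap K L Q.b + Q.ι) / 2, by
  have h1 : IsIntegral (𝓞 L) ((algebraMap K L Q.b + Q.ι) / 2) := by
    refine ⟨Polynomial.X ^ 2 - Polynomial.C (algebraMap (𝓞 K) (𝓞 L) Q.b) * Polynomial.X +
      Polynomial.C (algebraMap (𝓞 K) (𝓞 L) Q.c), ?_, ?_⟩
    · monicity!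
    · have := congrArg (fun x : 𝓞 K => algebraMap K L x) Q.hb
      have h4 : algebraMap K L (algebraMap (𝓞 K) K 4) = 4 := by
        rw [map_ofNat, map_ofNat]
      simp [h4] at this
      simp [algMap_coe]
      have h2 := Q.hι
      have e1 : algebraMap (𝓞 L) L (algebraMap (𝓞 K) (𝓞 L) Q.b) = algebraMap K L Q.b := rfl
      have e2 : algebraMap (𝓞 L) L (algebraMap (𝓞 K) (𝓞 L) Q.c) = algebraMap K L Q.c := rfl
      try rw [e1, e2]
      linear_combination (1/4) * h2 - (1/4) * this
  exact isIntegral_trans (R := ℤ) (A := 𝓞 L) _ h1⟩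

@[simp] lemma ω_coe : (Q.ω : L) = (algebraMap K L Q.b + Q.ι) / 2 := rfl
@[simp] lemma ιO_coe : (Q.ιO : L) = Q.ι := rfl

lemma ιO_sq : Q.ιO * Q.ιO = -1 := by
  apply RingOfIntegers.ext; simp; rw [← sq, Q.hι]

lemma repO (x : 𝓞 L) : ∃ α β : 𝓞 K, x = algebraMap (𝓞 K) (𝓞 L) α + algebraMap (𝓞 K) (𝓞 L) β * Q.ω ∧
    x - Q.σO x = algebraMap (𝓞 K) (𝓞 L) β * Q.ιO := by
  obtain ⟨p, q, h⟩ := Q.hrep x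
  have hinj := (algebraMap K L).injective
  have h2 : algebraMap K L 2 = 2 := map_ofNat _ 2
  have hq : IsIntegral ℤ (2 * q) := by
    have : IsIntegral ℤ (algebraMap K L (2 * q)) := by
      have h3 : algebraMap K L (2 * q) = (((x - Q.σO x) * (-Q.ιO) : 𝓞 L) : L) := by
        simp [h, Q.hσι, h2]
        linear_combination (2 * algebraMap K L q) * Q.hι
      rw [h3]; exact RingOfIntegers.isIntegral_coe _
    exact (isIntegral_algebraMap_iff hinj).1 this
  let β : 𝓞 K := ⟨2 * q, hq⟩
  have hβ : (β : K) = 2 * q := rfl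
  have hp : IsIntegral ℤ (p - q * Q.b) := by
    have : IsIntegral ℤ (algebraMap K L (p - q * Q.b)) := by
      have h3 : algebraMap K L (p - q * Q.b) = ((x - algebraMap (𝓞 K) (𝓞 L) β * Q.ω : 𝓞 L) : L) := by
        simp [h, algMap_coe, hβ, h2]
        ring
      rw [h3]; exact RingOfIntegers.isIntegral_coe _
    exact (isIntegral_algebraMap_iff hinj).1 this
  obtain ⟨α, hα⟩ : ∃ α : 𝓞 K, (α : K) = p - q * Q.b := ⟨⟨_, hp⟩, rfl⟩
  refine ⟨α, β, ?_, ?_⟩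
  · apply RingOfIntegers.ext
    rw [h]
    simp [hα, algMap_coe, hβ, h2]
    ring
  · apply RingOfIntegers.ext
    simp [h, algMap_coe, hβ, h2, Q.hσι]
    ring

lemma map_comap (I : Ideal (𝓞 L)) (hI : ∀ x ∈ I, Q.σO x ∈ I) :
    (I.comap (algebraMap (𝓞 K) (𝓞 L))).map (algebraMap (𝓞 K) (𝓞 L)) = I := by
  apply le_antisymm Ideal.map_comap_le
  intro x hx
  obtain ⟨α, β, h1, h2⟩ := Q.repO x
  have hβ : algebraMap (𝓞 K) (𝓞 L) β ∈ I := by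
    have : algebraMap (𝓞 K) (𝓞 L) β = (x - Q.σO x) * (-Q.ιO) := by
      rw [h2]; linear_combination (algebraMap (𝓞 K) (𝓞 L) β) * Q.ιO_sq
    rw [this]
    exact I.mul_mem_right _ (I.sub_mem hx (hI x hx))
  have hα : algebraMap (𝓞 K) (𝓞 L) α ∈ I := by
    have : algebraMap (𝓞 K) (𝓞 L) α = x - algebraMap (𝓞 K) (𝓞 L) β * Q.ω := by
      linear_combination -h1
    rw [this]
    exact I.sub_mem hx (I.mul_mem_right _ hβ)
  rw [h1]
  exact Ideal.add_mem _ (Ideal.mem_map_of_mem _ hα) (Ideal.mul_mem_right _ _ (Ideal.mem_map_of_mem _ hβ))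

end QD
end FSq

end

noncomputable section
namespace FSq
open NumberField FractionalIdeal IsDedekindDomain
open scoped nonZeroDivisors

variable {K L : Type*} [Field K] [NumberField K] [Field L] [NumberField L] [Algebra K L]
namespace QD

lemma finrank_eq (Q : QD K L) : Module.finrank K L = 2 := by
  let φ : (K × K) →ₗ[K] L :=
    { toFun := fun x => algebraMap K L x.1 + algebraMap K L x.2 * Q.ι
      map_add' := by intros; simp; ring
      map_smul' := by intros; simp [Algebra.smul_def]; ring }
  have hsurj : Function.Surjective φ := by
    intro x
    obtain ⟨p, q, h⟩ := Q.hrep x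
    exact ⟨(p, q), h.symm⟩
  have hinj : Function.Injective φ := by
    rw [← LinearMap.ker_eq_bot, LinearMap.ker_eq_bot']
    rintro ⟨p, q⟩ h
    have h1 : algebraMap K L p + algebraMap K L q * Q.ι = 0 := h
    have h2 := congrArg Q.σ h1
    simp [Q.hσι] at h2
    have h3 : algebraMap K L p = 0 := by linear_combination (1/2) * (h1 + h2)
    have h4 : algebraMap K L q * Q.ι = 0 := by linear_combination h1 - h3
    have h5 := (mul_eq_zero.1 h4).resolve_right Q.ι_ne
    simp at h3 h5
    simp [h3, h5]
  rw [← (LinearEquiv.ofBijective φ ⟨hinj, hsurj⟩).finrank_eq]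
  simp

lemma finrankO (Q : QD K L) : Module.finrank (𝓞 K) (𝓞 L) = 2 := by
  rw [← Q.finrank_eq]
  exact (IsFractionRing.finrank_eq (𝓞 K) K (𝓞 L) L).symm

lemma absNorm_map (Q : QD K L) (I : Ideal (𝓞 K)) :
    Ideal.absNorm (I.map (algebraMap (𝓞 K) (𝓞 L))) = Ideal.absNorm I ^ 2 := by
  rw [Ideal.absNorm_algebraMap, Q.finrankO]

lemma absNorm_σ (Q : QD K L) (I : Ideal (𝓞 L)) : Ideal.absNorm (I.map Q.σO) = Ideal.absNorm I := by
  rw [Ideal.absNorm_apply, Ideal.absNorm_apply, Submodule.cardQuot_apply, Submodule.cardQuot_apply]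
  exact Nat.card_congr (Ideal.quotientEquiv I _ Q.σO rfl).symm.toEquiv

lemma mem_map_σ (Q : QD K L) (I : Ideal (𝓞 L)) (x : 𝓞 L) : x ∈ I.map Q.σO ↔ Q.σO x ∈ I := by
  constructor
  · intro h
    obtain ⟨y, hy, rfl⟩ := (Ideal.mem_map_iff_of_surjective (Q.σO : 𝓞 L →+* 𝓞 L) Q.σO.surjective).1 h
    have e : Q.σO ((Q.σO : 𝓞 L →+* 𝓞 L) y) = y := Q.σOσO y
    rw [e]
    exact hy
  · intro h
    have := Ideal.mem_map_of_mem Q.σO h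
    rwa [σOσO] at this

lemma map_σσ (Q : QD K L) (I : Ideal (𝓞 L)) : (I.map Q.σO).map Q.σO = I := by
  ext x; rw [mem_map_σ, mem_map_σ, σOσO]

/-- prime below -/
def P (w : HeightOneSpectrum (𝓞 L)) : HeightOneSpectrum (𝓞 K) where
  asIdeal := w.asIdeal.comap (algebraMap (𝓞 K) (𝓞 L))
  isPrime := inferInstance
  ne_bot := fun h => w.ne_bot (Ideal.eq_bot_of_comap_eq_bot h)

lemma fixed_ideal (Q : QD K L) (I : Ideal (𝓞 L)) (h : I.map Q.σO = I) :
    (I.comap (algebraMap (𝓞 K) (𝓞 L))).map (algebraMap (𝓞 K) (𝓞 L)) = I := by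
  apply Q.map_comap
  intro x hx
  rw [← h, mem_map_σ, σOσO]; exact hx

lemma comap_σ (Q : QD K L) (I : Ideal (𝓞 L)) : (I.map Q.σO).comap (algebraMap (𝓞 K) (𝓞 L)) =
    I.comap (algebraMap (𝓞 K) (𝓞 L)) := by
  ext x
  rw [Ideal.mem_comap, mem_map_σ, σO_alg, Ideal.mem_comap]

lemma prime_inert (Q : QD K L) (w : HeightOneSpectrum (𝓞 L)) (h : w.asIdeal.map Q.σO = w.asIdeal) :
    (P w : HeightOneSpectrum (𝓞 K)).asIdeal.map (algebraMap (𝓞 K) (𝓞 L)) = w.asIdeal :=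
  Q.fixed_ideal _ h

lemma prime_split (Q : QD K L) (w : HeightOneSpectrum (𝓞 L)) (h : w.asIdeal.map Q.σO ≠ w.asIdeal) :
    (P w : HeightOneSpectrum (𝓞 K)).asIdeal.map (algebraMap (𝓞 K) (𝓞 L)) =
      w.asIdeal * w.asIdeal.map Q.σO := by
  haveI : w.asIdeal.IsMaximal := w.isPrime.isMaximal w.ne_bot
  haveI : (w.asIdeal.map Q.σO).IsMaximal := Ideal.map_isMaximal_of_equiv Q.σO
  have hc : IsCoprime w.asIdeal (w.asIdeal.map Q.σO) := Ideal.isCoprime_of_isMaximal (Ne.symm h)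
  rw [← (Ideal.isCoprime_iff_sup_eq.1 hc |> Ideal.inf_eq_mul_of_isCoprime ∘ Ideal.isCoprime_iff_sup_eq.2)]
  have hfix : (w.asIdeal ⊓ w.asIdeal.map Q.σO).map Q.σO = w.asIdeal ⊓ w.asIdeal.map Q.σO := by
    ext x
    rw [mem_map_σ, Ideal.mem_inf, mem_map_σ, Ideal.mem_inf, mem_map_σ, σOσO, and_comm]
  rw [← Q.fixed_ideal _ hfix, Ideal.comap_inf, comap_σ, inf_idem]
  rfl

lemma fiber (Q : QD K L) (w w' : HeightOneSpectrum (𝓞 L)) (h : (P w : HeightOneSpectrum (𝓞 K)) = P w') :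
    w'.asIdeal = w.asIdeal ∨ w'.asIdeal = w.asIdeal.map Q.σO := by
  have hm : w.asIdeal.IsMaximal := w.isPrime.isMaximal w.ne_bot
  have hm' : (w.asIdeal.map Q.σO).IsMaximal := Ideal.map_isMaximal_of_equiv Q.σO
  have hle : (P w : HeightOneSpectrum (𝓞 K)).asIdeal.map (algebraMap (𝓞 K) (𝓞 L)) ≤ w'.asIdeal := by
    rw [h]; exact Ideal.map_comap_le
  have hne : w'.asIdeal ≠ ⊤ := w'.isPrime.ne_top
  by_cases hw : w.asIdeal.map Q.σO = w.asIdeal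
  · rw [Q.prime_inert w hw] at hle
    left; exact (hm.eq_of_le hne hle).symm
  · rw [Q.prime_split w hw, w'.isPrime.mul_le] at hle
    rcases hle with h1 | h1
    · left; exact (hm.eq_of_le hne h1).symm
    · right; exact (hm'.eq_of_le hne h1).symm

end QD
end FSq

end

noncomputable section
namespace FSq
open NumberField FractionalIdeal IsDedekindDomain
open scoped nonZeroDivisors

variable {K L : Type*} [Field K] [NumberField K] [Field L] [NumberField L] [Algebra K L]

/-- group of fractional ideals -/
abbrev Dv (K : Type*) [Field K] [NumberField K] := (FractionalIdeal (𝓞 K)⁰ K)ˣ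

namespace QD

lemma σhf (Q : QD K L) : (𝓞 L)⁰ ≤ Submonoid.comap (Q.σO : 𝓞 L →+* 𝓞 L) (𝓞 L)⁰ :=
  nonZeroDivisors_le_comap_nonZeroDivisors_of_injective _ Q.σO.injective

/-- sigma on fractional ideals -/
def τ₀ (Q : QD K L) : FractionalIdeal (𝓞 L)⁰ L →+* FractionalIdeal (𝓞 L)⁰ L :=
  extendedHom' L Q.σhf

lemma τ₀_coe (Q : QD K L) (I : Ideal (𝓞 L)) :
    Q.τ₀ (I : FractionalIdeal (𝓞 L)⁰ L) = (I.map Q.σO : Ideal (𝓞 L)) :=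
  extended_coeIdeal_eq_map L _ I

lemma τ₀_span (Q : QD K L) (x : L) :
    Q.τ₀ (spanSingleton (𝓞 L)⁰ x) = spanSingleton (𝓞 L)⁰ (Q.σ x) := by
  refine (extended_spanSingleton L Q.σhf x).trans ?_
  congr 1
  have : (IsLocalization.map L (Q.σO : 𝓞 L →+* 𝓞 L) Q.σhf : L →+* L) = (Q.σ : L →+* L) := by
    apply IsLocalization.ringHom_ext (𝓞 L)⁰
    ext y
    simp only [RingHom.comp_apply, IsLocalization.map_eq]
    rfl
  exact congrArg (fun f : L →+* L => f x) this

/-- extension of fractional ideals -/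
def ext₀ (K L : Type*) [Field K] [NumberField K] [Field L] [NumberField L] [Algebra K L] :
    FractionalIdeal (𝓞 K)⁰ K →+* FractionalIdeal (𝓞 L)⁰ L := extendedHom L (𝓞 L)

lemma ext₀_coe (I : Ideal (𝓞 K)) :
    ext₀ K L (I : FractionalIdeal (𝓞 K)⁰ K) = (I.map (algebraMap (𝓞 K) (𝓞 L)) : Ideal (𝓞 L)) :=
  extendedHom_coeIdeal_eq_map L _ I

lemma ext₀_span (x : K) :
    ext₀ K L (spanSingleton (𝓞 K)⁰ x) = spanSingleton (𝓞 L)⁰ (algebraMap K L x) := by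
  refine (extendedHom_spanSingleton L (𝓞 L) x).trans ?_
  congr 1
  have : (IsFractionRing.map (FaithfulSMul.algebraMap_injective (𝓞 K) (𝓞 L)) : K →+* L) = algebraMap K L := by
    apply IsLocalization.ringHom_ext (𝓞 K)⁰
    ext y
    simp only [RingHom.comp_apply]
    refine (IsLocalization.map_eq _ _).trans ?_
    rfl
  exact congrArg (fun f : K →+* L => f x) this

lemma ringHom_frac_ext {M : Type*} [CommSemiring M] {f g : FractionalIdeal (𝓞 K)⁰ K →+* M}
    (h1 : ∀ I : Ideal (𝓞 K), f I = g I) (h2 : ∀ x : K, f (spanSingleton _ x) = g (spanSingleton _ x)) :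
    f = g := by
  ext J
  obtain ⟨a, aI, ha, rfl⟩ := exists_eq_spanSingleton_mul J
  rw [map_mul, map_mul, h1, h2]

lemma τ₀τ₀ (Q : QD K L) (J : FractionalIdeal (𝓞 L)⁰ L) : Q.τ₀ (Q.τ₀ J) = J := by
  have : Q.τ₀.comp Q.τ₀ = RingHom.id _ := by
    apply ringHom_frac_ext
    · intro I
      rw [RingHom.comp_apply, τ₀_coe, τ₀_coe, map_σσ]; rfl
    · intro x
      rw [RingHom.comp_apply, τ₀_span, τ₀_span, σσ]; rfl
  exact congrArg (fun f => f J) this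

lemma τ₀ext₀ (Q : QD K L) (J : FractionalIdeal (𝓞 K)⁰ K) : Q.τ₀ (ext₀ K L J) = ext₀ K L J := by
  have : Q.τ₀.comp (ext₀ K L) = ext₀ K L := by
    apply ringHom_frac_ext
    · intro I
      rw [RingHom.comp_apply, ext₀_coe, τ₀_coe]
      congr 1
      refine (Ideal.map_map (algebraMap (𝓞 K) (𝓞 L)) (Q.σO : 𝓞 L →+* 𝓞 L)).trans ?_
      congr 1
      ext x
      exact congrArg (fun y : 𝓞 L => (y : L)) (Q.σO_alg x)
    · intro x
      rw [RingHom.comp_apply, ext₀_span, τ₀_span, AlgEquiv.commutes]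
  exact congrArg (fun f => f J) this

lemma fixed_frac (Q : QD K L) (J : FractionalIdeal (𝓞 L)⁰ L) (h : Q.τ₀ J = J) :
    ∃ J', ext₀ K L J' = J := by
  obtain ⟨a, I, ha, hJ⟩ := exists_eq_spanSingleton_mul J
  obtain ⟨n, hn⟩ := Q.fixed (x := (a : L) * Q.σ a) (by rw [map_mul, Q.σσ, mul_comm])
  have ha0 : (a : L) ≠ 0 := by simpa using ha
  have hn0 : algebraMap K L n ≠ 0 := by
    rw [← hn]; exact mul_ne_zero ha0 (by simpa using ha0)
  -- n J = σ(a) I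
  have key : spanSingleton (𝓞 L)⁰ (algebraMap K L n) * J =
      ((Ideal.span {Q.σO a} * I : Ideal (𝓞 L)) : FractionalIdeal (𝓞 L)⁰ L) := by
    rw [hJ, ← mul_assoc, spanSingleton_mul_spanSingleton, coeIdeal_mul, coeIdeal_span_singleton,
      ← hn]
    have e : (algebraMap (𝓞 L) L) (Q.σO a) = Q.σ a := rfl
    rw [e]
    congr 2
    field_simp
  set I' := Ideal.span {Q.σO a} * I with hI'
  have hfix : I'.map Q.σO = I' := by
    apply coeIdeal_injective (K := L)
    show ((I'.map Q.σO : Ideal (𝓞 L)) : FractionalIdeal (𝓞 L)⁰ L) = (I' : FractionalIdeal (𝓞 L)⁰ L)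
    rw [← τ₀_coe, ← key, map_mul, h, τ₀_span, AlgEquiv.commutes]
  refine ⟨spanSingleton _ n⁻¹ * ((I'.comap (algebraMap (𝓞 K) (𝓞 L)) : Ideal (𝓞 K)) : FractionalIdeal (𝓞 K)⁰ K), ?_⟩
  rw [map_mul, ext₀_span, ext₀_coe, Q.fixed_ideal _ hfix, ← key, ← mul_assoc,
    spanSingleton_mul_spanSingleton, map_inv₀, inv_mul_cancel₀ hn0, spanSingleton_one, one_mul]

/-- on units -/
def τ (Q : QD K L) : Dv L →* Dv L := Units.map Q.τ₀
/-- on units -/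
def ext (K L : Type*) [Field K] [NumberField K] [Field L] [NumberField L] [Algebra K L] :
    Dv K →* Dv L := Units.map (ext₀ K L)
/-- on units -/
def s (Q : QD K L) : Lˣ →* Lˣ := Units.map (Q.σ : L →* L)
/-- principal divisors -/
abbrev δ (K : Type*) [Field K] [NumberField K] : Kˣ →* Dv K := toPrincipalIdeal (𝓞 K) K

lemma s_coe (Q : QD K L) (x : Lˣ) : ((Q.s x : Lˣ) : L) = Q.σ x := rfl
lemma ss (Q : QD K L) (x : Lˣ) : Q.s (Q.s x) = x := Units.ext (Q.σσ x)
lemma ττ (Q : QD K L) (x : Dv L) : Q.τ (Q.τ x) = x := Units.ext (Q.τ₀τ₀ x)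
lemma δs (Q : QD K L) (x : Lˣ) : δ L (Q.s x) = Q.τ (δ L x) := by
  apply Units.ext
  rw [coe_toPrincipalIdeal, s_coe, ← τ₀_span]
  show _ = Q.τ₀ (δ L x)
  rw [coe_toPrincipalIdeal]

lemma δext (x : Kˣ) : ext K L (δ K x) = δ L (Units.map (algebraMap K L : K →* L) x) := by
  apply Units.ext
  rw [coe_toPrincipalIdeal]
  show ext₀ K L (δ K x) = _
  rw [coe_toPrincipalIdeal, ext₀_span]
  rfl

lemma h90A (Q : QD K L) (a : Lˣ) (h : a * Q.s a = 1) : ∃ c, a = c / Q.s c := by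
  have h' : (a : L) * Q.σ a = 1 := congrArg Units.val h
  by_cases h1 : (a : L) = -1
  · refine ⟨Units.mk0 Q.ι Q.ι_ne, ?_⟩
    rw [eq_div_iff_mul_eq']
    apply Units.ext
    rw [Units.val_mul, s_coe, Units.val_mk0, Q.hσι, h1]; ring
  · have h2 : (1 + a : L) ≠ 0 := fun h => h1 (by linear_combination h)
    refine ⟨Units.mk0 _ h2, ?_⟩
    rw [eq_div_iff_mul_eq']
    apply Units.ext
    rw [Units.val_mul, s_coe, Units.val_mk0, map_add, map_one]
    linear_combination h'

lemma h90D (Q : QD K L) (d : Dv L) (h : d * Q.τ d = 1) : ∃ c, d = c / Q.τ c := by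
  have h' : (d : FractionalIdeal (𝓞 L)⁰ L) * Q.τ₀ d = 1 := congrArg Units.val h
  have h2 : (1 + d : FractionalIdeal (𝓞 L)⁰ L) ≠ 0 := by
    intro h0
    have : (1 : FractionalIdeal (𝓞 L)⁰ L) ≤ 1 + d := le_sup_left
    rw [h0] at this
    exact one_ne_zero (le_antisymm this (zero_le _))
  refine ⟨Units.mk0 _ h2, ?_⟩
  rw [eq_div_iff_mul_eq']
  apply Units.ext
  rw [Units.val_mul, Units.val_mk0]
  have e : ((Q.τ (Units.mk0 _ h2) : Dv L) : FractionalIdeal (𝓞 L)⁰ L) = Q.τ₀ (1 + d) := rfl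
  rw [e, map_add, map_one]
  first
    | rw [mul_add, mul_one, h', add_comm]
    | rw [add_mul, one_mul, mul_comm _ (d : FractionalIdeal (𝓞 L)⁰ L), h', add_comm]

lemma ext_range (Q : QD K L) : (ext K L).range = (mh Q.τ).ker := by
  ext d
  rw [MonoidHom.mem_ker, mh_apply, div_eq_one, MonoidHom.mem_range]
  constructor
  · rintro ⟨J, rfl⟩
    exact (Units.ext (Q.τ₀ext₀ J)).symm
  · intro h
    obtain ⟨J', hJ'⟩ := Q.fixed_frac d (congrArg Units.val h).symm
    have hne : J' ≠ 0 := by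
      rintro rfl
      rw [map_zero] at hJ'
      exact d.ne_zero hJ'.symm
    exact ⟨Units.mk0 J' hne, Units.ext hJ'⟩

/-- Units of K inside L: elements fixed -/
lemma s_fixed (Q : QD K L) (x : Lˣ) : x ∈ (mh Q.s).ker ↔ ∃ y : Kˣ, Units.map (algebraMap K L : K →* L) y = x := by
  rw [MonoidHom.mem_ker, mh_apply, div_eq_one]
  constructor
  · intro h
    obtain ⟨p, hp⟩ := Q.fixed (congrArg Units.val h).symm
    have hp0 : p ≠ 0 := by rintro rfl; rw [map_zero] at hp; exact x.ne_zero hp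
    exact ⟨Units.mk0 p hp0, Units.ext hp.symm⟩
  · rintro ⟨y, rfl⟩
    apply Units.ext
    rw [s_coe]
    exact (Q.σ.commutes _).symm

lemma mapδ (Q : QD K L) : (mh Q.s).ker.map (δ L) = (δ K).range.map (ext K L) := by
  ext d
  constructor
  · rintro ⟨x, hx, rfl⟩
    obtain ⟨y, rfl⟩ := (Q.s_fixed x).1 hx
    exact ⟨_, ⟨y, rfl⟩, δext y⟩
  · rintro ⟨_, ⟨y, rfl⟩, rfl⟩
    exact ⟨_, (Q.s_fixed _).2 ⟨y, rfl⟩, (δext y).symm⟩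

lemma index_δ_ne_zero : (δ K).range.index ≠ 0 := by
  have : Finite (Dv K ⧸ (δ K).range) := Finite.of_equiv _ (ClassGroup.equiv (R := 𝓞 K) K).toEquiv
  exact Subgroup.index_ne_zero_of_finite

lemma hfinK (Q : QD K L) : ((mh Q.s).ker.map (δ L)).relIndex (mh Q.τ).ker ≠ 0 := by
  rw [Q.mapδ, ← ext_range, MonoidHom.range_eq_map (ext K L), Subgroup.relIndex_map_map, top_sup_eq, Subgroup.relIndex_top_right]
  exact fun h => index_δ_ne_zero (K := K) (Subgroup.index_eq_zero_of_relIndex_eq_zero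
    (K := ⊤) (by
      rw [Subgroup.relIndex_top_right]
      by_contra h0
      have := Subgroup.index_dvd_of_le (le_sup_left : (δ K).range ≤ (δ K).range ⊔ (ext K L).ker)
      rw [h, zero_dvd_iff] at this
      exact h0 this))

end QD
end FSq

end

noncomputable section
namespace FSq
open NumberField FractionalIdeal IsDedekindDomain
open scoped nonZeroDivisors

lemma exists_char {G : Type*} [CommGroup G] [Finite G] (h2 : ∀ g : G, g ^ 2 = 1) (a : G) (ha : a ≠ 1) :
    ∃ χ : G →* ℝ, (∀ c, χ c = 1 ∨ χ c = -1) ∧ χ a = -1 := by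
  have hexp : NeZero (Monoid.exponent G) := ⟨Monoid.exponent_ne_zero_of_finite⟩
  obtain ⟨φ, hφ⟩ := CommGroup.exists_apply_ne_one_of_hasEnoughRootsOfUnity G ℂ ha
  have h1 : ∀ c, ((φ c : ℂˣ) : ℂ) = 1 ∨ ((φ c : ℂˣ) : ℂ) = -1 := by
    intro c
    rw [← sq_eq_one_iff, ← Units.val_pow_eq_pow_val, ← map_pow, h2, map_one, Units.val_one]
  refine ⟨⟨⟨fun c => ((φ c : ℂˣ) : ℂ).re, by simp⟩, ?_⟩, ?_, ?_⟩
  · intro x y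
    show ((φ (x * y) : ℂˣ) : ℂ).re = ((φ x : ℂˣ) : ℂ).re * ((φ y : ℂˣ) : ℂ).re
    rw [map_mul, Units.val_mul]
    rcases h1 x with h | h <;> rcases h1 y with h' | h' <;> rw [h, h'] <;> simp
  · intro c
    show ((φ c : ℂˣ) : ℂ).re = 1 ∨ ((φ c : ℂˣ) : ℂ).re = -1
    rcases h1 c with h | h <;> rw [h] <;> simp
  · show ((φ a : ℂˣ) : ℂ).re = -1
    rcases h1 a with h | h
    · exact absurd (Units.ext h) hφ
    · rw [h]; simp

lemma exists_two_chars {G : Type*} [CommGroup G] [Finite G] (h2 : ∀ g : G, g ^ 2 = 1)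
    (hc : 2 < Nat.card G) :
    ∃ χ₁ χ₂ : G →* ℝ, (∀ c, χ₁ c = 1 ∨ χ₁ c = -1) ∧ (∀ c, χ₂ c = 1 ∨ χ₂ c = -1) ∧
      (∃ a, χ₁ a = -1) ∧ ∃ b, χ₁ b = 1 ∧ χ₂ b = -1 := by
  haveI : Nontrivial G := Finite.one_lt_card_iff_nontrivial.1 (by omega)
  obtain ⟨a, ha⟩ := exists_ne (1 : G)
  obtain ⟨χ₁, h1, h1a⟩ := exists_char h2 a ha
  obtain ⟨b, hb, hb1⟩ : ∃ b : G, b ≠ 1 ∧ χ₁ b = 1 := by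
    by_contra hno
    push Not at hno
    have hinj : Function.Injective χ₁ := by
      intro x y hxy
      by_contra hne
      refine hno (x / y) (fun h => hne (div_eq_one.1 h)) ?_
      have e : χ₁ (x / y) * χ₁ y = χ₁ x := by rw [← map_mul, div_mul_cancel]
      rw [hxy] at e
      rcases h1 y with h | h <;> rw [h] at e <;> linarith
    have hr : Set.range χ₁ ⊆ ({1, -1} : Set ℝ) := by
      rintro _ ⟨c, rfl⟩; rcases h1 c with h | h <;> simp [h]
    have := Set.ncard_le_ncard hr (by simp)
    rw [← Set.image_univ, Set.ncard_image_of_injective _ hinj, Set.ncard_univ] at this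
    have h3 := Set.ncard_insert_le (1 : ℝ) {-1}
    rw [Set.ncard_singleton] at h3
    omega
  obtain ⟨χ₂, h3, h3b⟩ := exists_char h2 b hb
  exact ⟨χ₁, χ₂, h1, h3, ⟨a, h1a⟩, b, hb1, h3b⟩

variable {K L : Type*} [Field K] [NumberField K] [Field L] [NumberField L] [Algebra K L]
namespace QD

/-- norm-ish subgroup -/
def S (Q : QD K L) : Subgroup (Dv K) :=
  ((nh Q.τ).range ⊔ (mh Q.s).ker.map (δ L)).comap (ext K L)

lemma S_index (Q : QD K L) : Q.S.index = ((nh Q.τ).range ⊔ (mh Q.s).ker.map (δ L)).relIndex (mh Q.τ).ker := by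
  rw [S, Subgroup.index_comap, ext_range]

lemma δ_le_S (Q : QD K L) : (δ K).range ≤ Q.S := by
  rw [S, ← Subgroup.map_le_iff_le_comap, ← Q.mapδ]
  exact le_sup_right

lemma τext (Q : QD K L) (d : Dv K) : Q.τ (ext K L d) = ext K L d := Units.ext (Q.τ₀ext₀ d)

lemma sq_mem_S (Q : QD K L) (d : Dv K) : d ^ 2 ∈ Q.S := by
  apply Subgroup.mem_sup_left (S := (nh Q.τ).range)
  refine ⟨ext K L d, ?_⟩
  rw [nh_apply, τext, map_pow, sq]

lemma split_mem_S (Q : QD K L) (w : HeightOneSpectrum (𝓞 L)) (h : w.asIdeal.map Q.σO ≠ w.asIdeal) :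
    FractionalIdeal.mk0 K (pI (P w : HeightOneSpectrum (𝓞 K))) ∈ Q.S := by
  apply Subgroup.mem_sup_left (S := (nh Q.τ).range)
  refine ⟨FractionalIdeal.mk0 L (pI w), ?_⟩
  rw [nh_apply]
  apply Units.ext
  have e1 : ((Q.τ (FractionalIdeal.mk0 L (pI w)) : Dv L) : FractionalIdeal (𝓞 L)⁰ L) =
    Q.τ₀ (w.asIdeal : FractionalIdeal (𝓞 L)⁰ L) := rfl
  have e2 : ((ext K L (FractionalIdeal.mk0 K (pI (P w : HeightOneSpectrum (𝓞 K)))) : Dv L) : FractionalIdeal (𝓞 L)⁰ L) =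
    ext₀ K L ((P w : HeightOneSpectrum (𝓞 K)).asIdeal : FractionalIdeal (𝓞 K)⁰ K) := rfl
  have e3 : ((FractionalIdeal.mk0 L (pI w) : Dv L) : FractionalIdeal (𝓞 L)⁰ L) = w.asIdeal := rfl
  rw [Units.val_mul, e1, e2, e3, ext₀_coe, τ₀_coe, Q.prime_split w h, coeIdeal_mul]

lemma nv_pos (v : HeightOneSpectrum (𝓞 K)) : 0 < nv v := by
  have : Ideal.absNorm v.asIdeal ≠ 0 := Ideal.absNorm_eq_zero_iff.not.2 v.ne_bot
  unfold nv
  exact_mod_cast Nat.pos_of_ne_zero this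

lemma fib (Q : QD K L) (χ₁ χ₂ : ClassGroup (𝓞 K) →* ℝ)
    (hS : ∀ v : HeightOneSpectrum (𝓞 K), FractionalIdeal.mk0 K (pI v) ∈ Q.S →
      χ₁ (ClassGroup.mk0 (pI v)) = 1 ∧ χ₂ (ClassGroup.mk0 (pI v)) = 1)
    (v : HeightOneSpectrum (𝓞 K)) (T : Finset (HeightOneSpectrum (𝓞 L))) (hT : ∀ w ∈ T, P w = v) :
     (T.card ≤ 2 ∧ (∀ w ∈ T, nv w = nv v) ∧ χ₁ (ClassGroup.mk0 (pI v)) = 1 ∧ χ₂ (ClassGroup.mk0 (pI v)) = 1) ∨ (T.card ≤ 1 ∧ ∀ w ∈ T, nv w = nv v ^ 2) := by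
  classical
  rcases T.eq_empty_or_nonempty with rfl | ⟨w₀, hw₀⟩
  · right; simp
  obtain rfl := hT w₀ hw₀
  by_cases h : w₀.asIdeal.map Q.σO = w₀.asIdeal
  · right
    have hall : ∀ w ∈ T, w = w₀ := by
      intro w hw
      apply HeightOneSpectrum.ext
      rcases Q.fiber w₀ w (hT w hw).symm with h' | h'
      · exact h'
      · rw [h', h]
    refine ⟨Finset.card_le_one.2 fun a ha b hb => (hall a ha).trans (hall b hb).symm, ?_⟩
    intro w hw
    rw [hall w hw]
    have := Q.absNorm_map (P w₀ : HeightOneSpectrum (𝓞 K)).asIdeal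
    rw [Q.prime_inert w₀ h] at this
    unfold nv
    exact_mod_cast this
  · left
    refine ⟨?_, ?_, hS _ (Q.split_mem_S w₀ h)⟩
    · have hinj : Set.InjOn (HeightOneSpectrum.asIdeal (R := 𝓞 L)) T := fun a _ b _ hab =>
        HeightOneSpectrum.ext hab
      rw [← Finset.card_image_of_injOn hinj]
      refine (Finset.card_le_card (t := {w₀.asIdeal, w₀.asIdeal.map Q.σO}) ?_).trans Finset.card_le_two
      intro I hI
      obtain ⟨w, hw, rfl⟩ := Finset.mem_image.1 hI
      rcases Q.fiber w₀ w (hT w hw).symm with h' | h' <;> simp [h']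
    · intro w hw
      have e : nv w = nv w₀ := by
        unfold nv
        rcases Q.fiber w₀ w (hT w hw).symm with h' | h'
        · rw [h']
        · rw [h', Q.absNorm_σ]
      have := Q.absNorm_map (P w₀ : HeightOneSpectrum (𝓞 K)).asIdeal
      rw [Q.prime_split w₀ h, map_mul, Q.absNorm_σ, ← sq] at this
      have h3 : nv w₀ ^ 2 = nv (P w₀ : HeightOneSpectrum (𝓞 K)) ^ 2 := by
        unfold nv; exact_mod_cast this
      rw [e]
      exact (pow_left_inj₀ (nv_pos _).le (nv_pos _).le two_ne_zero).1 h3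

lemma hidx (Q : QD K L) : ((nh Q.τ).range ⊔ (mh Q.s).ker.map (δ L)).relIndex (mh Q.τ).ker ≤ 2 := by
  rw [← S_index]
  by_contra hlt
  push Not at hlt
  have hfi : Q.S.FiniteIndex := ⟨by omega⟩
  have : Finite (Dv K ⧸ Q.S) := inferInstance
  obtain ⟨χ₁, χ₂, h1, h2, ⟨a, ha⟩, b, hb1, hb2⟩ := exists_two_chars (G := Dv K ⧸ Q.S) (by
    intro g
    obtain ⟨d, rfl⟩ := QuotientGroup.mk_surjective g
    rw [← QuotientGroup.mk_pow, QuotientGroup.eq_one_iff]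
    exact Q.sq_mem_S d) hlt
  let φ : ClassGroup (𝓞 K) →* Dv K ⧸ Q.S :=
    (QuotientGroup.map (δ K).range Q.S (MonoidHom.id _) Q.δ_le_S).comp
      (ClassGroup.equiv (R := 𝓞 K) K).toMonoidHom
  have hφs : Function.Surjective φ := by
    intro g
    obtain ⟨d, rfl⟩ := QuotientGroup.mk_surjective g
    refine ⟨(ClassGroup.equiv (R := 𝓞 K) K).symm (QuotientGroup.mk d), ?_⟩
    simp [φ]
    rfl
  have hφm : ∀ v : HeightOneSpectrum (𝓞 K), φ (ClassGroup.mk0 (pI v)) = QuotientGroup.mk (FractionalIdeal.mk0 K (pI v)) := by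
    intro v
    simp only [φ, MonoidHom.comp_apply]
    have : (ClassGroup.equiv (R := 𝓞 K) K).toMonoidHom (ClassGroup.mk0 (pI v)) = _ := ClassGroup.equiv_mk0 K (pI v)
    rw [this]; rfl
  obtain ⟨a', rfl⟩ := hφs a
  obtain ⟨b', rfl⟩ := hφs b
  refine index_contra (L := L) P (χ₁.comp φ) (χ₂.comp φ) (fun c => h1 _) (fun c => h2 _)
    (Q.fib _ _ ?_) ?_ ?_ ?_
  · intro v hv
    simp only [MonoidHom.comp_apply, hφm, (QuotientGroup.eq_one_iff _).2 hv, map_one, and_self]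
  · intro h
    have := congrArg (fun f => f a') h
    simp [ha] at this; norm_num at this
  · intro h
    have := congrArg (fun f => f b') h
    simp [hb2] at this; norm_num at this
  · intro h
    have := congrArg (fun f => f b') h
    simp [hb2, hb1] at this; norm_num at this

end QD
end FSq

end

noncomputable section
namespace FSq
open NumberField FractionalIdeal IsDedekindDomain
open scoped nonZeroDivisors

variable {K L : Type*} [Field K] [NumberField K] [Field L] [NumberField L] [Algebra K L]
namespace QD

/-- integral units inside the field units -/
def uh (K : Type*) [Field K] [NumberField K] : (𝓞 K)ˣ →* Kˣ := Units.map (algebraMap (𝓞 K) K : 𝓞 K →* K)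

lemma uh_inj : Function.Injective (uh K) :=
  Units.map_injective (RingOfIntegers.coe_injective)

lemma uh_of_int (x : Kˣ) (h1 : IsIntegral ℤ (x : K)) (h2 : IsIntegral ℤ ((x⁻¹ : Kˣ) : K)) : x ∈ (uh K).range := by
  obtain ⟨y, hy⟩ : ∃ y : 𝓞 K, (y : K) = x := ⟨⟨x, h1⟩, rfl⟩
  obtain ⟨z, hz⟩ : ∃ y : 𝓞 K, (y : K) = (x⁻¹ : Kˣ) := ⟨⟨_, h2⟩, rfl⟩
  have hyz : y * z = 1 := by
    apply RingOfIntegers.ext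
    show (y : K) * (z : K) = 1
    rw [hy, hz]; simp
  exact ⟨⟨y, z, hyz, by rw [mul_comm, hyz]⟩, Units.ext hy⟩

lemma int_of_ker (x : Kˣ) (hx : x ∈ (δ K).ker) : IsIntegral ℤ (x : K) := by
  rw [MonoidHom.mem_ker, toPrincipalIdeal_eq_iff] at hx
  have := mem_spanSingleton_self (𝓞 K)⁰ (x : K)
  rw [hx, Units.val_one, mem_one_iff] at this
  obtain ⟨y, hy⟩ := this
  rw [← hy]
  exact y.isIntegral_coe

lemma uh_range : (uh K).range = (δ K).ker := by
  ext x
  constructor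
  · rintro ⟨u, rfl⟩
    rw [MonoidHom.mem_ker, toPrincipalIdeal_eq_iff]
    apply le_antisymm
    · rw [spanSingleton_le_iff_mem, Units.val_one, mem_one_iff]
      exact ⟨u, rfl⟩
    · rw [Units.val_one, FractionalIdeal.one_le, mem_spanSingleton]
      refine ⟨((u⁻¹ : (𝓞 K)ˣ) : 𝓞 K), ?_⟩
      rw [Algebra.smul_def]
      have : algebraMap (𝓞 K) K ((u⁻¹ : (𝓞 K)ˣ) : 𝓞 K) * algebraMap (𝓞 K) K u = 1 := by
        rw [← map_mul, Units.inv_mul, map_one]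
      exact this
  · intro hx
    exact uh_of_int x (int_of_ker x hx) (int_of_ker _ (inv_mem hx))

lemma fin_of_equiv {A B : Type*} [CommGroup A] [CommGroup B] (e : A ≃* B) [Module.Finite ℤ (Additive A)] :
    Module.Finite ℤ (Additive B) ∧ Module.finrank ℤ (Additive B) = Module.finrank ℤ (Additive A) := by
  let e' : Additive A ≃ₗ[ℤ] Additive B := (MulEquiv.toAdditive e).toIntLinearEquiv
  exact ⟨Module.Finite.equiv e', e'.symm.finrank_eq⟩

lemma unitsL : Module.Finite ℤ (Additive (δ L).ker) ∧
    Module.finrank ℤ (Additive (δ L).ker) = Units.rank L := by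
  rw [← uh_range, ← Units.finrank_eq L]
  exact fin_of_equiv (MonoidHom.ofInjective uh_inj)

/-- units of K in L -/
def uhL (K L : Type*) [Field K] [NumberField K] [Field L] [NumberField L] [Algebra K L] : (𝓞 K)ˣ →* Lˣ :=
  (Units.map (algebraMap K L : K →* L)).comp (uh K)

lemma uhL_inj : Function.Injective (uhL K L) :=
  (Units.map_injective (FaithfulSMul.algebraMap_injective K L)).comp uh_inj

lemma uhL_range (Q : QD K L) : (uhL K L).range = (δ L).ker ⊓ (mh Q.s).ker := by
  ext x
  constructor
  · rintro ⟨u, rfl⟩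
    refine ⟨?_, (Q.s_fixed _).2 ⟨uh K u, rfl⟩⟩
    show δ L _ = 1
    have h : δ K (uh K u) = 1 := by
      have : uh K u ∈ (δ K).ker := by rw [← uh_range]; exact ⟨u, rfl⟩
      exact this
    have := δext (L := L) (uh K u)
    rw [h, map_one] at this
    exact this.symm
  · rintro ⟨h1, h2⟩
    obtain ⟨y, rfl⟩ := (Q.s_fixed _).1 h2
    have hi : ∀ y : Kˣ, Units.map (algebraMap K L : K →* L) y ∈ (δ L).ker → IsIntegral ℤ (y : K) := by
      intro y hy
      have := int_of_ker _ hy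
      exact (isIntegral_algebraMap_iff (FaithfulSMul.algebraMap_injective K L)).1 this
    obtain ⟨u, hu⟩ := uh_of_int y (hi y h1) (hi y⁻¹ (by rw [map_inv]; exact inv_mem h1))
    exact ⟨u, by rw [uhL, MonoidHom.comp_apply, hu]⟩

lemma unitsK (Q : QD K L) : Module.finrank ℤ (Additive ((δ L).ker ⊓ (mh Q.s).ker : Subgroup Lˣ)) = Units.rank K := by
  rw [← uhL_range, ← Units.finrank_eq K]
  exact (fin_of_equiv (MonoidHom.ofInjective uhL_inj)).2

lemma two_tors (B : Subgroup Lˣ) (h : -1 ∈ B) : Nat.card {x : B // x ^ 2 = 1} = 2 := by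
  have hne : (1 : Lˣ) ≠ -1 := by
    intro h
    have := congrArg Units.val h
    simp at this
    norm_num [eq_neg_iff_add_eq_zero] at this
  have e : {x : B // x ^ 2 = 1} ≃ ({1, -1} : Set Lˣ) :=
    { toFun := fun x => ⟨x.1.1, by
        have := congrArg (fun y : B => ((y : Lˣ) : L)) x.2
        simp only [Subgroup.coe_pow, Units.val_pow_eq_pow_val, Subgroup.coe_one, Units.val_one, sq_eq_one_iff] at this
        rcases this with h | h
        · left; exact Units.ext h
        · right; exact Units.ext h⟩
      invFun := fun x => ⟨⟨x.1, by
        rcases x.2 with h' | h'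
        · rw [h']; exact one_mem _
        · rw [h']; exact h⟩, by
          apply Subtype.ext
          show x.1 ^ 2 = 1
          rcases x.2 with h' | h' <;> rw [h'] <;> simp⟩
      left_inv := fun x => rfl
      right_inv := fun x => rfl }
  rw [Nat.card_congr e, Nat.card_coe_set_eq, Set.ncard_pair hne]

theorem norm_neg_one (Q : QD K L) [IsTotallyComplex K] : ∃ u v : K, u ^ 2 + v ^ 2 = -1 := by
  have hfin := (unitsL (L := L)).1
  obtain ⟨hfE, hfB, hrk⟩ := rank_B Q.s Q.ss (δ L).ker (by
    intro a ha
    rw [MonoidHom.mem_ker] at ha ⊢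
    rw [Q.δs, ha, map_one])
  rw [unitsL.2, Q.unitsK] at hrk
  have hm1 : (-1 : Lˣ) ∈ (δ L).ker := by
    rw [← uh_range]
    exact ⟨-1, Units.ext (by simp [uh])⟩
  have hs1 : Q.s (-1) = -1 := Units.ext (by rw [s_coe]; simp)
  have hK := Q.unitsK
  have hrK : Units.rank K + 1 = InfinitePlace.nrComplexPlaces K := by
    have h1 := InfinitePlace.card_eq_nrRealPlaces_add_nrComplexPlaces K
    rw [IsTotallyComplex.nrRealPlaces_eq_zero, zero_add] at h1
    have h2 : 0 < Fintype.card (InfinitePlace K) := Fintype.card_pos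
    unfold Units.rank
    omega
  have hrL : 2 * InfinitePlace.nrComplexPlaces K ≤ Units.rank L + 1 := by
    have h1 := InfinitePlace.card_eq_nrRealPlaces_add_nrComplexPlaces L
    have h2 := InfinitePlace.card_add_two_mul_card_eq_rank L
    have h3 := IsTotallyComplex.finrank K
    have h4 := Module.finrank_mul_finrank ℚ K L
    rw [Q.finrank_eq] at h4
    have h5 : 0 < Fintype.card (InfinitePlace L) := Fintype.card_pos
    unfold Units.rank
    omega
  set r := InfinitePlace.nrComplexPlaces K
  have cE := sqs_relIndex ((δ L).ker ⊓ (mh Q.s).ker)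
  have t1 : (-1 : Lˣ) ∈ (δ L).ker ⊓ (mh Q.s).ker :=
    ⟨hm1, by show mh Q.s (-1) = 1; rw [mh_apply, hs1, div_self']⟩
  have t2 : (-1 : Lˣ) ∈ (δ L).ker ⊓ (nh Q.s).ker :=
    ⟨hm1, by show nh Q.s (-1) = 1; rw [nh_apply, hs1]; simp⟩
  rw [two_tors _ t1, hK, ← pow_succ, hrK] at cE
  have cB := sqs_relIndex ((δ L).ker ⊓ (nh Q.s).ker)
  rw [two_tors _ t2, ← pow_succ] at cB
  obtain ⟨x, hx⟩ := herbrand Q.s Q.τ (δ L) Q.ss Q.ττ Q.δs Q.h90A Q.h90D r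
    (by rw [cE]; positivity) cE.le (by rw [cB]; exact Nat.pow_le_pow_right (by norm_num) (by omega))
    index_δ_ne_zero Q.hfinK Q.hidx (-1) hm1 hs1
  have hx' := congrArg Units.val hx
  rw [Units.val_mul, s_coe] at hx'
  obtain ⟨p, q, hpq⟩ := Q.hrep x
  rw [hpq] at hx'
  simp only [map_add, map_mul, AlgEquiv.commutes, Q.hσι, Units.val_neg, Units.val_one] at hx'
  refine ⟨p, q, FaithfulSMul.algebraMap_injective K L ?_⟩
  simp only [map_add, map_pow, map_neg, map_one]
  have := Q.hι
  linear_combination -hx' + (algebraMap K L q)^2 * this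

end QD

/-- Theorem T -/
theorem theoremT (K : Type) [Field K] [NumberField K] [IsTotallyComplex K] (b c : 𝓞 K) (hb : b ^ 2 + 1 = 4 * c) :
    ∃ u v : K, u ^ 2 + v ^ 2 = -1 := by
  by_cases hi : ∃ i : K, i ^ 2 = -1
  · obtain ⟨i, hi⟩ := hi
    exact ⟨i, 0, by rw [hi]; simp⟩
  push Not at hi
  let g : Polynomial K := Polynomial.X ^ 2 + 1
  have hgm : g.Monic := by unfold g; monicity!
  have hgd : g.natDegree = 2 := by unfold g; compute_degree!
  have hirr : Irreducible g := by
    rw [hgm.irreducible_iff_roots_eq_zero_of_degree_le_three (by rw [hgd]) (by rw [hgd]; norm_num)]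
    rw [Multiset.eq_zero_iff_forall_notMem]
    intro a ha
    rw [Polynomial.mem_roots hgm.ne_zero, Polynomial.IsRoot.def] at ha
    refine hi a ?_
    have : a ^ 2 + 1 = 0 := by simpa [g] using ha
    linear_combination this
  haveI : Fact (Irreducible g) := ⟨hirr⟩
  let L := AdjoinRoot g
  haveI : CharZero L := charZero_of_injective_algebraMap (algebraMap K L).injective
  haveI : FiniteDimensional K L := (AdjoinRoot.powerBasis hirr.ne_zero).finite
  haveI : NumberField L := by
    have := Module.Finite.trans (R := ℚ) K L
    constructor
  let ι : L := AdjoinRoot.root g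
  have hι : ι ^ 2 = -1 := by
    have := AdjoinRoot.eval₂_root g
    simp [g] at this
    linear_combination this
  let e : L →ₐ[K] L := AdjoinRoot.liftAlgHom g (Algebra.ofId K L) (-ι) (by
    simp [g, hι])
  have heι : e ι = -ι := AdjoinRoot.liftAlgHom_root _ _ _ _
  have hee : e.comp e = AlgHom.id K L := by
    apply AdjoinRoot.algHom_ext
    show e (e ι) = ι
    rw [heι, map_neg, heι, neg_neg]
  let σ : L ≃ₐ[K] L := AlgEquiv.ofAlgHom e e hee hee
  have hrep : ∀ x : L, ∃ p q : K, x = algebraMap K L p + algebraMap K L q * ι := by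
    intro x
    obtain ⟨f, rfl⟩ := AdjoinRoot.mk_surjective x
    have h1 : AdjoinRoot.mk g f = AdjoinRoot.mk g (f %ₘ g) := by
      rw [AdjoinRoot.mk_eq_mk]
      exact ⟨f /ₘ g, by linear_combination -Polynomial.modByMonic_add_div f g⟩
    have h2 : (f %ₘ g).natDegree ≤ 1 := by
      have := Polynomial.natDegree_modByMonic_lt f hgm (by intro h; rw [h] at hgd; simp at hgd)
      omega
    obtain ⟨q, p, hqp⟩ := Polynomial.exists_eq_X_add_C_of_natDegree_le_one h2
    refine ⟨p, q, ?_⟩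
    rw [h1, hqp, map_add, map_mul, AdjoinRoot.mk_X, AdjoinRoot.mk_C, AdjoinRoot.mk_C, add_comm]
    rfl
  exact QD.norm_neg_one (L := L) ⟨σ, ι, hι, heι, hrep, b, c, hb⟩
end FSq

end

noncomputable section
namespace FSq
open Polynomial NumberField

/-- sum of four squares -/
def Sq4 {R : Type*} [CommRing R] (x : R) : Prop := ∃ a b c d : R, x = a ^ 2 + b ^ 2 + c ^ 2 + d ^ 2

lemma Sq4.mul {R : Type*} [CommRing R] {x y : R} (hx : Sq4 x) (hy : Sq4 y) : Sq4 (x * y) := by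
  obtain ⟨a, b, c, d, rfl⟩ := hx
  obtain ⟨p, q, r, s, rfl⟩ := hy
  exact ⟨a * p - b * q - c * r - d * s, a * q + b * p + c * s - d * r,
    a * r - b * s + c * p + d * q, a * s + b * r - c * q + d * p, by ring⟩

lemma sq4_rat (q : ℚ) (hq : 0 ≤ q) : Sq4 q := by
  obtain ⟨a, b, c, d, h⟩ := Nat.sum_four_squares (q.num.toNat * q.den)
  have hd : (q.den : ℚ) ≠ 0 := by exact_mod_cast q.den_ne_zero
  refine ⟨a / q.den, b / q.den, c / q.den, d / q.den, ?_⟩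
  have h' : ((a : ℚ) ^ 2 + b ^ 2 + c ^ 2 + d ^ 2) = q.num * q.den := by
    have hn : ((q.num.toNat : ℤ) : ℚ) = q.num := by
      rw [Int.toNat_of_nonneg (Rat.num_nonneg.2 hq)]
    rw [← hn]; exact_mod_cast h
  have e : ((a : ℚ) / q.den) ^ 2 + (b / q.den) ^ 2 + (c / q.den) ^ 2 + (d / q.den) ^ 2 =
    ((a : ℚ) ^ 2 + b ^ 2 + c ^ 2 + d ^ 2) / q.den ^ 2 := by ring
  rw [e, h', eq_div_iff (pow_ne_zero 2 hd)]
  nth_rw 1 [← Rat.num_div_den q]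
  field_simp

lemma Sq4.C {q : ℚ} (h : Sq4 q) : Sq4 (C q : ℚ[X]) := by
  obtain ⟨a, b, c, d, rfl⟩ := h
  exact ⟨Polynomial.C a, Polynomial.C b, Polynomial.C c, Polynomial.C d, by simp⟩

lemma sq_sum_zero (a b c d : ℚ[X]) (h : a ^ 2 + b ^ 2 + c ^ 2 + d ^ 2 = 0) :
    a = 0 ∧ b = 0 ∧ c = 0 ∧ d = 0 := by
  have h' : ∀ t : ℚ, a.eval t = 0 ∧ b.eval t = 0 ∧ c.eval t = 0 ∧ d.eval t = 0 := by
    intro t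
    have := congrArg (Polynomial.eval t) h
    simp only [eval_add, eval_pow, eval_zero] at this
    refine ⟨?_, ?_, ?_, ?_⟩ <;> apply pow_eq_zero_iff (two_ne_zero) |>.1 <;>
      nlinarith [sq_nonneg (a.eval t), sq_nonneg (b.eval t), sq_nonneg (c.eval t), sq_nonneg (d.eval t)]
  refine ⟨?_, ?_, ?_, ?_⟩ <;> apply Polynomial.funext <;> intro t <;> simp [h' t]

lemma descent (π : ℚ[X]) (hπ : Irreducible π) : ∀ (n : ℕ) (h : ℚ[X]) (a b c d : ℚ[X]), h.natDegree = n →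
    h ≠ 0 → n < π.natDegree → π * h = a ^ 2 + b ^ 2 + c ^ 2 + d ^ 2 → ∃ q : ℚ, q ≠ 0 ∧ Sq4 (C q * π) := by
  intro n
  induction n using Nat.strong_induction_on with
  | _ n ih =>
  intro h a b c d hn h0 hlt heq
  rcases Nat.eq_zero_or_pos n with rfl | hnpos
  · obtain ⟨q, rfl⟩ := natDegree_eq_zero.1 hn
    refine ⟨q, fun h => h0 (by rw [h, C_0]), a, b, c, d, by rw [← heq, mul_comm]⟩
  have hd : ∀ x : ℚ[X], (x % h).natDegree < n := by
    intro x; rw [← hn]; exact natDegree_mod_lt x (by omega)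
  have he : ∀ x : ℚ[X], ∃ y z : ℚ[X], x = h * y + z ∧ z.natDegree < n := fun x =>
    ⟨x / h, x % h, (EuclideanDomain.div_add_mod x h).symm, hd x⟩
  obtain ⟨qa, ra, ha, hra⟩ := he a
  obtain ⟨qb, rb, hb, hrb⟩ := he b
  obtain ⟨qc, rc, hc, hrc⟩ := he c
  obtain ⟨qd, rd, hd', hrd⟩ := he d
  let h' := π - 2 * (a * qa + b * qb + c * qc + d * qd) + h * (qa ^ 2 + qb ^ 2 + qc ^ 2 + qd ^ 2)
  have key : h * h' = ra ^ 2 + rb ^ 2 + rc ^ 2 + rd ^ 2 := by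
    have e1 : ra = a - h * qa := by rw [ha]; ring
    have e2 : rb = b - h * qb := by rw [hb]; ring
    have e3 : rc = c - h * qc := by rw [hc]; ring
    have e4 : rd = d - h * qd := by rw [hd']; ring
    rw [e1, e2, e3, e4]
    linear_combination heq
  have hne : h' ≠ 0 := by
    intro hz
    rw [hz, mul_zero] at key
    obtain ⟨z1, z2, z3, z4⟩ := sq_sum_zero _ _ _ _ key.symm
    rw [z1, add_zero] at ha
    rw [z2, add_zero] at hb
    rw [z3, add_zero] at hc
    rw [z4, add_zero] at hd'
    have hdvd : π = h * (qa ^ 2 + qb ^ 2 + qc ^ 2 + qd ^ 2) := by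
      apply mul_right_cancel₀ h0
      rw [heq, ha, hb, hc, hd']; ring
    rcases hπ.isUnit_or_isUnit hdvd with hu | hu
    · have := natDegree_eq_zero_of_isUnit hu; omega
    · have h1 := natDegree_eq_zero_of_isUnit hu
      have h2 := congrArg natDegree hdvd
      rw [natDegree_mul h0 hu.ne_zero, h1] at h2
      omega
  have hdeg : h'.natDegree < n := by
    have h1 := congrArg natDegree key
    rw [natDegree_mul h0 hne, hn] at h1
    have h2 : (ra ^ 2 + rb ^ 2 + rc ^ 2 + rd ^ 2).natDegree ≤ 2 * (n - 1) := by
      have hp : ∀ x : ℚ[X], x.natDegree < n → (x ^ 2).natDegree ≤ 2 * (n - 1) := by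
        intro x hx; rw [natDegree_pow]; omega
      exact natDegree_add_le_of_degree_le (natDegree_add_le_of_degree_le
        (natDegree_add_le_of_degree_le (hp _ hra) (hp _ hrb)) (hp _ hrc)) (hp _ hrd)
    omega
  refine ih h'.natDegree hdeg h' (π - (a * qa + b * qb + c * qc + d * qd))
    (a * qb - b * qa + c * qd - d * qc) (a * qc - b * qd - c * qa + d * qb)
    (a * qd + b * qc - c * qb - d * qa) rfl hne (by omega) ?_
  simp only [h']
  linear_combination (qa ^ 2 + qb ^ 2 + qc ^ 2 + qd ^ 2) * heq

lemma prime_sq4 (π : ℚ[X]) (hπ : Irreducible π) (u v : ℚ[X]) (huv : π ∣ u ^ 2 + v ^ 2 + 1) :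
    ∃ q : ℚ, q ≠ 0 ∧ Sq4 (C q * π) := by
  have hpd : 0 < π.natDegree := hπ.natDegree_pos
  obtain ⟨h, hh⟩ : π ∣ (u % π) ^ 2 + (v % π) ^ 2 + 1 := by
    have h1 : ∀ x : ℚ[X], x = π * (x / π) + x % π := fun x => (EuclideanDomain.div_add_mod x π).symm
    obtain ⟨k, hk⟩ := huv
    have hu := h1 u
    have hv := h1 v
    set u' := u % π
    set v' := v % π
    refine ⟨k - (u / π) * (u + u') - (v / π) * (v + v'), ?_⟩
    have hu' : u' = u - π * (u / π) := by linear_combination -hu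
    have hv' : v' = v - π * (v / π) := by linear_combination -hv
    rw [hu', hv']
    linear_combination hk
  have h0 : h ≠ 0 := by
    rintro rfl
    have := sq_sum_zero (u % π) (v % π) 1 0 (by linear_combination hh)
    exact one_ne_zero this.2.2.1
  have hdu := natDegree_mod_lt u hpd.ne'
  have hdv := natDegree_mod_lt v hpd.ne'
  refine descent π hπ h.natDegree h (u % π) (v % π) 1 0 rfl h0 ?_ (by linear_combination -hh)
  have h1 := congrArg natDegree hh
  rw [natDegree_mul hπ.ne_zero h0] at h1
  have h2 : ((u % π) ^ 2 + (v % π) ^ 2 + 1).natDegree ≤ 2 * (π.natDegree - 1) := by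
    have hp : ∀ x : ℚ[X], x.natDegree < π.natDegree → (x ^ 2).natDegree ≤ 2 * (π.natDegree - 1) := by
      intro x hx; rw [natDegree_pow]; omega
    exact natDegree_add_le_of_degree_le (natDegree_add_le_of_degree_le (hp _ hdu) (hp _ hdv)) (by simp)
  omega

lemma all_sq4 (g : ℚ[X]) (hg : 0 < g.eval 0)
    (hp : ∀ π, Irreducible π → π ∣ g → ∃ q : ℚ, q ≠ 0 ∧ Sq4 (C q * π)) : Sq4 g := by
  have hg0 : g ≠ 0 := by rintro rfl; simp at hg
  have main : ∀ x : ℚ[X], x ∣ g → ∃ q : ℚ, q ≠ 0 ∧ Sq4 (C q * x) := by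
    intro x
    induction x using UniqueFactorizationMonoid.induction_on_prime with
    | h₁ => intro h; exact absurd (zero_dvd_iff.1 h) hg0
    | h₂ x hx =>
      intro _
      obtain ⟨r, hr, rfl⟩ := Polynomial.isUnit_iff.1 hx
      refine ⟨r⁻¹, inv_ne_zero hr.ne_zero, ?_⟩
      rw [← C_mul, inv_mul_cancel₀ hr.ne_zero]
      exact (sq4_rat 1 zero_le_one).C
    | h₃ a p ha hpr ih =>
      intro hd
      obtain ⟨q1, hq1, h1⟩ := ih ((dvd_mul_left a p).trans hd)
      obtain ⟨q2, hq2, h2⟩ := hp p hpr.irreducible ((dvd_mul_right p a).trans hd)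
      refine ⟨q2 * q1, mul_ne_zero hq2 hq1, ?_⟩
      have := h2.mul h1
      rwa [show C q2 * p * (C q1 * a) = C (q2 * q1) * (p * a) by rw [C_mul]; ring] at this
  obtain ⟨q, hq, h⟩ := main g dvd_rfl
  have hqpos : 0 < q := by
    obtain ⟨a, b, c, d, he⟩ := h
    have := congrArg (Polynomial.eval 0) he
    simp only [eval_mul, eval_C, eval_add, eval_pow] at this
    have h1 : 0 ≤ q * g.eval 0 := by rw [this]; positivity
    have h2 : 0 ≤ q := nonneg_of_mul_nonneg_left h1 hg
    exact lt_of_le_of_ne h2 hq.symm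
  have := (sq4_rat q⁻¹ (inv_nonneg.2 hqpos.le)).C.mul h
  rwa [← mul_assoc, ← C_mul, inv_mul_cancel₀ hq, C_1, one_mul] at this

end FSq

end

noncomputable section
namespace FSq
open Polynomial Filter Topology

lemma lower_bound (f : ℤ[X]) (m : ℕ) (hm : 1 ≤ m) (hdeg : f.natDegree = 2 * m)
    (hpos : ∀ t : ℝ, 0 < aeval t f) : ∃ ε : ℝ, 0 < ε ∧ ∀ t : ℝ, ε * (1 + t ^ (2 * m)) ≤ aeval t f := by
  have aux : ∀ F : ℝ[X], F.natDegree = 2 * m → (∀ t : ℝ, 0 < F.eval t) →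
      ∃ ε : ℝ, 0 < ε ∧ ∃ A : ℝ, ∀ t ≥ A, ε * (1 + t ^ (2 * m)) ≤ F.eval t := by
    intro F hF hFp
    have hF0 : F ≠ 0 := by rintro rfl; simpa using hFp 0
    let G : ℝ[X] := 1 + X ^ (2 * m)
    have hG : G.natDegree = 2 * m := by
      unfold G
      rw [natDegree_add_eq_right_of_natDegree_lt (by simp; omega), natDegree_X_pow]
    have hGe : ∀ t, G.eval t = 1 + t ^ (2 * m) := by intro t; simp [G]
    have hGp : ∀ t, 0 < G.eval t := by
      intro t; rw [hGe, pow_mul]; positivity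
    have hG0 : G ≠ 0 := by intro h; have := hGp 0; rw [h] at this; simp at this
    have hGl : G.leadingCoeff = 1 := by
      rw [leadingCoeff, hG]; unfold G; simp [coeff_one]; omega
    have ht := Polynomial.div_tendsto_leadingCoeff_div_of_degree_eq F G
      (by rw [degree_eq_natDegree hF0, degree_eq_natDegree hG0, hF, hG])
    rw [hGl, div_one] at ht
    have hl : 0 ≤ F.leadingCoeff := ge_of_tendsto' ht fun t => (div_pos (hFp t) (hGp t)).le
    have hl' : 0 < F.leadingCoeff := lt_of_le_of_ne hl (leadingCoeff_ne_zero.2 hF0).symm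
    obtain ⟨A, hA⟩ := eventually_atTop.1 (ht.eventually (lt_mem_nhds (half_lt_self hl')))
    refine ⟨F.leadingCoeff / 2, by positivity, A, fun t htA => ?_⟩
    have := hA t htA
    rw [lt_div_iff₀ (hGp t), hGe] at this
    exact this.le
  let F : ℝ[X] := f.map (Int.castRingHom ℝ)
  have hFe : ∀ t, F.eval t = aeval t f := by
    intro t; rw [eval_map]; rfl
  have hFd : F.natDegree = 2 * m := by
    rw [← hdeg]; exact natDegree_map_eq_of_injective (Int.cast_injective) f
  obtain ⟨ε₁, h1, A, hA⟩ := aux F hFd (fun t => by rw [hFe]; exact hpos t)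
  obtain ⟨ε₂, h2, B, hB⟩ := aux (F.comp (-X)) (by rw [natDegree_comp, hFd]; simp)
    (fun t => by rw [eval_comp, hFe]; exact hpos _)
  obtain ⟨t₀, ht₀, hmin⟩ := (isCompact_Icc (a := -|A| - |B|) (b := |A| + |B|)).exists_isMinOn
    (f := fun t => F.eval t / (1 + t ^ (2 * m))) ⟨0, by constructor <;> linarith [abs_nonneg A, abs_nonneg B]⟩
    (by
      apply Continuous.continuousOn
      refine F.continuous.div (by fun_prop) (fun t => ?_)
      rw [pow_mul]; positivity)
  have hq : ∀ t : ℝ, 0 < 1 + t ^ (2 * m) := by intro t; rw [pow_mul]; positivity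
  set ε₃ := F.eval t₀ / (1 + t₀ ^ (2 * m)) with hε₃
  have h3 : 0 < ε₃ := div_pos (by rw [hFe]; exact hpos _) (hq _)
  refine ⟨min ε₁ (min ε₂ ε₃), by simp [h1, h2, h3], fun t => ?_⟩
  rw [← hFe]
  by_cases hcA : A ≤ t
  · exact (mul_le_mul_of_nonneg_right (min_le_left _ _) (hq t).le).trans (hA t hcA)
  by_cases hcB : B ≤ -t
  · have := hB (-t) hcB
    rw [eval_comp, eval_neg, eval_X, neg_neg, Even.neg_pow (even_two_mul m)] at this
    exact (mul_le_mul_of_nonneg_right ((min_le_right _ _).trans (min_le_left _ _)) (hq t).le).trans this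
  · push Not at hcA hcB
    have hmem : t ∈ Set.Icc (-|A| - |B|) (|A| + |B|) := by
      constructor
      · linarith [le_abs_self B, abs_nonneg A]
      · linarith [le_abs_self A, abs_nonneg B]
    have := hmin hmem
    simp only [Set.mem_ofPred_eq] at this
    rw [← hε₃, le_div_iff₀ (hq t)] at this
    exact (mul_le_mul_of_nonneg_right ((min_le_right _ _).trans (min_le_right _ _)) (hq t).le).trans this

lemma choose_params (f : ℤ[X]) (m : ℕ) (hm : 1 ≤ m) (hdeg : f.natDegree = 2 * m)
    (hpos : ∀ t : ℝ, 0 < aeval t f) (a M : ℕ) : ∃ N ℓ : ℕ, Odd N ∧ M ≤ ℓ ∧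
      ∀ t : ℝ, ((1 : ℝ) / 2 ^ ℓ * t ^ m + 2 ^ a / N) ^ 2 < aeval t f := by
  obtain ⟨ε, hε, hb⟩ := lower_bound f m hm hdeg hpos
  obtain ⟨l, hl⟩ := exists_nat_gt (2 / ε)
  obtain ⟨n, hn⟩ := exists_nat_gt (2 * (2 ^ a) ^ 2 / ε)
  refine ⟨2 * n + 1, l + M, ⟨n, rfl⟩, by omega, fun t => lt_of_lt_of_le ?_ (hb t)⟩
  set p : ℝ := 1 / 2 ^ (l + M) with hp
  set q : ℝ := 2 ^ a / ((2 * n + 1 : ℕ) : ℝ) with hq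
  have hp2 : 2 * p ^ 2 ≤ ε := by
    have h1 : (l : ℝ) ≤ 2 ^ (l + M) := by
      have : l + M < 2 ^ (l + M) := Nat.lt_two_pow_self
      have : l ≤ 2 ^ (l + M) := by omega
      exact_mod_cast this
    have h2 : (1 : ℝ) ≤ 2 ^ (l + M) := one_le_pow₀ (by norm_num)
    rw [div_lt_iff₀ hε] at hl
    have hP : (0 : ℝ) < 2 ^ (l + M) := by positivity
    rw [hp, div_pow, one_pow, mul_one_div, div_le_iff₀ (by positivity)]
    have h3 : (l : ℝ) ≤ (2 ^ (l + M)) ^ 2 := by nlinarith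
    have h4 := mul_le_mul_of_nonneg_left h3 hε.le
    linarith
  have hq2 : 2 * q ^ 2 < ε := by
    rw [div_lt_iff₀ hε] at hn
    have hN : (0 : ℝ) < ((2 * n + 1 : ℕ) : ℝ) := by positivity
    rw [hq, div_pow, ← mul_div_assoc, div_lt_iff₀ (by positivity)]
    have h1 : (n : ℝ) ≤ ((2 * n + 1 : ℕ) : ℝ) ^ 2 := by
      have : n ≤ (2 * n + 1) ^ 2 := by nlinarith
      exact_mod_cast this
    nlinarith
  have e : t ^ (2 * m) = (t ^ m) ^ 2 := by rw [mul_comm, pow_mul]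
  rw [e]
  nlinarith [sq_nonneg (p * t ^ m - q), mul_le_mul_of_nonneg_right hp2 (sq_nonneg (t ^ m))]

end FSq

end

noncomputable section
namespace FSq
open Polynomial NumberField

lemma denom_pow {K : Type*} [Field K] (D : ℤ) (y : K) (h : IsIntegral ℤ ((D : K) * y)) (W : ℤ[X]) :
    ∃ n : ℕ, IsIntegral ℤ ((D : K) ^ n * aeval y W) := by
  have hD : IsIntegral ℤ (D : K) := isIntegral_algebraMap (R := ℤ) (x := D)
  induction W using Polynomial.induction_on' with
  | add p q hp hq =>
    obtain ⟨n1, h1⟩ := hp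
    obtain ⟨n2, h2⟩ := hq
    refine ⟨n1 + n2, ?_⟩
    have : (D : K) ^ (n1 + n2) * aeval y (p + q) =
      (D : K) ^ n2 * ((D : K) ^ n1 * aeval y p) + (D : K) ^ n1 * ((D : K) ^ n2 * aeval y q) := by
      rw [map_add]; ring
    rw [this]
    exact ((hD.pow _).mul h1).add ((hD.pow _).mul h2)
  | monomial n c =>
    refine ⟨n, ?_⟩
    rw [aeval_monomial]
    have : (D : K) ^ n * (algebraMap ℤ K c * y ^ n) = algebraMap ℤ K c * ((D : K) * y) ^ n := by ring
    rw [this]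
    exact isIntegral_algebraMap.mul (h.pow _)

/-- 2-adic integrality -/
lemma y_integral {K : Type*} [Field K] [CharZero K] (f : ℤ[X]) (m : ℕ) (hm : 1 ≤ m) (hdeg : f.natDegree = 2 * m)
    (a M l N : ℕ) (hN : Odd N) (hl : 1 ≤ l) (y : K)
    (hy : aeval ((2 : K) ^ M * y) f = (1 / 2 ^ (M * m + l) * ((2 : K) ^ M * y) ^ m + 2 ^ a / N) ^ 2) :
    ∃ D : ℤ, Odd D ∧ IsIntegral ℤ ((D : K) * y) := by
  let H : ℤ[X] := C ((N : ℤ) ^ 2 * 4 ^ l) * f.comp (C (2 ^ M) * X) - (C (N : ℤ) * X ^ m + C (2 ^ (a + l))) ^ 2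
  have hN0 : (N : K) ≠ 0 := by
    have := hN.pos; exact_mod_cast this.ne'
  have hH : aeval y H = 0 := by
    simp only [H, map_sub, map_mul, map_pow, map_add, aeval_C, aeval_X, aeval_comp]
    simp only [map_natCast, eq_intCast, Int.cast_mul, Int.cast_pow, Int.cast_ofNat, Int.cast_natCast]
    rw [hy]
    have h2 : (4 : K) ^ l = (2 ^ l) ^ 2 := by rw [← pow_mul, mul_comm, pow_mul]; norm_num
    rw [h2]
    field_simp
    ring
  have hE : (C (N : ℤ) * X ^ m + C ((2 : ℤ) ^ (a + l)) : ℤ[X]) ^ 2 =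
      C ((N : ℤ) ^ 2) * X ^ (2 * m) + C (2 * (N : ℤ) * 2 ^ (a + l)) * X ^ m +
        C (((2 : ℤ) ^ (a + l)) ^ 2) := by
    have h2 : (C (2 : ℤ) : ℤ[X]) = 2 := map_ofNat C 2
    simp only [C_mul, C_pow, h2]
    rw [ mul_comm 2 m, pow_mul]
    ring
  have hcoef : H.coeff (2 * m) = N ^ 2 * (4 ^ l * (f.coeff (2 * m) * (2 ^ M) ^ (2 * m)) - 1) := by
    simp only [H]
    rw [hE, coeff_sub, coeff_C_mul, comp_C_mul_X_coeff]
    simp only [coeff_add, coeff_C_mul, coeff_X_pow, coeff_C]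
    rw [if_pos trivial, if_neg (by omega), if_neg (by omega)]
    ring
  have hodd : Odd (H.coeff (2 * m)) := by
    rw [hcoef]
    refine Odd.mul (Odd.pow (by exact_mod_cast hN)) ?_
    apply Even.sub_odd _ odd_one
    apply Even.mul_right
    exact (by decide : Even (4:ℤ)).pow_of_ne_zero (by omega)
  have hdH : H.natDegree ≤ 2 * m := by
    simp only [H]
    rw [hE]
    refine (natDegree_sub_le_of_le (m := 2 * m) (n := 2 * m) ?_ ?_).trans (by simp)
    · refine (natDegree_C_mul_le _ _).trans ((natDegree_comp_le).trans ?_)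
      rw [hdeg]
      calc 2 * m * (C (2 ^ M) * X : ℤ[X]).natDegree ≤ 2 * m * 1 :=
            Nat.mul_le_mul_left _ ((natDegree_C_mul_le _ _).trans natDegree_X_le)
        _ = 2 * m := mul_one _
    · refine natDegree_add_le_of_degree_le (natDegree_add_le_of_degree_le ?_ ?_) (by simp)
      · exact (natDegree_C_mul_le _ _).trans (natDegree_X_pow_le _)
      · exact (natDegree_C_mul_le _ _).trans ((natDegree_X_pow_le _).trans (by omega))
  have hne : H.coeff (2 * m) ≠ 0 := by
    intro h; rw [h] at hodd; exact absurd hodd (by decide)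
  have hlead : H.leadingCoeff = H.coeff (2 * m) := by
    rw [leadingCoeff, le_antisymm hdH (le_natDegree_of_ne_zero hne)]
  refine ⟨H.coeff (2 * m), hodd, ?_⟩
  have := isIntegral_leadingCoeff_smul H y hH
  rwa [hlead, zsmul_eq_mul] at this

lemma exists_b {K : Type*} [Field K] [NumberField K] (f : ℤ[X]) (m : ℕ) (hm : 1 ≤ m) (hdeg : f.natDegree = 2 * m)
    (a k l N : ℕ) (hc : f.coeff 0 = 2 ^ (2 * a) * (4 * k + 3)) (hN : Odd N) (hl : 1 ≤ l) (θ : K)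
    (hθ : aeval θ f = (1 / 2 ^ ((2 * a + 2) * m + l) * θ ^ m + 2 ^ a / N) ^ 2) :
    ∃ b c : 𝓞 K, b ^ 2 + 1 = 4 * c := by
  set M := 2 * a + 2 with hM
  obtain ⟨y, rfl⟩ : ∃ y : K, θ = 2 ^ M * y := ⟨θ / 2 ^ M, by field_simp⟩
  obtain ⟨D, hD, hDy⟩ := y_integral f m hm hdeg a M l N hN hl y hθ
  set z : K := (1 / 2 ^ (M * m + l) * (2 ^ M * y) ^ m + 2 ^ a / N) / 2 ^ a with hz
  let W : ℤ[X] := X * f.divX.comp (C (2 ^ M) * X)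
  have hf : aeval (2 ^ M * y) f = 2 ^ (2 * a) * (4 * k + 3) + 2 ^ M * aeval y W := by
    conv_lhs => rw [← divX_mul_X_add f]
    simp only [W, map_add, map_mul, aeval_X, aeval_C, hc, aeval_comp, map_pow]
    simp only [eq_intCast, map_natCast, Int.cast_add, Int.cast_mul, Int.cast_pow, Int.cast_ofNat, Int.cast_natCast]
    ring
  have hz2 : z ^ 2 = 4 * k + 3 + 4 * aeval y W := by
    rw [hz, div_pow, ← hθ, hf, hM, ← pow_mul, mul_comm a 2, pow_add, div_eq_iff (pow_ne_zero _ two_ne_zero)]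
    ring
  obtain ⟨n, hn⟩ := denom_pow D y hDy W
  have hDn : Odd (D ^ n) := hD.pow
  obtain ⟨j, hj⟩ := hDn
  have hDnK : (D : K) ^ n = 2 * (j : K) + 1 := by exact_mod_cast congrArg (Int.cast : ℤ → K) hj
  obtain ⟨w, hw⟩ : ∃ w : 𝓞 K, (w : K) = (D : K) ^ n * aeval y W := ⟨⟨_, hn⟩, rfl⟩
  have hb2 : ((D : K) ^ n * z) ^ 2 = (2 * (j : K) + 1) ^ 2 * (4 * k + 3) + 4 * (2 * j + 1) * (w : K) := by
    rw [hw, mul_pow, hz2, hDnK]; ring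
  have hbi : IsIntegral ℤ ((D : K) ^ n * z) := by
    apply IsIntegral.of_pow (n := 2) (by norm_num)
    rw [hb2]
    have : IsIntegral ℤ (((((2 * (j : 𝓞 K) + 1) ^ 2 * (4 * k + 3) + 4 * (2 * j + 1) * w) : 𝓞 K)) : K) :=
      RingOfIntegers.isIntegral_coe _
    have e2 : algebraMap (𝓞 K) K 2 = 2 := map_ofNat _ 2
    have e3 : algebraMap (𝓞 K) K 3 = 3 := map_ofNat _ 3
    have e4 : algebraMap (𝓞 K) K 4 = 4 := map_ofNat _ 4
    simpa [e2, e3, e4] using this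
  obtain ⟨b, hb⟩ : ∃ b : 𝓞 K, (b : K) = (D : K) ^ n * z := ⟨⟨_, hbi⟩, rfl⟩
  refine ⟨b, (j ^ 2 + j) * (4 * k + 3) + (k + 1) + (2 * j + 1) * w, ?_⟩
  apply RingOfIntegers.ext
  simp only [map_add, map_mul, map_pow, map_one, map_natCast, map_intCast, map_ofNat]
  have hb' : algebraMap (𝓞 K) K b = (D : K) ^ n * z := hb
  rw [hb', hb2]; ring

lemma totally_complex {K : Type*} [Field K] [NumberField K] (g : ℚ[X]) (θ : K) (hθ : aeval θ g = 0)
    (hg : ∀ t : ℝ, aeval t g ≠ 0) : IsTotallyComplex K := by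
  refine ⟨fun v => ?_⟩
  rw [← InfinitePlace.not_isReal_iff_isComplex]
  rintro ⟨φ, hφ, rfl⟩
  have h1 : ((φ θ).re : ℂ) = φ θ := by
    have := RingHom.congr_fun hφ θ
    exact Complex.conj_eq_iff_re.1 this
  apply hg (φ θ).re
  have h2 : aeval (φ θ) g = 0 := by
    have : φ.toRatAlgHom (aeval θ g) = aeval (φ θ) g := (aeval_algHom_apply φ.toRatAlgHom θ g).symm
    rw [← this, hθ, map_zero]
  have h3 : ((aeval (φ θ).re g : ℝ) : ℂ) = aeval (((φ θ).re : ℝ) : ℂ) g :=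
    (aeval_algebraMap_apply ℂ (φ θ).re g).symm
  rw [h1, h2] at h3
  exact_mod_cast h3

end FSq

end

theorem subtract_square_of_half_degree_poly_sum_of_four_squares
    (f : Polynomial ℤ) (m : ℕ) (hm : 1 ≤ m) (hdeg : f.natDegree = 2 * m)
    (hpos : ∀ t : ℝ, 0 < Polynomial.aeval t f)
    (a k : ℕ) (hc : f.coeff 0 = 2 ^ (2 * a) * (4 * k + 3)) :
    ∃ N ℓ : ℕ, Odd N ∧
      ∃ p₁ p₂ p₃ p₄ : Polynomial ℚ,
        f.map (Int.castRingHom ℚ) -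
            (C ((1 : ℚ) / 2 ^ ℓ) * X ^ m + C ((2 ^ a : ℚ) / N)) ^ 2 =
          p₁ ^ 2 + p₂ ^ 2 + p₃ ^ 2 + p₄ ^ 2 := by
  obtain ⟨N, ℓ, hN, hℓ, hlt⟩ := FSq.choose_params f m hm hdeg hpos a ((2 * a + 2) * m + 1)
  refine ⟨N, ℓ, hN, ?_⟩
  obtain ⟨l, rfl⟩ : ∃ l, ℓ = (2 * a + 2) * m + l := ⟨ℓ - (2 * a + 2) * m, by omega⟩
  have hl : 1 ≤ l := by omega
  set g : ℚ[X] := f.map (Int.castRingHom ℚ) -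
            (C ((1 : ℚ) / 2 ^ ((2 * a + 2) * m + l)) * X ^ m + C ((2 ^ a : ℚ) / N)) ^ 2 with hg
  have hge : ∀ (F : Type) [Field F] [Algebra ℚ F] (t : F), aeval t g =
      aeval t f - (1 / 2 ^ ((2 * a + 2) * m + l) * t ^ m + 2 ^ a / N) ^ 2 := by
    intro F _ _ t
    have e : aeval t (f.map (Int.castRingHom ℚ)) = aeval t f := 
      aeval_map_algebraMap ℚ t f
    rw [hg, map_sub, e]
    simp
  have hgpos : ∀ t : ℝ, 0 < aeval t g := fun t => by
    rw [hge]; exact sub_pos.2 (hlt t)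
  refine FSq.all_sq4 g ?_ ?_
  · have h1 := hgpos ((0 : ℚ) : ℝ)
    have h2 : aeval (((0 : ℚ) : ℝ)) g = ((g.eval 0 : ℚ) : ℝ) := by
      have := aeval_algebraMap_apply ℝ (0 : ℚ) g
      simpa using this
    rw [h2] at h1
    exact_mod_cast h1
  · intro π hπ hdvd
    have : Fact (Irreducible π) := ⟨hπ⟩
    let K := AdjoinRoot π
    have hcz : CharZero K := charZero_of_injective_algebraMap (algebraMap ℚ K).injective
    have hfd : FiniteDimensional ℚ K := (AdjoinRoot.powerBasis hπ.ne_zero).finite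
    have hnf : NumberField K := by
      constructor
    let θ : K := AdjoinRoot.root π
    have hθ : aeval θ g = 0 := by
      obtain ⟨r, hr⟩ := hdvd
      rw [hr, map_mul]
      have : aeval θ π = 0 := by
        have e : algebraMap ℚ K = AdjoinRoot.of π := Subsingleton.elim _ _
        rw [aeval_def, e]
        exact AdjoinRoot.eval₂_root π
      rw [this, zero_mul]
    have htc := FSq.totally_complex g θ hθ (fun t => (hgpos t).ne')
    obtain ⟨b, c, hbc⟩ := FSq.exists_b f m hm hdeg a k l N hc hN hl θ (by
      rw [hge] at hθ
      exact sub_eq_zero.1 hθ)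
    obtain ⟨u, v, huv⟩ := FSq.theoremT K b c hbc
    obtain ⟨u, rfl⟩ := AdjoinRoot.mk_surjective u
    obtain ⟨v, rfl⟩ := AdjoinRoot.mk_surjective v
    refine FSq.prime_sq4 π hπ u v ?_
    rw [← AdjoinRoot.mk_eq_zero, map_add, map_add, map_pow, map_pow, map_one]
    linear_combination huv
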